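/- arXiv:2305.00563 — 3 statements merged into one kernel-verified Lean document; each statement's English description precedes it below -/
import Mathlib

section
/- The integer relation 16·H_4(1/2) = ζ(4) + 48·Li_4(−1/2) − 8·ζ(2)·Li_2(1/4) + (12·Li_3(1/4) + 16·ζ(2)·log(3) − 42·ζ(3))·log(2) + (12·Li_2(1/4) − 4·ζ(2))·log²(2) − 8·log(3)·log³(2) + 10·log⁴(2) holds. -/
/-- The classical polylogarithm `Li_k(z) = ∑_{n≥1} z^n/n^k`. -/
noncomputable def Li (k : ℕ) (z : ℝ) : ℝ :=
  ∑' n : ℕ, z ^ (n + 1) / ((n : ℝ) + 1) ^ k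

/-- `ζ_k = Li_k(1)`. -/
noncomputable def zeta' (k : ℕ) : ℝ := Li k 1

/-- The hard integral `H₄(y)` at weight four. -/
noncomputable def H4 (y : ℝ) : ℝ :=
  ∫ x in (0 : ℝ)..y,
    (Real.log (x / (1 + 2 * x)) * Li 2 x + (1 / 2) * (Real.log x) ^ 2 * Li 1 (-2 * x))
      / (x * (1 + x))

section
open Set

namespace H4P

noncomputable def g (k : ℕ) (z : ℝ) : ℝ := ∑' n : ℕ, z ^ n / ((n : ℝ) + 1) ^ k

lemma Li_eq (k : ℕ) (z : ℝ) : Li k z = z * g k z := by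
  unfold Li g
  rw [← tsum_mul_left]
  congr 1; ext n; rw [pow_succ]; ring

lemma Li_zero (k : ℕ) : Li k 0 = 0 := by rw [Li_eq]; simp

lemma summ_lt (k : ℕ) {z : ℝ} (hz : |z| < 1) : Summable (fun n : ℕ => z ^ n / ((n : ℝ) + 1) ^ k) := by
  refine Summable.of_norm_bounded (summable_geometric_of_lt_one (abs_nonneg z) hz) ?_
  intro n
  rw [norm_div, norm_pow, Real.norm_eq_abs]
  apply div_le_self (by positivity)
  rw [Real.norm_eq_abs, abs_of_nonneg (by positivity)]
  apply one_le_pow₀; linarith [(Nat.cast_nonneg n : (0:ℝ) ≤ n)]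

lemma summ_inv {k : ℕ} (hk : 2 ≤ k) : Summable (fun n : ℕ => 1 / ((n : ℝ) + 1) ^ k) := by
  have := (summable_nat_add_iff (f := fun n : ℕ => 1 / (n : ℝ) ^ k) 1).2
    (Real.summable_one_div_nat_pow.2 (by omega))
  simpa using this

lemma term_bd (k : ℕ) {z : ℝ} (hz : |z| ≤ 1) (n : ℕ) :
    ‖z ^ n / ((n : ℝ) + 1) ^ k‖ ≤ 1 / ((n : ℝ) + 1) ^ k := by
  rw [norm_div, norm_pow, Real.norm_eq_abs, Real.norm_eq_abs,
    abs_of_nonneg (by positivity : (0:ℝ) ≤ ((n : ℝ) + 1) ^ k)]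
  gcongr
  exact pow_le_one₀ (abs_nonneg _) hz

lemma summ_le {k : ℕ} (hk : 2 ≤ k) {z : ℝ} (hz : |z| ≤ 1) :
    Summable (fun n : ℕ => z ^ n / ((n : ℝ) + 1) ^ k) :=
  Summable.of_norm_bounded (summ_inv hk) (term_bd k hz)

lemma cont_g {k : ℕ} (hk : 2 ≤ k) : ContinuousOn (g k) (Icc (-1) 1) := by
  unfold g
  apply continuousOn_tsum (u := fun n : ℕ => 1 / ((n : ℝ) + 1) ^ k)
  · intro n; fun_prop
  · exact summ_inv hk
  · intro n x hx
    exact term_bd k (abs_le.2 hx) n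

lemma cont_Li {k : ℕ} (hk : 2 ≤ k) : ContinuousOn (Li k) (Icc (-1) 1) := by
  have : Li k = fun z => z * g k z := by ext z; exact Li_eq k z
  rw [this]
  exact continuousOn_id.mul (cont_g hk)

lemma hasDerivAt_Li_g (k : ℕ) {z : ℝ} (hz : |z| < 1) : HasDerivAt (Li (k+1)) (g k z) z := by
  obtain ⟨r, hr1, hr2⟩ := exists_between hz
  have hr0 : 0 < r := lt_of_le_of_lt (abs_nonneg z) hr1
  unfold Li g
  apply hasDerivAt_tsum_of_isPreconnected (u := fun n : ℕ => r ^ n)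
    (summable_geometric_of_lt_one hr0.le hr2) (t := Ioo (-r) r) isOpen_Ioo
    (isPreconnected_Ioo) (g := fun n y => y ^ (n + 1) / ((n : ℝ) + 1) ^ (k+1))
    (g' := fun n y => y ^ n / ((n : ℝ) + 1) ^ k) (y₀ := 0)
  · intro n y hy
    have h := (hasDerivAt_pow (n+1) y).div_const (((n : ℝ) + 1) ^ (k+1))
    refine h.congr_deriv ?_
    have : ((n:ℝ)+1) ≠ 0 := by positivity
    push_cast
    field_simp
    ring
  · intro n y hy
    rw [norm_div, norm_pow, Real.norm_eq_abs]
    have h1 : |y| ≤ r := abs_le.2 ⟨hy.1.le, hy.2.le⟩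
    refine (div_le_self (by positivity) ?_).trans (pow_le_pow_left₀ (abs_nonneg _) h1 n)
    rw [Real.norm_eq_abs, abs_of_nonneg (by positivity)]
    apply one_le_pow₀; linarith [(Nat.cast_nonneg n : (0:ℝ) ≤ n)]
  · exact ⟨by linarith, hr0⟩
  · simp
  · exact abs_lt.1 hr1

lemma cont_g_lt (k : ℕ) : ContinuousOn (g k) (Ioo (-1) 1) := by
  intro z hz
  apply ContinuousAt.continuousWithinAt
  obtain ⟨r, hr1, hr2⟩ := exists_between (abs_lt.2 hz)
  have hr0 : 0 < r := lt_of_le_of_lt (abs_nonneg z) hr1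
  have : ContinuousOn (g k) (Icc (-r) r) := by
    unfold g
    apply continuousOn_tsum (u := fun n : ℕ => r ^ n)
    · intro n; fun_prop
    · exact summable_geometric_of_lt_one hr0.le hr2
    · intro n y hy
      rw [norm_div, norm_pow, Real.norm_eq_abs]
      have h1 : |y| ≤ r := abs_le.2 hy
      refine (div_le_self (by positivity) ?_).trans (pow_le_pow_left₀ (abs_nonneg _) h1 n)
      rw [Real.norm_eq_abs, abs_of_nonneg (by positivity)]
      apply one_le_pow₀; linarith [(Nat.cast_nonneg n : (0:ℝ) ≤ n)]
  exact this.continuousAt (Icc_mem_nhds (abs_lt.1 hr1).1 (abs_lt.1 hr1).2)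

lemma hasDerivAt_Li (k : ℕ) {z : ℝ} (hz : |z| < 1) (h0 : z ≠ 0) :
    HasDerivAt (Li (k+1)) (Li k z / z) z := by
  convert hasDerivAt_Li_g k hz using 1
  rw [Li_eq]; field_simp

lemma Li_one {z : ℝ} (hz : |z| < 1) : Li 1 z = - Real.log (1 - z) := by
  have := (Real.hasSum_pow_div_log_of_abs_lt_one hz).tsum_eq
  unfold Li
  simpa using this

lemma Li_dup {k : ℕ} (hk : 2 ≤ k) {z : ℝ} (hz : |z| ≤ 1) :
    2 * Li k (z^2) = 2^k * (Li k z + Li k (-z)) := by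
  have hs : Summable (fun n : ℕ => z ^ (n+1) / ((n : ℝ) + 1) ^ k) := by
    refine ((summ_le hk hz).mul_left z).congr ?_
    intro n; rw [pow_succ]; ring
  have hs' : Summable (fun n : ℕ => (-z) ^ (n+1) / ((n : ℝ) + 1) ^ k) := by
    refine ((summ_le hk (z := -z) (by simpa using hz)).mul_left (-z)).congr ?_
    intro n; rw [pow_succ]; ring
  have h := (hs.add hs')
  unfold Li
  rw [← hs.tsum_add hs']
  rw [← tsum_even_add_odd (f := fun n : ℕ => z ^ (n+1) / ((n : ℝ) + 1) ^ k + (-z) ^ (n+1) / ((n : ℝ) + 1) ^ k)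
    (h.comp_injective (i := fun n => 2 * n) (fun a b hab => by simpa using hab))
    (h.comp_injective (i := fun n => 2 * n + 1) (fun a b hab => by simpa using hab))]
  have e1 : ∀ n : ℕ, z ^ (2*n+1) / (((2*n : ℕ) : ℝ) + 1) ^ k + (-z) ^ (2*n+1) / (((2*n:ℕ) : ℝ) + 1) ^ k = 0 := by
    intro n
    rw [Odd.neg_pow ⟨n, rfl⟩]; ring
  simp only [e1, tsum_zero, zero_add]
  rw [← tsum_mul_left, ← tsum_mul_left]
  congr 1; ext n
  have : ((2 * n + 1 : ℕ) : ℝ) + 1 = 2 * ((n:ℝ)+1) := by push_cast; ring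
  rw [this, mul_pow, show (2*n+1+1) = 2 * (n+1) by ring, pow_mul, pow_mul, neg_sq]
  have : ((n:ℝ)+1) ≠ 0 := by positivity
  field_simp
  ring

/-- constancy lemma -/
lemma eq_of_deriv_zero {f : ℝ → ℝ} {a b : ℝ} {s : Set ℝ} (hs : s.Countable) (hab : a ≤ b)
    (hc : ContinuousOn f (Icc a b)) (hd : ∀ x ∈ Ioo a b \ s, HasDerivAt f 0 x) : f b = f a := by
  have := MeasureTheory.integral_eq_of_hasDerivAt_off_countable f (fun _ => 0) hs
    (a := a) (b := b) (by rwa [uIcc_of_le hab]) (by rwa [min_eq_left hab, max_eq_right hab]) (by simp)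
  simp at this
  linarith

lemma eq_of_deriv_zero' {f : ℝ → ℝ} {a b : ℝ} (hab : a ≤ b)
    (hc : ContinuousOn f (Icc a b)) (hd : ∀ x ∈ Ioo a b, HasDerivAt f 0 x) : f b = f a :=
  eq_of_deriv_zero (s := ∅) (by simp) hab hc (by simpa using hd)

end H4P
end

section
open Set Real

namespace H4P

lemma dLi (k : ℕ) {f : ℝ → ℝ} {f' x : ℝ} (hf : HasDerivAt f f' x) (h1 : |f x| < 1) (h0 : f x ≠ 0) :
    HasDerivAt (fun y => Li (k+1) (f y)) (Li k (f x) * (f' / f x)) x := by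
  have := (hasDerivAt_Li k h1 h0).comp x hf
  refine this.congr_deriv ?_
  ring

lemma dLi2 {f : ℝ → ℝ} {f' x : ℝ} (hf : HasDerivAt f f' x) (h1 : |f x| < 1) (h0 : f x ≠ 0) :
    HasDerivAt (fun y => Li 2 (f y)) (- log (1 - f x) * (f' / f x)) x := by
  have := dLi 1 hf h1 h0
  rwa [Li_one h1] at this

lemma dlog {f : ℝ → ℝ} {f' x : ℝ} (hf : HasDerivAt f f' x) (h0 : f x ≠ 0) :
    HasDerivAt (fun y => log (f y)) (f' / f x) x := hf.log h0

lemma log_one_sub {z : ℝ} (hz : |z| < 1) : log (1 - z) = - (z * g 1 z) := by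
  have := Li_one hz
  rw [Li_eq] at this; linarith

lemma cont_xlog : Continuous (fun x : ℝ => x * log x) := Real.continuous_mul_log

/-- log x * log (1-x) is continuous on [0,1) -/
lemma cont_loglog : ContinuousOn (fun x : ℝ => log x * log (1 - x)) (Ioo (-1) 1) := by
  have : ContinuousOn (fun x : ℝ => - ((x * log x) * g 1 x)) (Ioo (-1) 1) :=
    (cont_xlog.continuousOn.mul (cont_g_lt 1)).neg
  refine this.congr ?_
  intro x hx
  simp only []
  rw [log_one_sub (abs_lt.2 hx)]; ring

lemma cLi {k : ℕ} (hk : 2 ≤ k) {f : ℝ → ℝ} {s : Set ℝ} (hf : ContinuousOn f s)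
    (h : ∀ x ∈ s, -1 ≤ f x ∧ f x ≤ 1) : ContinuousOn (fun x => Li k (f x)) s :=
  (cont_Li hk).comp hf (fun x hx => h x hx)

lemma Li2_refl {x : ℝ} (h0 : 0 < x) (h1 : x < 1) :
    Li 2 (1 - x) = zeta' 2 - log x * log (1 - x) - Li 2 x := by
  have key : (fun x => Li 2 (1 - x) + log x * log (1 - x) + Li 2 x) x
      = (fun x => Li 2 (1 - x) + log x * log (1 - x) + Li 2 x) 0 := by
    apply eq_of_deriv_zero' h0.le
    · apply ContinuousOn.add
      · apply ContinuousOn.add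
        · apply cLi le_rfl (by fun_prop)
          intro y hy; constructor <;> linarith [hy.1, hy.2]
        · exact cont_loglog.mono (fun y hy => ⟨by linarith [hy.1], by linarith [hy.2]⟩)
      · apply cLi le_rfl (by fun_prop)
        intro y hy; constructor <;> linarith [hy.1, hy.2]
    · intro y hy
      have y0 : 0 < y := hy.1
      have y1 : y < 1 := by linarith [hy.2]
      have hA : HasDerivAt (fun y : ℝ => 1 - y) (-1) y := by
        simpa using (hasDerivAt_id y).const_sub 1
      have d1 := dLi2 hA (by rw [abs_lt]; constructor <;> linarith) (by linarith)
      have d2 := dLi2 (hasDerivAt_id y) (by rw [abs_lt]; simp only [id]; constructor <;> linarith) (by simp only [id]; linarith)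
      have d3 := dlog hA (by linarith)
      have d4 := Real.hasDerivAt_log y0.ne'
      refine HasDerivAt.congr_deriv ((d1.fun_add (d4.fun_mul d3)).fun_add d2) ?_
      simp only [id, sub_sub_cancel]
      have : (1 - y) ≠ 0 := by linarith
      field_simp
      ring
  simp only [sub_zero, log_zero, zero_mul, Li_zero, add_zero] at key
  unfold zeta'
  linarith

lemma Li2_landen {x : ℝ} (h0 : -1 ≤ x) (h1 : x ≤ 1/2) :
    Li 2 (x / (x - 1)) = - Li 2 x - log (1 - x) ^ 2 / 2 := by
  set F : ℝ → ℝ := fun x => Li 2 (x / (x - 1)) + Li 2 x + log (1 - x) ^ 2 / 2 with hF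
  have F0 : F 0 = 0 := by simp [hF, Li_zero]
  have hc : ContinuousOn F (Icc (-1) (1/2)) := by
    refine ContinuousOn.add (ContinuousOn.add ?_ ?_) ?_
    · refine cLi le_rfl ?_ ?_
      · refine ContinuousOn.div (by fun_prop) (by fun_prop) ?_
        intro y hy; linarith [hy.2]
      · intro y hy
        have : y - 1 < 0 := by linarith [hy.2]
        constructor
        · rw [le_div_iff_of_neg this]; linarith [hy.2]
        · rw [div_le_iff_of_neg this]; linarith
    · apply cLi le_rfl (by fun_prop)
      intro y hy; constructor <;> linarith [hy.1, hy.2]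
    · refine ContinuousOn.div_const (ContinuousOn.pow (ContinuousOn.log (by fun_prop) ?_) _) _
      intro y hy; linarith [hy.2]
  have hd : ∀ y ∈ Ioo (-1 : ℝ) (1/2), y ≠ 0 → HasDerivAt F 0 y := by
    intro y hy y0
    have hy1 : y - 1 < 0 := by linarith [hy.2]
    have hy1' : y - 1 ≠ 0 := hy1.ne
    have hy2 : 1 - y ≠ 0 := by linarith
    have hA : HasDerivAt (fun y : ℝ => 1 - y) (-1) y := by
      simpa using (hasDerivAt_id y).const_sub 1
    have hB : HasDerivAt (fun y : ℝ => y / (y-1)) (-1/(y-1)^2) y := by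
      refine ((hasDerivAt_id y).div ((hasDerivAt_id y).sub_const 1) (by simpa using hy1')).congr_deriv ?_
      simp only [id]
      congr 1; ring
    have d1 := dLi2 hB (by
      rw [abs_lt]
      constructor
      · rw [lt_div_iff_of_neg hy1]; linarith [hy.2]
      · rw [div_lt_iff_of_neg hy1]; linarith) (div_ne_zero y0 hy1')
    have d2 := dLi2 (hasDerivAt_id y) (by rw [abs_lt]; simp only [id]; constructor <;> linarith [hy.1, hy.2]) (by simpa)
    have d3 := dlog hA hy2
    refine HasDerivAt.congr_deriv ((d1.fun_add d2).fun_add ((d3.fun_pow 2).div_const 2)) ?_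
    have e : 1 - y / (y - 1) = (1-y)⁻¹ := by field_simp; ring_nf
    rw [e, log_inv]
    simp only [id]
    have : (y-1) = -(1-y) := by ring
    rw [this]
    field_simp
    ring
  rcases le_total 0 x with h | h
  · have := eq_of_deriv_zero' h (hc.mono (Icc_subset_Icc (by norm_num) h1))
      (fun y hy => hd y ⟨by linarith [hy.1], by linarith [hy.2]⟩ hy.1.ne')
    rw [F0] at this; simp only [hF] at this; linarith
  · have := eq_of_deriv_zero' h (hc.mono (Icc_subset_Icc h0 (by norm_num)))
      (fun y hy => hd y ⟨by linarith [hy.1], by linarith [hy.2]⟩ hy.2.ne)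
    rw [F0] at this; simp only [hF] at this; linarith

lemma Li3_three {x : ℝ} (h0 : 0 < x) (h1 : x ≤ 1/2) :
    Li 3 (x / (x - 1)) = zeta' 3 + log (1-x)^3/6 + zeta' 2 * log (1-x) - log x * log (1-x)^2/2
      - Li 3 x - Li 3 (1 - x) := by
  set F : ℝ → ℝ := fun x => Li 3 (x / (x - 1)) - log (1-x)^3/6 - zeta' 2 * log (1-x)
    + (log x * log (1-x)) * log (1-x)/2 + Li 3 x + Li 3 (1 - x) with hF
  have F0 : F 0 = zeta' 3 := by simp [hF, Li_zero, zeta']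
  have clog : ContinuousOn (fun y : ℝ => log (1 - y)) (Icc 0 (1/2)) := by
    refine ContinuousOn.log (by fun_prop) ?_
    intro y hy; linarith [hy.2]
  have hc : ContinuousOn F (Icc 0 (1/2)) := by
    have c1 : ContinuousOn (fun y : ℝ => Li 3 (y/(y-1))) (Icc 0 (1/2)) := by
      refine cLi (by norm_num) ?_ ?_
      · refine ContinuousOn.div (by fun_prop) (by fun_prop) ?_
        intro y hy; linarith [hy.2]
      · intro y hy
        have : y - 1 < 0 := by linarith [hy.2]
        constructor
        · rw [le_div_iff_of_neg this]; linarith [hy.2]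
        · rw [div_le_iff_of_neg this]; linarith
    have c2 : ContinuousOn (fun y : ℝ => Li 3 y) (Icc 0 (1/2)) := by
      apply cLi (by norm_num) (by fun_prop)
      intro y hy; constructor <;> linarith [hy.1, hy.2]
    have c3 : ContinuousOn (fun y : ℝ => Li 3 (1-y)) (Icc 0 (1/2)) := by
      apply cLi (by norm_num) (by fun_prop)
      intro y hy; constructor <;> linarith [hy.1, hy.2]
    have c4 := cont_loglog.mono (t := Icc 0 (1/2)) (fun y hy => ⟨by linarith [hy.1], by linarith [hy.2]⟩)
    simp only [hF]
    exact ((((c1.sub ((clog.pow 3).div_const 6)).sub (clog.const_mul _)).add ((c4.mul clog).div_const 2)).add c2).add c3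
  have hd : ∀ y ∈ Ioo (0 : ℝ) (1/2), HasDerivAt F 0 y := by
    intro y hy
    have y0 := hy.1
    have hy1 : y - 1 < 0 := by linarith [hy.2]
    have hy1' : y - 1 ≠ 0 := hy1.ne
    have hy2 : 1 - y ≠ 0 := by linarith
    have hA : HasDerivAt (fun y : ℝ => 1 - y) (-1) y := by
      simpa using (hasDerivAt_id y).const_sub 1
    have hB : HasDerivAt (fun y : ℝ => y / (y-1)) (-1/(y-1)^2) y := by
      refine ((hasDerivAt_id y).div ((hasDerivAt_id y).sub_const 1) (by simpa using hy1')).congr_deriv ?_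
      simp only [id]
      congr 1; ring
    have d1 := dLi 2 hB (by
      rw [abs_lt]
      constructor
      · rw [lt_div_iff_of_neg hy1]; linarith [hy.2]
      · rw [div_lt_iff_of_neg hy1]; linarith) (div_ne_zero y0.ne' hy1')
    have d2 := dLi 2 (hasDerivAt_id y) (by rw [abs_lt]; simp only [id]; constructor <;> linarith [hy.1, hy.2]) (by simpa using y0.ne')
    have d5 := dLi 2 hA (by rw [abs_lt]; constructor <;> linarith [hy.1, hy.2]) hy2
    have d3 := dlog hA hy2
    have d4 := Real.hasDerivAt_log y0.ne'
    refine HasDerivAt.congr_deriv (((((d1.fun_sub ((d3.fun_pow 3).div_const 6)).fun_sub (d3.const_mul _)).fun_add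
      (((d4.fun_mul d3).fun_mul d3).div_const 2)).fun_add d2).fun_add d5) ?_
    rw [Li2_landen (by linarith) hy.2.le, Li2_refl y0 (by linarith)]
    simp only [id]
    have : (y-1) = -(1-y) := by ring
    rw [this]
    field_simp
    ring
  have := eq_of_deriv_zero' h0.le (hc.mono (Icc_subset_Icc le_rfl h1))
      (fun y hy => hd y ⟨by linarith [hy.1], by linarith [hy.2]⟩)
  rw [F0] at this; simp only [hF] at this; linarith

end H4P
end

section
open Set Real

namespace H4P

lemma hd_lin (a b x : ℝ) : HasDerivAt (fun y : ℝ => a + b * y) b x := by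
  simpa using ((hasDerivAt_id x).const_mul b).const_add a

/-- endpoint identity -/
lemma E_id {t : ℝ} (h0 : 0 ≤ t) (h2 : t ≤ 2) :
    Li 2 (-t/2) + Li 2 (-1/(1+t)) - Li 2 ((t-1)/(t+1)) - Li 2 (t/(2*(1+t))) - Li 2 ((1-t)/2)
      + Li 2 (1/2) + Li 2 (t/(1+t)) = 0 := by
  set F : ℝ → ℝ := fun t => Li 2 (-t/2) + Li 2 (-1/(1+t)) - Li 2 ((t-1)/(t+1)) - Li 2 (t/(2*(1+t))) - Li 2 ((1-t)/2)
      + Li 2 (1/2) + Li 2 (t/(1+t)) with hF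
  have F0 : F 0 = 0 := by simp [hF, Li_zero]
  have hc : ContinuousOn F (Icc 0 2) := by
    have c : ∀ f : ℝ → ℝ, (∀ y ∈ Icc (0:ℝ) 2, ContinuousAt f y) → (∀ y ∈ Icc (0:ℝ) 2, -1 ≤ f y ∧ f y ≤ 1) →
        ContinuousOn (fun y => Li 2 (f y)) (Icc 0 2) := by
      intro f hf h
      exact cLi le_rfl (fun y hy => (hf y hy).continuousWithinAt) h
    have c1 := c (fun t => -t/2) (by intro y hy; fun_prop) (by intro y hy; constructor <;> linarith [hy.1, hy.2])
    have c2 := c (fun t => -1/(1+t)) (by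
      intro y hy; have : 1 + y ≠ 0 := by linarith [hy.1]
      fun_prop (disch := assumption)) (by
      intro y hy; have : 0 < 1 + y := by linarith [hy.1]
      constructor
      · rw [le_div_iff₀ this]; linarith [hy.1]
      · rw [div_le_iff₀ this]; linarith [hy.1])
    have c3 := c (fun t => (t-1)/(t+1)) (by
      intro y hy; have : y + 1 ≠ 0 := by linarith [hy.1]
      fun_prop (disch := assumption)) (by
      intro y hy; have : 0 < y + 1 := by linarith [hy.1]
      constructor
      · rw [le_div_iff₀ this]; linarith [hy.1]
      · rw [div_le_iff₀ this]; linarith [hy.1])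
    have c4 := c (fun t => t/(2*(1+t))) (by
      intro y hy; have : 2*(1 + y) ≠ 0 := by linarith [hy.1]
      fun_prop (disch := assumption)) (by
      intro y hy; have : 0 < 2*(1 + y) := by linarith [hy.1]
      constructor
      · rw [le_div_iff₀ this]; linarith [hy.1]
      · rw [div_le_iff₀ this]; linarith [hy.1])
    have c5 := c (fun t => (1-t)/2) (by intro y hy; fun_prop) (by intro y hy; constructor <;> linarith [hy.1, hy.2])
    have c6 := c (fun t => t/(1+t)) (by
      intro y hy; have : (1 + y) ≠ 0 := by linarith [hy.1]
      fun_prop (disch := assumption)) (by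
      intro y hy; have : 0 < (1 + y) := by linarith [hy.1]
      constructor
      · rw [le_div_iff₀ this]; linarith [hy.1]
      · rw [div_le_iff₀ this]; linarith [hy.1])
    exact (((((c1.add c2).sub c3).sub c4).sub c5).add continuousOn_const).add c6
  have hd : ∀ y ∈ Ioo (0:ℝ) 2 \ {1}, HasDerivAt F 0 y := by
    rintro y ⟨⟨y0, y2⟩, y1⟩
    have y1 : y ≠ 1 := by simpa using y1
    have p1 : 0 < 1 + y := by linarith
    have i := hasDerivAt_id y
    have b1 : HasDerivAt (fun t : ℝ => -t/2) (-1/2) y := by simpa using i.neg.div_const 2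
    have bp : HasDerivAt (fun t : ℝ => 1+t) 1 y := by simpa using i.const_add 1
    have b2 : HasDerivAt (fun t : ℝ => -1/(1+t)) (1/(1+y)^2) y := by
      refine ((hasDerivAt_const y (-1:ℝ)).fun_div bp p1.ne').congr_deriv ?_
      congr 1; ring
    have b3 : HasDerivAt (fun t : ℝ => (t-1)/(t+1)) (2/(1+y)^2) y := by
      refine ((i.sub_const 1).fun_div (i.add_const 1) (by simpa [add_comm] using p1.ne')).congr_deriv ?_
      simp only [id]
      rw [add_comm y 1]
      congr 1; ring
    have b4 : HasDerivAt (fun t : ℝ => t/(2*(1+t))) (1/(2*(1+y)^2)) y := by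
      refine (i.fun_div (bp.const_mul 2) (by positivity)).congr_deriv ?_
      simp only [id]
      field_simp
      ring
    have b5 : HasDerivAt (fun t : ℝ => (1-t)/2) (-1/2) y := by simpa using (i.const_sub 1).div_const 2
    have b6 : HasDerivAt (fun t : ℝ => t/(1+t)) (1/(1+y)^2) y := by
      refine (i.fun_div bp p1.ne').congr_deriv ?_
      simp only [id]
      field_simp
      ring
    have d1 := dLi2 b1 (by rw [abs_lt]; constructor <;> linarith) (by linarith)
    have d2 := dLi2 b2 (by
      rw [abs_lt]; constructor
      · rw [lt_div_iff₀ p1]; linarith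
      · rw [div_lt_iff₀ p1]; linarith) (by apply div_ne_zero <;> linarith)
    have d3 := dLi2 b3 (by
      rw [abs_lt]; constructor
      · rw [lt_div_iff₀ (by linarith)]; linarith
      · rw [div_lt_iff₀ (by linarith)]; linarith) (by apply div_ne_zero; exact sub_ne_zero.2 y1; linarith)
    have d4 := dLi2 b4 (by
      rw [abs_lt]; constructor
      · rw [lt_div_iff₀ (by linarith)]; linarith
      · rw [div_lt_iff₀ (by linarith)]; linarith) (by apply div_ne_zero <;> linarith)
    have d5 := dLi2 b5 (by rw [abs_lt]; constructor <;> linarith) (by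
      apply div_ne_zero; exact sub_ne_zero.2 (Ne.symm y1); norm_num)
    have d6 := dLi2 b6 (by
      rw [abs_lt]; constructor
      · rw [lt_div_iff₀ (by linarith)]; linarith
      · rw [div_lt_iff₀ (by linarith)]; linarith) (by apply div_ne_zero <;> linarith)
    refine ((((((d1.fun_add d2).fun_sub d3).fun_sub d4).fun_sub d5).add_const (Li 2 (1/2))).fun_add d6).congr_deriv ?_
    have e1 : log (1 - -y/2) = log (2+y) - log 2 := by
      rw [← log_div (by linarith) (by norm_num)]; congr 1; field_simp; ring
    have e2 : log (1 - -1/(1+y)) = log (2+y) - log (1+y) := by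
      rw [← log_div (by linarith) (by linarith)]; congr 1; field_simp; ring
    have e3 : log (1 - (y-1)/(y+1)) = log 2 - log (1+y) := by
      rw [← log_div (by linarith) (by linarith)]; congr 1
      have : y + 1 ≠ 0 := by linarith
      field_simp; ring
    have e4 : log (1 - y/(2*(1+y))) = log (2+y) - log 2 - log (1+y) := by
      rw [← log_div (by linarith) (by linarith), ← log_div (by positivity) (by linarith)]; congr 1; field_simp; ring
    have e5 : log (1 - (1-y)/2) = log (1+y) - log 2 := by
      rw [← log_div (by linarith) (by norm_num)]; congr 1; field_simp; ring
    have e6 : log (1 - y/(1+y)) = - log (1+y) := by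
      rw [← log_inv]; congr 1; field_simp; ring
    rw [e1,e2,e3,e4,e5,e6]
    have q1 : y - 1 ≠ 0 := sub_ne_zero.2 y1
    have q2 : (1:ℝ) - y = -(y-1) := by ring
    have q3 : y + 1 = 1 + y := by ring
    rw [q2, q3]
    field_simp
    ring
  have := eq_of_deriv_zero (s := {1}) (by simp) h0 (hc.mono (Icc_subset_Icc le_rfl h2))
    (fun y hy => hd y ⟨⟨hy.1.1, by linarith [hy.1.2]⟩, hy.2⟩)
  rw [F0] at this
  exact this

end H4P
end

section
open Set Real

namespace H4P

noncomputable def k1 (x u : ℝ) : ℝ :=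
  3/(1+(1+u)*x) + (1+x)/((1+(1+u)*x)*(1+u*x)) - log (1+(1+u)*x)/(1+u*x)^2 - 2/(1+u*x)
noncomputable def k2 (x u : ℝ) : ℝ := -1/((1+u*x)*(1-x))
noncomputable def Psi (x u : ℝ) : ℝ := (log x - log (1-x)) * k1 x u + log x * k2 x u

lemma bpos {x u : ℝ} (hx0 : 0 ≤ x) (hu0 : -1 ≤ u) : 0 < 1+(1+u)*x := by
  have : 0 ≤ (1+u)*x := mul_nonneg (by linarith) hx0
  linarith
lemma fpos {x u : ℝ} (hx0 : 0 ≤ x) (hx1 : x ≤ 1/2) (hu0 : -1 ≤ u) : 0 < 1+u*x := by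
  nlinarith

lemma intlog (a b : ℝ) : IntervalIntegrable log MeasureTheory.volume a b :=
  intervalIntegral.intervalIntegrable_log'

/-- ∫ over x -/
lemma int_x {u : ℝ} (hu0 : -1 < u) (hu1 : u < 1) (hu : u ≠ 0) :
    ∫ x in (0:ℝ)..(1/2), Psi x u = 0 := by
  set t := 1 + u with ht
  have t0 : 0 < t := by linarith
  set F : ℝ → ℝ := fun x => -(t*(log x - log (1-x))*log (1+t*x)*x/(1+u*x)) + 2*(log x - log (1-x))*log (1+t*x)
    + Li 2 (-t*x) + Li 2 (-x/(1+u*x)) - Li 2 (u*x/(1+u*x)) - Li 2 (t*(1-x)/(1+t))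
    + log (1+t)*log (1-x) - log x * log (1+u*x) - Li 2 (-u*x) + log x * log (1-x) + Li 2 x with hF
  have hxlog : ∀ s : ℝ, |s| < 2 → ContinuousOn (fun x => log x * log (1+s*x)) (Icc 0 (1/2)) := by
    intro s hs
    have hab : ∀ x ∈ Icc (0:ℝ) (1/2), |-s*x| < 1 := by
      intro x hx
      rw [abs_mul, abs_neg, abs_of_nonneg hx.1]
      nlinarith [hx.1, hx.2, abs_nonneg s]
    have : ContinuousOn (fun x => (x * log x) * (s * g 1 (-s*x))) (Icc 0 (1/2)) := by
      refine cont_xlog.continuousOn.mul (continuousOn_const.mul ((cont_g_lt 1).comp (by fun_prop) ?_))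
      intro x hx; exact abs_lt.1 (hab x hx)
    refine this.congr ?_
    intro x hx
    simp only []
    have := log_one_sub (hab x hx)
    rw [show 1 - -s*x = 1+s*x by ring] at this
    rw [this]; ring
  have hf0 : ∀ x ∈ Icc (0:ℝ) (1/2), 0 < 1 + u*x := fun x hx => fpos hx.1 hx.2 hu0.le
  have hb0 : ∀ x ∈ Icc (0:ℝ) (1/2), 0 < 1 + t*x := fun x hx => bpos hx.1 hu0.le
  have hc : ContinuousOn F (Icc 0 (1/2)) := by
    have x1 : ContinuousOn (fun x => log x * log (1+t*x)) (Icc 0 (1/2)) := hxlog t (by rw [abs_lt]; constructor <;> linarith)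
    have x2 : ContinuousOn (fun x => log x * log (1+u*x)) (Icc 0 (1/2)) := hxlog u (by rw [abs_lt]; constructor <;> linarith)
    have x3 := cont_loglog.mono (t := Icc 0 (1/2)) (fun y hy => ⟨by linarith [hy.1], by linarith [hy.2]⟩)
    have cb : ContinuousOn (fun x => log (1+t*x)) (Icc 0 (1/2)) := by
      refine ContinuousOn.log (by fun_prop) (fun x hx => (hb0 x hx).ne')
    have cc : ContinuousOn (fun x : ℝ => log (1-x)) (Icc 0 (1/2)) := by
      refine ContinuousOn.log (by fun_prop) (fun x hx => by linarith [hx.2])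
    have y1 : ContinuousOn (fun x => Li 2 (-t*x)) (Icc 0 (1/2)) := by
      refine cLi le_rfl (by fun_prop) ?_
      intro x hx; constructor <;> nlinarith [hx.1, hx.2]
    have y2 : ContinuousOn (fun x => Li 2 (-x/(1+u*x))) (Icc 0 (1/2)) := by
      refine cLi le_rfl (ContinuousOn.div (by fun_prop) (by fun_prop) (fun x hx => (hf0 x hx).ne')) ?_
      intro x hx
      constructor
      · rw [le_div_iff₀ (hf0 x hx)]; nlinarith [hx.1, hx.2]
      · rw [div_le_iff₀ (hf0 x hx)]; nlinarith [hx.1, hx.2]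
    have y3 : ContinuousOn (fun x => Li 2 (u*x/(1+u*x))) (Icc 0 (1/2)) := by
      refine cLi le_rfl (ContinuousOn.div (by fun_prop) (by fun_prop) (fun x hx => (hf0 x hx).ne')) ?_
      intro x hx
      constructor
      · rw [le_div_iff₀ (hf0 x hx)]; nlinarith [hx.1, hx.2]
      · rw [div_le_iff₀ (hf0 x hx)]; nlinarith [hx.1, hx.2]
    have y4 : ContinuousOn (fun x => Li 2 (t*(1-x)/(1+t))) (Icc 0 (1/2)) := by
      refine cLi le_rfl (by fun_prop) ?_
      intro x hx
      constructor
      · rw [le_div_iff₀ (by linarith)]; nlinarith [hx.1, hx.2]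
      · rw [div_le_iff₀ (by linarith)]; nlinarith [hx.1, hx.2]
    have y5 : ContinuousOn (fun x => Li 2 (-u*x)) (Icc 0 (1/2)) := by
      refine cLi le_rfl (by fun_prop) ?_
      intro x hx; constructor <;> nlinarith [hx.1, hx.2]
    have y6 : ContinuousOn (fun x => Li 2 x) (Icc 0 (1/2)) := by
      refine cLi le_rfl (by fun_prop) ?_
      intro x hx; constructor <;> linarith [hx.1, hx.2]
    have z1 : ContinuousOn (fun x => (log x - log (1-x))*log (1+t*x)) (Icc 0 (1/2)) :=
      (x1.sub (cc.mul cb)).congr (fun x hx => by simp only [Pi.sub_apply, Pi.mul_apply]; ring)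
    have z2 : ContinuousOn (fun x => -(t*(log x - log (1-x))*log (1+t*x)*x/(1+u*x))) (Icc 0 (1/2)) := by
      refine (((z1.const_mul t).mul continuousOn_id).div (g := fun x => 1+u*x) (by fun_prop) (fun x hx => (hf0 x hx).ne')).neg.congr ?_
      intro x hx; simp only [id, Pi.neg_apply, Pi.div_apply, Pi.mul_apply]; ring
    have z3 : ContinuousOn (fun x => 2*(log x - log (1-x))*log (1+t*x)) (Icc 0 (1/2)) :=
      (z1.const_mul 2).congr (fun x hx => by ring)
    exact (((((((((z2.add z3).add y1).add y2).sub y3).sub y4).add (cc.const_mul _)).sub x2).sub y5).add x3).add y6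
  have hd : ∀ x ∈ Ioo (0:ℝ) (1/2), HasDerivAt F (t * Psi x u) x := by
    intro x hx
    have x0 := hx.1
    have x2 := hx.2
    have f0 := hf0 x ⟨x0.le, x2.le⟩
    have b0 := hb0 x ⟨x0.le, x2.le⟩
    have c0 : 0 < 1 - x := by linarith
    have i := hasDerivAt_id' x
    have da := Real.hasDerivAt_log x0.ne'
    have hA : HasDerivAt (fun y : ℝ => 1 - y) (-1) x := by simpa using i.const_sub 1
    have dc := dlog hA c0.ne'
    have hb := hd_lin 1 t x
    have hf := hd_lin 1 u x
    have db := dlog hb b0.ne'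
    have df := dlog hf f0.ne'
    have d1 := dLi2 (hd_lin 0 (-t) x) (by rw [abs_lt]; constructor <;> nlinarith) (by nlinarith)
    have b2 : HasDerivAt (fun y : ℝ => -y/(1+u*y)) (-1/(1+u*x)^2) x := by
      refine (i.neg.fun_div hf f0.ne').congr_deriv ?_
      simp only [Pi.neg_apply]
      congr 1; ring
    have d2 := dLi2 b2 (by
      rw [abs_lt]; constructor
      · rw [lt_div_iff₀ f0]; nlinarith
      · rw [div_lt_iff₀ f0]; nlinarith) (by apply div_ne_zero <;> linarith)
    have b3 : HasDerivAt (fun y : ℝ => u*y/(1+u*y)) (u/(1+u*x)^2) x := by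
      refine ((i.const_mul u).fun_div hf f0.ne').congr_deriv ?_
      congr 1; ring
    have d3 := dLi2 b3 (by
      rw [abs_lt]; constructor
      · rw [lt_div_iff₀ f0]; nlinarith
      · rw [div_lt_iff₀ f0]; nlinarith) (by apply div_ne_zero _ f0.ne'; exact mul_ne_zero hu x0.ne')
    have b4 : HasDerivAt (fun y : ℝ => t*(1-y)/(1+t)) (-t/(1+t)) x := by
      simpa using (hA.const_mul t).div_const (1+t)
    have d4 := dLi2 b4 (by
      rw [abs_lt]; constructor
      · rw [lt_div_iff₀ (by linarith)]; nlinarith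
      · rw [div_lt_iff₀ (by linarith)]; nlinarith) (by
        apply div_ne_zero _ (by linarith); exact mul_ne_zero t0.ne' c0.ne')
    have d5 := dLi2 (hd_lin 0 (-u) x) (by rw [abs_lt]; constructor <;> nlinarith) (by
      rw [zero_add]; exact mul_ne_zero (neg_ne_zero.2 hu) x0.ne')
    have d6 := dLi2 i (by rw [abs_lt]; constructor <;> linarith) x0.ne'
    simp only [zero_add] at d1 d5
    have dl := da.fun_sub dc
    refine (((((((((((((((dl.const_mul t).fun_mul db).fun_mul i).fun_div hf f0.ne').fun_neg).fun_add ((dl.const_mul 2).fun_mul db)).fun_add d1).fun_add d2).fun_sub d3).fun_sub d4).fun_add (dc.const_mul (log (1+t)))).fun_sub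
      (da.fun_mul df)).fun_sub d5).fun_add (da.fun_mul dc)).fun_add d6).congr_deriv ?_
    have e1 : log (1 - -t*x) = log (1+t*x) := by congr 1; ring
    have e2 : log (1 - -x/(1+u*x)) = log (1+t*x) - log (1+u*x) := by
      rw [← log_div b0.ne' f0.ne']; congr 1; rw [eq_div_iff f0.ne', sub_mul, div_mul_cancel₀ _ f0.ne', ht]; ring
    have e3 : log (1 - u*x/(1+u*x)) = - log (1+u*x) := by
      rw [← log_inv]; congr 1; field_simp; ring
    have e4 : log (1 - t*(1-x)/(1+t)) = log (1+t*x) - log (1+t) := by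
      rw [← log_div b0.ne' (by linarith)]; congr 1; field_simp; ring
    have e5 : log (1 - -u*x) = log (1+u*x) := by congr 1; ring
    rw [e1,e2,e3,e4,e5]
    unfold Psi k1 k2
    rw [← ht]
    have hut : u = t - 1 := by linarith
    have t1 : (1+t) ≠ 0 := by linarith
    generalize hB : log (1+t*x) = B
    generalize hFF : log (1+u*x) = FF
    generalize log (1+t) = T
    generalize log (1-x) = C
    generalize log x = A
    have g1 : 1+u*x = 1 + t*x - x := by rw [hut]; ring
    rw [g1] at f0 ⊢
    have hu' : t - 1 ≠ 0 := by rwa [← hut]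
    rw [hut]
    field_simp
    ring
  have hint : IntervalIntegrable (fun x => t * Psi x u) MeasureTheory.volume 0 (1/2) := by
    have cf : ContinuousOn (fun x => 1+u*x) (uIcc 0 (1/2)) := by fun_prop
    have cb : ContinuousOn (fun x => 1+t*x) (uIcc 0 (1/2)) := by fun_prop
    rw [uIcc_of_le (by norm_num)] at cf cb
    have ck2 : ContinuousOn (fun x => k2 x u) (Icc 0 (1/2)) := by
      unfold k2
      refine ContinuousOn.div (by fun_prop) (by fun_prop) (fun x hx => mul_ne_zero (hf0 x hx).ne' (by linarith [hx.2]))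
    have ck1 : ContinuousOn (fun x => k1 x u) (Icc 0 (1/2)) := by
      unfold k1
      refine ContinuousOn.sub (ContinuousOn.sub (ContinuousOn.add ?_ ?_) ?_) ?_
      · exact ContinuousOn.div (by fun_prop) cb (fun x hx => (hb0 x hx).ne')
      · exact ContinuousOn.div (by fun_prop) (cb.mul cf) (fun x hx => mul_ne_zero (hb0 x hx).ne' (hf0 x hx).ne')
      · exact ContinuousOn.div (ContinuousOn.log cb (fun x hx => (hb0 x hx).ne')) (cf.pow 2) (fun x hx => pow_ne_zero _ (hf0 x hx).ne')
      · exact ContinuousOn.div (by fun_prop) cf (fun x hx => (hf0 x hx).ne')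
    have cc : ContinuousOn (fun x : ℝ => log (1-x)) (Icc 0 (1/2)) := by
      refine ContinuousOn.log (by fun_prop) (fun x hx => by linarith [hx.2])
    have hu2 : uIcc (0:ℝ) (1/2) = Icc 0 (1/2) := uIcc_of_le (by norm_num)
    apply IntervalIntegrable.const_mul
    have : (fun x => Psi x u) = fun x => log x * (k1 x u + k2 x u) - log (1-x) * k1 x u := by
      ext x; unfold Psi; ring
    rw [this]
    refine IntervalIntegrable.sub ((intlog 0 (1/2)).mul_continuousOn (by rw [hu2]; exact ck1.add ck2)) ?_
    apply ContinuousOn.intervalIntegrable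
    rw [hu2]; exact cc.mul ck1
  have hI := intervalIntegral.integral_eq_sub_of_hasDerivAt_of_le (by norm_num : (0:ℝ) ≤ 1/2) hc hd hint
  rw [intervalIntegral.integral_const_mul] at hI
  have E := E_id t0.le (by linarith : t ≤ 2)
  have F12 : F (1/2) - F 0 = 0 := by
    have l1 : log (1+u*(1/2)) = log (1+t) - log 2 := by
      rw [← log_div (by linarith) (by norm_num)]; congr 1; rw [ht]; ring
    have l2 : log (1/2:ℝ) = - log 2 := by rw [one_div, log_inv]
    have h1t : 1 + t ≠ 0 := by linarith
    have hut : u = t - 1 := by linarith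
    have a1 : -(1/2)/(1+u*(1/2)) = -1/(1+t) := by
      rw [hut, show 1+(t-1)*(1/2) = (1+t)/2 by ring]; field_simp
    have a2 : u*(1/2)/(1+u*(1/2)) = (t-1)/(t+1) := by
      rw [hut, show 1+(t-1)*(1/2) = (1+t)/2 by ring, add_comm t 1]; field_simp
    have a3 : t*(1-1/2)/(1+t) = t/(2*(1+t)) := by field_simp; ring
    have a4 : -u*(1/2) = (1-t)/2 := by rw [hut]; ring
    have a5 : -t*(1/2) = -t/2 := by ring
    simp only [hF]
    rw [a1, a2, a3, a4, a5, l1, show (1:ℝ) - 1/2 = 1/2 by norm_num, l2]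
    simp only [mul_zero, add_zero, sub_zero, log_one, log_zero, Li_zero, neg_zero, zero_div, mul_one]
    linear_combination E
  rw [F12] at hI
  rcases mul_eq_zero.1 hI with h | h
  · linarith
  · exact h

end H4P
end

section
open Set Real

namespace H4P

noncomputable def Lam (x : ℝ) : ℝ := Li 2 x - Li 2 (-x)

lemma cont_k1u {x : ℝ} (hx0 : 0 ≤ x) (hx1 : x ≤ 1/2) : ContinuousOn (fun u => k1 x u) (Icc (-1) 1) := by
  have hf0 : ∀ u ∈ Icc (-1:ℝ) 1, 0 < 1 + u*x := fun u hu => fpos hx0 hx1 hu.1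
  have hb0 : ∀ u ∈ Icc (-1:ℝ) 1, 0 < 1 + (1+u)*x := fun u hu => bpos hx0 hu.1
  have cf : ContinuousOn (fun u => 1+u*x) (Icc (-1) 1) := by fun_prop
  have cb : ContinuousOn (fun u => 1+(1+u)*x) (Icc (-1) 1) := by fun_prop
  unfold k1
  refine ContinuousOn.sub (ContinuousOn.sub (ContinuousOn.add ?_ ?_) ?_) ?_
  · exact ContinuousOn.div (by fun_prop) cb (fun x hx => (hb0 x hx).ne')
  · exact ContinuousOn.div (by fun_prop) (cb.mul cf) (fun x hx => mul_ne_zero (hb0 x hx).ne' (hf0 x hx).ne')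
  · exact ContinuousOn.div (ContinuousOn.log cb (fun x hx => (hb0 x hx).ne')) (cf.pow 2) (fun x hx => pow_ne_zero _ (hf0 x hx).ne')
  · exact ContinuousOn.div (by fun_prop) cf (fun x hx => (hf0 x hx).ne')

lemma int_u {x : ℝ} (x0 : 0 < x) (x1 : x < 1/2) :
    ∫ u in (-1:ℝ)..1, log u * Psi x u =
      -(4*(log x - log (1-x))*Lam (x/(1+x)) - log x * Lam x/(1-x) - 2*(log x - log (1-x))*Lam x)/x := by
  set ℓ := log x - log (1-x) with hl
  set p' := x/(1+x) with hp'
  have p'0 : 0 < p' := by positivity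
  have p'1 : p' < 1/2 := by rw [hp', div_lt_iff₀ (by linarith)]; linarith
  have hf0 : ∀ u ∈ Icc (-1:ℝ) 1, 0 < 1 + u*x := fun u hu => fpos x0.le x1.le hu.1
  have hb0 : ∀ u ∈ Icc (-1:ℝ) 1, 0 < 1 + (1+u)*x := fun u hu => bpos x0.le hu.1
  set G : ℝ → ℝ := fun u => 3*ℓ*(log u * log (1+p'*u) + Li 2 (0+(-p')*u))
    + ℓ*((log u * log (1+x*u) - (u * log u)*(x*log ((1+x)+x*u)/(1+x*u))) + Li 2 (-x/(1+x*u)) - Li 2 (u*x/(1+x*u)))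
    - (log x/(1-x)+2*ℓ) * (log u * log (1+x*u) + Li 2 (0+(-x)*u)) with hG
  have hxlog : ∀ s : ℝ, |s| < 1 → ContinuousOn (fun u => log u * log (1+s*u)) (Icc (-1) 1) := by
    intro s hs
    have hab : ∀ x ∈ Icc (-1:ℝ) 1, |-s*x| < 1 := by
      intro x hx
      rw [abs_mul, abs_neg]
      have : |x| ≤ 1 := abs_le.2 hx
      nlinarith [abs_nonneg s, abs_nonneg x]
    have : ContinuousOn (fun x => (x * log x) * (s * g 1 (-s*x))) (Icc (-1) 1) := by
      refine cont_xlog.continuousOn.mul (continuousOn_const.mul ((cont_g_lt 1).comp (by fun_prop) ?_))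
      intro x hx; exact abs_lt.1 (hab x hx)
    refine this.congr ?_
    intro x hx
    simp only []
    have := log_one_sub (hab x hx)
    rw [show 1 - -s*x = 1+s*x by ring] at this
    rw [this]; ring
  have hf0' : ∀ u ∈ Icc (-1:ℝ) 1, 0 < 1 + x*u := fun u hu => by rw [mul_comm]; exact hf0 u hu
  have hb0' : ∀ u ∈ Icc (-1:ℝ) 1, 0 < (1+x) + x*u := fun u hu => by
    have := hb0 u hu; linarith
  have hc : ContinuousOn G (Icc (-1) 1) := by
    have c1 := hxlog p' (by rw [abs_of_pos p'0]; linarith)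
    have c2 := hxlog x (by rw [abs_of_pos x0]; linarith)
    have c3 : ContinuousOn (fun u => Li 2 (0+(-p')*u)) (Icc (-1) 1) := by
      refine cLi le_rfl (by fun_prop) ?_
      intro u hu; constructor <;> nlinarith [hu.1, hu.2]
    have c4 : ContinuousOn (fun u => Li 2 (0+(-x)*u)) (Icc (-1) 1) := by
      refine cLi le_rfl (by fun_prop) ?_
      intro u hu; constructor <;> nlinarith [hu.1, hu.2]
    have c5 : ContinuousOn (fun u => Li 2 (-x/(1+x*u))) (Icc (-1) 1) := by
      refine cLi le_rfl (ContinuousOn.div (by fun_prop) (by fun_prop) (fun u hu => (hf0' u hu).ne')) ?_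
      intro u hu
      constructor
      · rw [le_div_iff₀ (hf0' u hu)]; nlinarith [hu.1, hu.2]
      · rw [div_le_iff₀ (hf0' u hu)]; nlinarith [hu.1, hu.2]
    have c6 : ContinuousOn (fun u => Li 2 (u*x/(1+x*u))) (Icc (-1) 1) := by
      refine cLi le_rfl (ContinuousOn.div (by fun_prop) (by fun_prop) (fun u hu => (hf0' u hu).ne')) ?_
      intro u hu
      constructor
      · rw [le_div_iff₀ (hf0' u hu)]; nlinarith [hu.1, hu.2]
      · rw [div_le_iff₀ (hf0' u hu)]; nlinarith [hu.1, hu.2]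
    have c7 : ContinuousOn (fun u => x*log ((1+x)+x*u)/(1+x*u)) (Icc (-1) 1) := by
      refine ContinuousOn.div (continuousOn_const.mul (ContinuousOn.log (by fun_prop) (fun u hu => (hb0' u hu).ne'))) (by fun_prop) (fun u hu => (hf0' u hu).ne')
    have c8 := cont_xlog.continuousOn (s := Icc (-1) 1)
    exact (((c1.add c3).const_mul _).add (((((c2.sub (c8.mul c7)).add c5).sub c6)).const_mul _)).sub ((c2.add c4).const_mul _)
  have hd : ∀ u ∈ Ioo (-1:ℝ) 1 \ {0}, HasDerivAt G (x * (log u * Psi x u)) u := by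
    rintro u ⟨⟨u0, u1⟩, un⟩
    have un : u ≠ 0 := by simpa using un
    have f0 := hf0' u ⟨u0.le, u1.le⟩
    have b0 := hb0' u ⟨u0.le, u1.le⟩
    have i := hasDerivAt_id' u
    have dl := Real.hasDerivAt_log un
    have q0 : 0 < 1 + p'*u := by nlinarith
    have hf := hd_lin 1 x u
    have dp := dlog (hd_lin 1 p' u) q0.ne'
    have df := dlog hf f0.ne'
    have db := dlog (hd_lin (1+x) x u) b0.ne'
    have d1 := dLi2 (hd_lin 0 (-p') u) (by rw [abs_lt]; constructor <;> nlinarith) (by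
      rw [zero_add]; exact mul_ne_zero (neg_ne_zero.2 p'0.ne') un)
    have d2 := dLi2 (hd_lin 0 (-x) u) (by rw [abs_lt]; constructor <;> nlinarith) (by
      rw [zero_add]; exact mul_ne_zero (neg_ne_zero.2 x0.ne') un)
    have b3 : HasDerivAt (fun u : ℝ => -x/(1+x*u)) (x^2/(1+x*u)^2) u := by
      refine ((hasDerivAt_const u (-x)).fun_div hf f0.ne').congr_deriv ?_
      congr 1; ring
    have d3 := dLi2 b3 (by
      rw [abs_lt]; constructor
      · rw [lt_div_iff₀ f0]; nlinarith
      · rw [div_lt_iff₀ f0]; nlinarith) (by apply div_ne_zero <;> linarith)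
    have b4 : HasDerivAt (fun u : ℝ => u*x/(1+x*u)) (x/(1+x*u)^2) u := by
      refine ((i.mul_const x).fun_div hf f0.ne').congr_deriv ?_
      congr 1; ring
    have d4 := dLi2 b4 (by
      rw [abs_lt]; constructor
      · rw [lt_div_iff₀ f0]; nlinarith
      · rw [div_lt_iff₀ f0]; nlinarith) (by apply div_ne_zero _ f0.ne'; exact mul_ne_zero un x0.ne')
    refine ((((dl.fun_mul dp).fun_add d1).const_mul (3*ℓ)).fun_add
      ((((dl.fun_mul df).fun_sub ((i.fun_mul dl).fun_mul ((db.const_mul x).fun_div hf f0.ne'))).fun_add d3).fun_sub d4 |>.const_mul ℓ)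
      |>.fun_sub (((dl.fun_mul df).fun_add d2).const_mul (log x/(1-x)+2*ℓ))).congr_deriv ?_
    have e1 : log (1 - (0+-p'*u)) = log (1+p'*u) := by congr 1; ring
    have e2 : log (1 - (0+-x*u)) = log (1+x*u) := by congr 1; ring
    have e3 : log (1 - -x/(1+x*u)) = log ((1+x)+x*u) - log (1+x*u) := by
      rw [← log_div b0.ne' f0.ne']; congr 1; rw [eq_div_iff f0.ne', sub_mul, div_mul_cancel₀ _ f0.ne']; ring
    have e4 : log (1 - u*x/(1+x*u)) = - log (1+x*u) := by
      rw [← log_inv]; congr 1; apply eq_inv_of_mul_eq_one_left; rw [sub_mul, div_mul_cancel₀ _ f0.ne']; ring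
    rw [e1, e2, e3, e4]
    have hpb : p'/(1+p'*u) = x/((1+x)+x*u) := by
      have : 1+p'*u = ((1+x)+x*u)/(1+x) := by rw [hp']; field_simp
      rw [this, hp']; field_simp
    have hpz : -p'/(0+-p'*u) = 1/u := by rw [zero_add]; field_simp
    rw [hpb, hpz]
    unfold Psi k1 k2
    rw [← hl]
    have g1 : 1+u*x = 1 + x*u := by ring
    have g2 : 1+(1+u)*x = 1 + x+x*u := by ring
    rw [g1, g2]
    have c0 : 1 - x ≠ 0 := by linarith
    have b0' := b0.ne'
    have f0' := f0.ne'
    generalize log (1+x+x*u) = B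
    generalize log (1+x*u) = FF
    generalize log u = U
    generalize log (1+p'*u) = Q
    clear_value ℓ
    generalize log x = A
    rw [zero_add]
    simp only [mul_comm x u] at b0' f0' ⊢
    have b1 : 1 + x*(u+1) ≠ 0 := by convert b0' using 1; ring
    field_simp
    ring
  have hint : IntervalIntegrable (fun u => x * (log u * Psi x u)) MeasureTheory.volume (-1) 1 := by
    apply IntervalIntegrable.const_mul
    have hu2 : uIcc (-1:ℝ) 1 = Icc (-1) 1 := uIcc_of_le (by norm_num)
    have ck2 : ContinuousOn (fun u => k2 x u) (Icc (-1) 1) := by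
      unfold k2
      refine ContinuousOn.div (by fun_prop) (by fun_prop) (fun u hu => mul_ne_zero (hf0 u hu).ne' (by linarith))
    refine (intlog (-1) 1).mul_continuousOn ?_
    rw [hu2]
    unfold Psi
    exact ((cont_k1u x0.le x1.le).const_mul _).add (ck2.const_mul _)
  have hI := MeasureTheory.integral_eq_of_hasDerivAt_off_countable (a := -1) (b := 1) G (fun u => x * (log u * Psi x u)) (s := {0}) (by simp)
    (by rw [uIcc_of_le (by norm_num)]; exact hc) (by
      rw [min_eq_left (by norm_num), max_eq_right (by norm_num)]; exact hd) hint
  rw [intervalIntegral.integral_const_mul] at hI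
  rw [eq_div_iff x0.ne', mul_comm, hI]
  simp only [hG, log_one, log_neg_eq_log, mul_zero, zero_mul, sub_zero, zero_add, Lam, mul_one]
  have a1 : -x/(1+x) = -p' := by rw [hp']; ring
  have a2 : 1*x/(1+x) = p' := by rw [hp']; ring
  have a3 : -1*x/(1+x*(-1)) = -x/(1+x*(-1)) := by ring
  rw [a1, a2, a3]
  simp only [mul_neg, mul_one, neg_neg]
  ring

end H4P
end

section
open Set Real MeasureTheory

namespace H4P

lemma integrable_prod_log : IntegrableOn (Function.uncurry fun x u => log u * Psi x u)
    (uIoc (0:ℝ) (1/2) ×ˢ uIoc (-1:ℝ) 1) := by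
  rw [uIoc_of_le (by norm_num), uIoc_of_le (by norm_num)]
  set K : Set (ℝ × ℝ) := Icc (0:ℝ) (1/2) ×ˢ Icc (-1:ℝ) 1 with hK
  have Kc : IsCompact K := isCompact_Icc.prod isCompact_Icc
  have hf0 : ∀ z ∈ K, 1 + z.2*z.1 ≠ 0 := fun z hz => (fpos hz.1.1 hz.1.2 hz.2.1).ne'
  have hb0 : ∀ z ∈ K, 1 + (1+z.2)*z.1 ≠ 0 := fun z hz => (bpos hz.1.1 hz.2.1).ne'
  have hc0 : ∀ z ∈ K, 1 - z.1 ≠ 0 := fun z hz => by linarith [hz.1.2]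
  have cf : ContinuousOn (fun z : ℝ × ℝ => 1+z.2*z.1) K := by fun_prop
  have cb : ContinuousOn (fun z : ℝ × ℝ => 1+(1+z.2)*z.1) K := by fun_prop
  have ck2 : ContinuousOn (fun z : ℝ × ℝ => k2 z.1 z.2) K := by
    unfold k2
    exact ContinuousOn.div (by fun_prop) (by fun_prop) (fun z hz => mul_ne_zero (hf0 z hz) (hc0 z hz))
  have ck1 : ContinuousOn (fun z : ℝ × ℝ => k1 z.1 z.2) K := by
    unfold k1
    refine ContinuousOn.sub (ContinuousOn.sub (ContinuousOn.add ?_ ?_) ?_) ?_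
    · exact ContinuousOn.div (by fun_prop) cb (fun x hx => (hb0 x hx))
    · exact ContinuousOn.div (by fun_prop) (cb.mul cf) (fun x hx => mul_ne_zero (hb0 x hx) (hf0 x hx))
    · exact ContinuousOn.div (ContinuousOn.log cb (fun x hx => (hb0 x hx))) (cf.pow 2) (fun x hx => pow_ne_zero _ (hf0 x hx))
    · exact ContinuousOn.div (by fun_prop) cf (fun x hx => (hf0 x hx))
  have cc : ContinuousOn (fun z : ℝ × ℝ => log (1 - z.1)) K := ContinuousOn.log (by fun_prop) hc0
  have gen : ∀ (k : ℝ × ℝ → ℝ) (f : ℝ → ℝ), ContinuousOn k K → IntegrableOn f (Ioc (0:ℝ) (1/2)) →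
      IntegrableOn (fun z : ℝ × ℝ => k z * (f z.1 * log z.2)) (Ioc (0:ℝ) (1/2) ×ˢ Ioc (-1:ℝ) 1) := by
    intro k f hk hf
    have hsub : Ioc (0:ℝ) (1/2) ×ˢ Ioc (-1:ℝ) 1 ⊆ K := prod_mono Ioc_subset_Icc_self Ioc_subset_Icc_self
    have hms : MeasurableSet (Ioc (0:ℝ) (1/2) ×ˢ Ioc (-1:ℝ) 1) := measurableSet_Ioc.prod measurableSet_Ioc
    obtain ⟨C, hC⟩ := Kc.exists_bound_of_continuousOn hk
    have h1 : IntegrableOn log (Ioc (-1:ℝ) 1) := by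
      have := intlog (-1) 1
      rwa [intervalIntegrable_iff_integrableOn_Ioc_of_le (by norm_num)] at this
    have h2 := Integrable.mul_prod hf h1
    rw [Measure.prod_restrict] at h2
    refine Integrable.bdd_mul (c := C) h2 ((hk.mono hsub).aestronglyMeasurable hms) ?_
    filter_upwards [ae_restrict_mem hms] with z hz using hC z (hsub hz)
  have i1 : IntegrableOn log (Ioc (0:ℝ) (1/2)) := by
    have := intlog 0 (1/2)
    rwa [intervalIntegrable_iff_integrableOn_Ioc_of_le (by norm_num)] at this
  have i2 : IntegrableOn (fun _ : ℝ => (1:ℝ)) (Ioc (0:ℝ) (1/2)) := by simp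
  have h := (gen _ _ (ck1.add ck2) i1).sub (gen _ _ (cc.mul ck1) i2)
  refine h.congr (Filter.Eventually.of_forall ?_)
  intro z
  simp only [Function.uncurry, Psi, Pi.sub_apply, Pi.add_apply, Pi.mul_apply]
  ring

lemma fub : ∫ x in (0:ℝ)..(1/2), (∫ u in (-1:ℝ)..1, log u * Psi x u) = 0 := by
  rw [intervalIntegral_intervalIntegral_swap integrable_prod_log]
  have : ∫ u in (-1:ℝ)..1, (∫ x in (0:ℝ)..(1/2), log u * Psi x u) = ∫ u in (-1:ℝ)..1, (0:ℝ) := by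
    apply intervalIntegral.integral_congr_Ioo_of_le (by norm_num)
    intro u hu
    simp only []
    rw [intervalIntegral.integral_const_mul]
    by_cases h : u = 0
    · rw [h, log_zero, zero_mul]
    · rw [int_x hu.1 hu.2 h, mul_zero]
  rw [this]; simp

lemma Lam_eq (w : ℝ) : Lam w = w * (g 2 w + g 2 (-w)) := by
  unfold Lam; rw [Li_eq, Li_eq]; ring

lemma cont_gLam : ContinuousOn (fun w => g 2 w + g 2 (-w)) (Icc (-1) 1) := by
  refine (cont_g le_rfl).add ((cont_g le_rfl).comp (by fun_prop) ?_)
  intro x hx; exact ⟨by linarith [hx.2], by linarith [hx.1]⟩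

lemma w_mem {x : ℝ} (hx : x ∈ Icc (0:ℝ) (1/2)) : x/(1+x) ∈ Icc (-1:ℝ) 1 := by
  have : 0 < 1 + x := by linarith [hx.1]
  constructor
  · rw [le_div_iff₀ this]; linarith [hx.1]
  · rw [div_le_iff₀ this]; linarith [hx.1]

/-- the T-integrand -/
noncomputable def tI (x : ℝ) : ℝ := 4 * log x * Li 2 x * (1/x - 1/(1+x))
  + Lam x * (3 * log x / x + log x/(1-x) - 2 * log (1-x)/x)

lemma cI {f : ℝ → ℝ} (hf : ContinuousOn f (Icc 0 (1/2))) : IntervalIntegrable f volume 0 (1/2) := by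
  apply ContinuousOn.intervalIntegrable
  rwa [uIcc_of_le (by norm_num)]
lemma cIl {f : ℝ → ℝ} (hf : ContinuousOn f (Icc 0 (1/2))) : IntervalIntegrable (fun x => log x * f x) volume 0 (1/2) := by
  apply (intlog 0 (1/2)).mul_continuousOn
  rwa [uIcc_of_le (by norm_num)]

lemma cc12 : ContinuousOn (fun x : ℝ => log (1-x)) (Icc 0 (1/2)) :=
  ContinuousOn.log (by fun_prop) (fun x hx => by linarith [hx.2])
lemma cg12 : ContinuousOn (fun x : ℝ => g 2 x) (Icc 0 (1/2)) :=
  (cont_g le_rfl).mono (fun x hx => ⟨by linarith [hx.1], by linarith [hx.2]⟩)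
lemma cgL12 : ContinuousOn (fun w => g 2 w + g 2 (-w)) (Icc 0 (1/2)) :=
  cont_gLam.mono (fun x hx => ⟨by linarith [hx.1], by linarith [hx.2]⟩)
lemma cgM12 : ContinuousOn (fun x => (g 2 (x/(1+x)) + g 2 (-(x/(1+x))))/(1+x)) (Icc 0 (1/2)) := by
  refine ContinuousOn.div (cont_gLam.comp (f := fun x : ℝ => x/(1+x)) ?_ (fun x hx => w_mem hx)) (by fun_prop) (fun x hx => by linarith [hx.1])
  exact ContinuousOn.div (by fun_prop) (by fun_prop) (fun x hx => by linarith [hx.1])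

noncomputable def e2I (x : ℝ) : ℝ := log x * (g 2 x / (1+x))
noncomputable def lM (x : ℝ) : ℝ := (log x - log (1-x)) * ((g 2 (x/(1+x)) + g 2 (-(x/(1+x))))/(1+x))
noncomputable def lL (x : ℝ) : ℝ := log x * ((g 2 x + g 2 (-x)) * (3 + x/(1-x))) - 2 * log (1-x) * (g 2 x + g 2 (-x))

lemma int_e2I : IntervalIntegrable e2I volume 0 (1/2) := by
  unfold e2I
  apply cIl
  exact ContinuousOn.div cg12 (by fun_prop) (fun x hx => by linarith [hx.1])
lemma int_lM : IntervalIntegrable lM volume 0 (1/2) := by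
  have := (cIl cgM12).sub (cI (cc12.mul cgM12))
  refine this.congr_uIoo ?_
  intro x hx; simp only [lM, Pi.mul_apply]; ring
lemma int_lL : IntervalIntegrable lL volume 0 (1/2) := by
  have c : ContinuousOn (fun x : ℝ => 3 + x/(1-x)) (Icc 0 (1/2)) :=
    continuousOn_const.add (ContinuousOn.div (by fun_prop) (by fun_prop) (fun x hx => by linarith [hx.2]))
  have := (cIl (cgL12.mul c)).sub (cI ((cc12.const_mul 2).mul cgL12))
  refine this.congr_uIoo ?_
  intro x hx; simp only [lL, Pi.mul_apply]

lemma tI_eq {x : ℝ} (hx : x ∈ Ioo (0:ℝ) (1/2)) : tI x = 4 * e2I x + lL x := by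
  unfold tI e2I lL
  rw [Lam_eq, Li_eq]
  have h0 := hx.1.ne'
  have h1 : 1 + x ≠ 0 := by linarith [hx.1]
  have h2 : 1 - x ≠ 0 := by linarith [hx.2]
  field_simp
  ring

lemma int_tI : IntervalIntegrable tI volume 0 (1/2) := by
  refine ((int_e2I.const_mul 4).add int_lL).congr_uIoo ?_
  intro x hx
  rw [uIoo_of_le (by norm_num)] at hx
  rw [tI_eq hx]

lemma A2 : 4 * ∫ x in (0:ℝ)..(1/2), lM x = ∫ x in (0:ℝ)..(1/2), lL x := by
  have h := fub
  have : ∫ x in (0:ℝ)..(1/2), (∫ u in (-1:ℝ)..1, log u * Psi x u) = ∫ x in (0:ℝ)..(1/2), (lL x - 4 * lM x) := by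
    apply intervalIntegral.integral_congr_Ioo_of_le (by norm_num)
    intro x hx
    simp only []
    rw [int_u hx.1 hx.2]
    unfold lL lM
    rw [Lam_eq, Lam_eq]
    have h0 := hx.1.ne'
    have h1 : 1 + x ≠ 0 := by linarith [hx.1]
    have h2 : 1 - x ≠ 0 := by linarith [hx.2]
    generalize g 2 (x/(1+x)) = G1
    generalize g 2 (-(x/(1+x))) = G2
    field_simp
    ring
  rw [this, intervalIntegral.integral_sub int_lL (int_lM.const_mul 4), intervalIntegral.integral_const_mul] at h
  linarith

lemma cont_xlog2 : ContinuousOn (fun x : ℝ => x * log x ^2) (Ici 0) := by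
  have : Continuous (fun x : ℝ => 4 * (√x * log (√x))^2) := by
    have := cont_xlog.comp continuous_sqrt
    exact (this.pow 2).const_mul 4
  refine this.continuousOn.congr ?_
  intro x hx
  simp only []
  rw [Real.log_sqrt hx, mul_pow, Real.sq_sqrt hx]; ring

lemma int_log2 : IntervalIntegrable (fun x => log x^2) volume 0 (1/2) := by
  refine intervalIntegral.intervalIntegrable_deriv_of_nonneg (g := fun x => x*log x^2 - 2*(x*log x) + 2*x) ?_ ?_ ?_
  · rw [uIcc_of_le (by norm_num)]
    have := cont_xlog2.mono (t := Icc (0:ℝ) (1/2)) (fun x hx => hx.1)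
    exact (this.sub (cont_xlog.continuousOn.const_mul 2)).add (by fun_prop)
  · intro x hx
    rw [min_eq_left (by norm_num)] at hx
    have h0 := hx.1.ne'
    have d := Real.hasDerivAt_log h0
    have i := hasDerivAt_id' x
    refine (((i.fun_mul (d.fun_pow 2)).fun_sub ((i.fun_mul d).const_mul 2)).fun_add (i.const_mul 2)).congr_deriv ?_
    field_simp
    ring
  · intro x hx; positivity

noncomputable def vM (x : ℝ) : ℝ := (log x^2/2 + Li 2 x) * (2/(1+2*x) * g 1 (2*x/(1+2*x)) / (1+x))

lemma log12 {x : ℝ} (hx : 0 ≤ x) : log (1+2*x) = 2*x/(1+2*x) * g 1 (2*x/(1+2*x)) := by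
  have h : 0 < 1+2*x := by linarith
  have h1 : |2*x/(1+2*x)| < 1 := by
    rw [abs_of_nonneg (by positivity), div_lt_iff₀ h]; linarith
  have := log_one_sub h1
  have e : 1 - 2*x/(1+2*x) = (1+2*x)⁻¹ := by field_simp; ring
  rw [e, log_inv] at this
  linarith

lemma A1 : H4 (1/2) = (∫ x in (0:ℝ)..(1/2), e2I x) + (∫ x in (0:ℝ)..(1/2), lM x) - zeta' 2 / 2 * Lam (1/3) := by
  have cq : ContinuousOn (fun x : ℝ => 2/(1+2*x) * g 1 (2*x/(1+2*x)) / (1+x)) (Icc 0 (1/2)) := by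
    refine ContinuousOn.div (ContinuousOn.mul ?_ ?_) (by fun_prop) (fun x hx => by linarith [hx.1])
    · exact ContinuousOn.div (by fun_prop) (by fun_prop) (fun x hx => by linarith [hx.1])
    · refine (cont_g_lt 1).comp (ContinuousOn.div (by fun_prop) (by fun_prop) (fun x hx => by linarith [hx.1])) ?_
      intro x hx
      have : 0 < 1 + 2*x := by linarith [hx.1]
      constructor
      · rw [lt_div_iff₀ this]; linarith [hx.1]
      · rw [div_lt_iff₀ this]; linarith
  have cL : ContinuousOn (Li 2) (Icc 0 (1/2)) :=
    (cont_Li le_rfl).mono (fun x hx => ⟨by linarith [hx.1], by linarith [hx.2]⟩)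
  have int_vM : IntervalIntegrable vM volume 0 (1/2) := by
    have h1 := (int_log2.mul_continuousOn (g := fun x : ℝ => 2/(1+2*x) * g 1 (2*x/(1+2*x)) / (1+x)) (by rw [uIcc_of_le (by norm_num)]; exact cq)).const_mul (1/2)
    have h2 := cI (cL.mul cq)
    refine (h1.add h2).congr_uIoo ?_
    intro x hx
    simp only [vM, Pi.mul_apply]; ring
  have hH : H4 (1/2) = ∫ x in (0:ℝ)..(1/2), (e2I x - vM x) := by
    unfold H4
    apply intervalIntegral.integral_congr_Ioo_of_le (by norm_num)
    intro x hx
    have x0 := hx.1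
    have x1 := hx.2
    simp only []
    rw [Li_one (by rw [abs_lt]; constructor <;> linarith), log_div x0.ne' (by linarith), show 1 - -2*x = 1+2*x by ring]
    unfold e2I vM
    rw [log12 x0.le, Li_eq]
    have : 1 + 2*x ≠ 0 := by linarith
    have : 1 + x ≠ 0 := by linarith
    generalize g 1 (2*x/(1+2*x)) = G
    field_simp
    ring
  have hW : ∫ x in (0:ℝ)..(1/2), (lM x + vM x) = zeta' 2/2 * Lam (1/3) := by
    set W : ℝ → ℝ := fun x => (log x^2/2 + Li 2 x) * Lam (x/(1+x)) with hW
    have hc : ContinuousOn W (Icc 0 (1/2)) := by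
      have h1 : ContinuousOn (fun x => x*log x^2/2 + x * Li 2 x) (Icc 0 (1/2)) :=
        ((cont_xlog2.mono Icc_subset_Ici_self).div_const 2).add (continuousOn_id.mul cL)
      refine (h1.mul cgM12).congr ?_
      intro x hx
      have : 1 + x ≠ 0 := by linarith [hx.1]
      simp only [hW, Lam_eq, Pi.mul_apply]
      generalize g 2 (x/(1+x)) = G1
      generalize g 2 (-(x/(1+x))) = G2
      field_simp
    have hd : ∀ x ∈ Ioo (0:ℝ) (1/2), HasDerivAt W (lM x + vM x) x := by
      intro x hx
      have x0 := hx.1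
      have x1 := hx.2
      have i := hasDerivAt_id' x
      have p1 : 0 < 1 + x := by linarith
      have dl := Real.hasDerivAt_log x0.ne'
      have b : HasDerivAt (fun x : ℝ => x/(1+x)) (1/(1+x)^2) x := by
        refine (i.fun_div (i.const_add 1) p1.ne').congr_deriv ?_
        field_simp; ring
      have b' : HasDerivAt (fun x : ℝ => -(x/(1+x))) (-(1/(1+x)^2)) x := b.fun_neg
      have w0 : 0 < x/(1+x) := by positivity
      have w1 : x/(1+x) < 1 := by rw [div_lt_iff₀ p1]; linarith
      have d1 := dLi2 i (by rw [abs_lt]; constructor <;> linarith) x0.ne'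
      have d2 := dLi2 b (by rw [abs_lt]; constructor <;> linarith) w0.ne'
      have d3 := dLi2 b' (by rw [abs_lt]; constructor <;> linarith) (by linarith)
      refine ((((dl.fun_pow 2).div_const 2).fun_add d1).fun_mul (d2.fun_sub d3)).congr_deriv ?_
      have e1 : log (1 - x/(1+x)) = - log (1+x) := by
        rw [← log_inv]; congr 1; field_simp; ring
      have e2 : log (1 - -(x/(1+x))) = log (1+2*x) - log (1+x) := by
        rw [← log_div (by linarith) p1.ne']; congr 1; field_simp; ring
      rw [e1, e2]
      have hL : Lam (x/(1+x)) = Li 2 (x/(1+x)) - Li 2 (-(x/(1+x))) := rfl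
      rw [← hL, Lam_eq, log12 x0.le]
      unfold lM vM
      have : 1 + 2*x ≠ 0 := by linarith
      generalize g 2 (x/(1+x)) = G1
      generalize g 2 (-(x/(1+x))) = G2
      generalize g 1 (2*x/(1+2*x)) = G
      field_simp
      ring
    rw [intervalIntegral.integral_eq_sub_of_hasDerivAt_of_le (by norm_num) hc hd (int_lM.add int_vM)]
    have h2 := Li2_refl (x := 1/2) (by norm_num) (by norm_num)
    rw [show (1:ℝ) - 1/2 = 1/2 by norm_num] at h2
    have : log (1/2)^2/2 + Li 2 (1/2) = zeta' 2/2 := by linarith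
    simp only [hW]
    rw [this]
    norm_num [Lam, Li_zero]
  rw [intervalIntegral.integral_add int_lM int_vM] at hW
  rw [hH, intervalIntegral.integral_sub int_e2I int_vM]
  linarith

lemma H4_T : 4 * H4 (1/2) = (∫ x in (0:ℝ)..(1/2), tI x) - 2 * zeta' 2 * Lam (1/3) := by
  have : ∫ x in (0:ℝ)..(1/2), tI x = ∫ x in (0:ℝ)..(1/2), (4 * e2I x + lL x) :=
    intervalIntegral.integral_congr_Ioo_of_le (by norm_num) (fun x hx => tI_eq hx)
  rw [this, intervalIntegral.integral_add (int_e2I.const_mul 4) int_lL, intervalIntegral.integral_const_mul, ← A2, A1]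
  ring

end H4P
end

section
open Set Real MeasureTheory

namespace H4P

noncomputable def J (k : ℕ) (α β : ℝ) : ℝ := ∫ z in (0:ℝ)..1, Li k (α*z) * (β/(1-β*z))

lemma cont_Li_lt (k : ℕ) : ContinuousOn (Li k) (Ioo (-1) 1) := by
  have : Li k = fun z => z * g k z := by ext z; exact Li_eq k z
  rw [this]
  exact continuousOn_id.mul (cont_g_lt k)

lemma az_mem {α z : ℝ} (h : |α| < 1) (hz : z ∈ Icc (0:ℝ) 1) : α*z ∈ Ioo (-1:ℝ) 1 := by
  apply abs_lt.1
  rw [abs_mul, abs_of_nonneg hz.1]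
  nlinarith [hz.1, hz.2, abs_nonneg α]

lemma bz_pos {β z : ℝ} (h : |β| < 1) (hz : z ∈ Icc (0:ℝ) 1) : 0 < 1 - β*z := by
  have := (az_mem h hz).2; linarith

lemma J_cont (k : ℕ) {a b : ℝ} {α β : ℝ → ℝ} (hα : ContinuousOn α (Icc a b)) (hβ : ContinuousOn β (Icc a b))
    (ha : ∀ s ∈ Icc a b, |α s| < 1) (hb : ∀ s ∈ Icc a b, |β s| < 1) :
    ContinuousOn (fun s => J k (α s) (β s)) (Icc a b) := by
  set h : ℝ × ℝ → ℝ := fun p => Li k (α p.1*p.2) * (β p.1/(1-β p.1*p.2)) with hh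
  have c1 : ContinuousOn (fun p : ℝ × ℝ => α p.1) (Icc a b ×ˢ Icc (0:ℝ) 1) :=
    hα.comp continuousOn_fst (fun p hp => hp.1)
  have c2 : ContinuousOn (fun p : ℝ × ℝ => β p.1) (Icc a b ×ˢ Icc (0:ℝ) 1) :=
    hβ.comp continuousOn_fst (fun p hp => hp.1)
  have hc : ContinuousOn h (Icc a b ×ˢ Icc (0:ℝ) 1) := by
    refine ((cont_Li_lt k).comp (c1.mul continuousOn_snd) (fun p hp => az_mem (ha _ hp.1) hp.2)).mul
      (c2.div (continuousOn_const.sub (c2.mul continuousOn_snd)) (fun p hp => (bz_pos (hb _ hp.1) hp.2).ne'))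
  obtain ⟨C, hC⟩ := (isCompact_Icc.prod isCompact_Icc).exists_bound_of_continuousOn hc
  intro s hs
  unfold J
  have hI : uIoc (0:ℝ) 1 = Ioc 0 1 := uIoc_of_le (by norm_num)
  refine intervalIntegral.continuousWithinAt_of_dominated_interval (bound := fun _ => C) ?_ ?_ (by simp) ?_
  · filter_upwards [self_mem_nhdsWithin] with x hx
    rw [hI]
    apply ContinuousOn.aestronglyMeasurable _ measurableSet_Ioc
    exact hc.comp (f := fun z : ℝ => (x, z)) (by fun_prop) (fun z hz => ⟨hx, Ioc_subset_Icc_self hz⟩)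
  · filter_upwards [self_mem_nhdsWithin] with x hx
    refine Filter.Eventually.of_forall ?_
    intro t ht
    rw [hI] at ht
    exact hC (x, t) ⟨hx, Ioc_subset_Icc_self ht⟩
  · refine Filter.Eventually.of_forall ?_
    intro t ht
    rw [hI] at ht
    exact (hc.comp (f := fun x : ℝ => (x, t)) (by fun_prop) (fun z hz => ⟨hz, Ioc_subset_Icc_self ht⟩)) s hs

lemma J_deriv (k : ℕ) {a b : ℝ} {α β α' β' : ℝ → ℝ}
    (dα : ∀ s ∈ Icc a b, HasDerivAt α (α' s) s) (dβ : ∀ s ∈ Icc a b, HasDerivAt β (β' s) s)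
    (cα : ContinuousOn α' (Icc a b)) (cβ : ContinuousOn β' (Icc a b))
    (ha : ∀ s ∈ Icc a b, |α s| < 1) (hb : ∀ s ∈ Icc a b, |β s| < 1)
    {s : ℝ} (hs : s ∈ Ioo a b) (ha0 : α s ≠ 0) (hb0 : β s ≠ 0) :
    HasDerivAt (fun s => J (k+1) (α s) (β s))
      ((α' s/α s - β' s/β s) * J k (α s) (β s) + Li (k+1) (α s) * (β' s/(1 - β s))) s := by
  set h' : ℝ × ℝ → ℝ := fun p => g k (α p.1*p.2) * (α' p.1 * p.2) * (β p.1/(1-β p.1*p.2))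
    + Li (k+1) (α p.1*p.2) * (β' p.1/(1-β p.1*p.2)^2) with hh'
  set h : ℝ × ℝ → ℝ := fun p => Li (k+1) (α p.1*p.2) * (β p.1/(1-β p.1*p.2)) with hh
  have hα : ContinuousOn α (Icc a b) := fun s hs => (dα s hs).continuousAt.continuousWithinAt
  have hβ : ContinuousOn β (Icc a b) := fun s hs => (dβ s hs).continuousAt.continuousWithinAt
  set K := Icc a b ×ˢ Icc (0:ℝ) 1 with hK
  have c1 : ContinuousOn (fun p : ℝ × ℝ => α p.1) K := hα.comp continuousOn_fst (fun p hp => hp.1)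
  have c2 : ContinuousOn (fun p : ℝ × ℝ => β p.1) K := hβ.comp continuousOn_fst (fun p hp => hp.1)
  have c3 : ContinuousOn (fun p : ℝ × ℝ => α' p.1) K := cα.comp continuousOn_fst (fun p hp => hp.1)
  have c4 : ContinuousOn (fun p : ℝ × ℝ => β' p.1) K := cβ.comp continuousOn_fst (fun p hp => hp.1)
  have c5 : ContinuousOn (fun p : ℝ × ℝ => Li (k+1) (α p.1*p.2)) K :=
    (cont_Li_lt (k+1)).comp (c1.mul continuousOn_snd) (fun p hp => az_mem (ha _ hp.1) hp.2)
  have c6 : ContinuousOn (fun p : ℝ × ℝ => 1 - β p.1*p.2) K := continuousOn_const.sub (c2.mul continuousOn_snd)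
  have c7 : ContinuousOn (fun p : ℝ × ℝ => g k (α p.1*p.2)) K :=
    (cont_g_lt k).comp (c1.mul continuousOn_snd) (fun p hp => az_mem (ha _ hp.1) hp.2)
  have hne : ∀ p ∈ K, 1 - β p.1*p.2 ≠ 0 := fun p hp => (bz_pos (hb _ hp.1) hp.2).ne'
  have hc : ContinuousOn h K := c5.mul (c2.div c6 hne)
  have hc' : ContinuousOn h' K :=
    ((c7.mul (c3.mul continuousOn_snd)).mul (c2.div c6 hne)).add
      (c5.mul (c4.div (c6.pow 2) (fun p hp => pow_ne_zero _ (hne p hp))))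
  obtain ⟨C, hC⟩ := (isCompact_Icc.prod isCompact_Icc).exists_bound_of_continuousOn hc'
  have hI : uIoc (0:ℝ) 1 = Ioc 0 1 := uIoc_of_le (by norm_num)
  have hIcc : uIcc (0:ℝ) 1 = Icc 0 1 := uIcc_of_le (by norm_num)
  have sl : ∀ f : ℝ × ℝ → ℝ, ContinuousOn f K → ∀ x ∈ Icc a b, ContinuousOn (fun z => f (x,z)) (Icc 0 1) := by
    intro f hf x hx
    exact hf.comp (f := fun z : ℝ => (x, z)) (by fun_prop) (fun z hz => ⟨hx, hz⟩)
  have hs' : s ∈ Icc a b := Ioo_subset_Icc_self hs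
  have main := intervalIntegral.hasDerivAt_integral_of_dominated_loc_of_deriv_le (μ := volume)
    (F := fun s z => h (s,z)) (F' := fun s z => h' (s,z)) (x₀ := s) (s := Icc a b) (a := 0) (b := 1) (bound := fun _ => C)
    (Icc_mem_nhds hs.1 hs.2)
    (by
      filter_upwards [Icc_mem_nhds hs.1 hs.2] with x hx
      rw [hI]
      exact ((sl h hc x hx).mono Ioc_subset_Icc_self).aestronglyMeasurable measurableSet_Ioc)
    (by
      apply ContinuousOn.intervalIntegrable; rw [hIcc]; exact sl h hc s hs')
    (by
      rw [hI]
      exact ((sl h' hc' s hs').mono Ioc_subset_Icc_self).aestronglyMeasurable measurableSet_Ioc)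
    (by
      refine Filter.Eventually.of_forall ?_
      intro t ht x hx
      rw [hI] at ht
      exact hC (x, t) ⟨hx, Ioc_subset_Icc_self ht⟩)
    (by simp)
    (by
      refine Filter.Eventually.of_forall ?_
      intro t ht x hx
      rw [hI] at ht
      have ht' := Ioc_subset_Icc_self ht
      have q := (bz_pos (hb x hx) ht').ne'
      have dL := (hasDerivAt_Li_g k (abs_lt.2 (az_mem (ha x hx) ht'))).comp x ((dα x hx).mul_const t)
      have dB := (dβ x hx).fun_div (((dβ x hx).mul_const t).const_sub 1) q
      refine (dL.fun_mul dB).congr_deriv ?_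
      simp only [hh', Function.comp]
      field_simp
      ring)
  refine main.2.congr_deriv ?_
  -- integrate by parts
  set A := α s
  set B := β s
  have hA : |A| < 1 := ha s hs'
  have hB : |B| < 1 := hb s hs'
  have parts : ∫ z in (0:ℝ)..1, (Li k (A*z) * (1/(1-B*z)) + Li (k+1) (A*z) * (1/(1-B*z)^2)) = Li (k+1) A * (1/(1-B)) := by
    have hh := intervalIntegral.integral_eq_sub_of_hasDerivAt (a := 0) (b := 1) (f := fun z => Li (k+1) (A*z) * (z/(1-B*z)))
      (f' := fun z => Li k (A*z) * (1/(1-B*z)) + Li (k+1) (A*z) * (1/(1-B*z)^2)) (by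
        intro z hz
        rw [hIcc] at hz
        have q := (bz_pos hB hz).ne'
        have i := hasDerivAt_id' z
        have dL := (hasDerivAt_Li_g k (abs_lt.2 (az_mem hA hz))).comp z (i.const_mul A)
        have dB := i.fun_div ((i.const_mul B).const_sub 1) q
        refine (dL.fun_mul dB).congr_deriv ?_
        simp only [Function.comp, Li_eq k]
        field_simp
        ring) (by
        apply ContinuousOn.intervalIntegrable
        rw [hIcc]
        have cm : ContinuousOn (fun z => A*z) (Icc (0:ℝ) 1) := by fun_prop
        have e1 : ContinuousOn (fun z => Li k (A*z)) (Icc (0:ℝ) 1) := (cont_Li_lt k).comp cm (fun z hz => az_mem hA hz)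
        have e2 : ContinuousOn (fun z => Li (k+1) (A*z)) (Icc (0:ℝ) 1) := (cont_Li_lt (k+1)).comp cm (fun z hz => az_mem hA hz)
        have e3 : ContinuousOn (fun z => 1 - B*z) (Icc (0:ℝ) 1) := by fun_prop
        exact (e1.mul (continuousOn_const.div e3 (fun z hz => (bz_pos hB hz).ne'))).add
          (e2.mul (continuousOn_const.div (e3.pow 2) (fun z hz => pow_ne_zero _ (bz_pos hB hz).ne'))))
    rw [hh]; simp [Li_zero]
  have cm : ContinuousOn (fun z => A*z) (Icc (0:ℝ) 1) := by fun_prop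
  have e1 : ContinuousOn (fun z => Li k (A*z)) (Icc (0:ℝ) 1) := (cont_Li_lt k).comp cm (fun z hz => az_mem hA hz)
  have e2 : ContinuousOn (fun z => Li (k+1) (A*z)) (Icc (0:ℝ) 1) := (cont_Li_lt (k+1)).comp cm (fun z hz => az_mem hA hz)
  have e3 : ContinuousOn (fun z => 1 - B*z) (Icc (0:ℝ) 1) := by fun_prop
  have i1 : IntervalIntegrable (fun z => Li k (A*z) * (B/(1-B*z))) volume 0 1 := by
    apply ContinuousOn.intervalIntegrable; rw [hIcc]
    exact e1.mul (continuousOn_const.div e3 (fun z hz => (bz_pos hB hz).ne'))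
  have i2 : IntervalIntegrable (fun z => Li k (A*z) * (1/(1-B*z)) + Li (k+1) (A*z) * (1/(1-B*z)^2)) volume 0 1 := by
    apply ContinuousOn.intervalIntegrable; rw [hIcc]
    exact (e1.mul (continuousOn_const.div e3 (fun z hz => (bz_pos hB hz).ne'))).add
          (e2.mul (continuousOn_const.div (e3.pow 2) (fun z hz => pow_ne_zero _ (bz_pos hB hz).ne')))
  have split : ∫ z in (0:ℝ)..1, h' (s,z) = ∫ z in (0:ℝ)..1, ((α' s/A - β' s/B) * (Li k (A*z) * (B/(1-B*z)))
      + β' s * (Li k (A*z) * (1/(1-B*z)) + Li (k+1) (A*z) * (1/(1-B*z)^2))) := by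
    apply intervalIntegral.integral_congr
    intro z hz
    rw [hIcc] at hz
    have q := (bz_pos hB hz).ne'
    simp only [hh']
    change g k (A*z) * (α' s * z) * (B/(1-B*z)) + Li (k+1) (A*z) * (β' s/(1-B*z)^2) = _
    rw [Li_eq k]
    field_simp
    ring
  rw [split, intervalIntegral.integral_add (i1.const_mul _) (i2.const_mul _), intervalIntegral.integral_const_mul,
    intervalIntegral.integral_const_mul, parts]
  unfold J
  ring

lemma J_zero {α β : ℝ} (ha : |α| < 1) (hb : |β| < 1) (hab : α ≠ β) :
    J 0 α β = (- β * log (1-α) + α * log (1-β))/(α-β) := by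
  unfold J
  have hIcc : uIcc (0:ℝ) 1 = Icc 0 1 := uIcc_of_le (by norm_num)
  have hL : ∀ w : ℝ, |w| < 1 → Li 0 w = w/(1-w) := by
    intro w hw
    rw [Li_eq]
    unfold g
    simp only [pow_zero, div_one]
    rw [tsum_geometric_of_abs_lt_one hw]
    rfl
  have cm : ContinuousOn (fun z => α*z) (Icc (0:ℝ) 1) := by fun_prop
  have e3 : ContinuousOn (fun z => 1 - β*z) (Icc (0:ℝ) 1) := by fun_prop
  rw [intervalIntegral.integral_eq_sub_of_hasDerivAt (f := fun z => (- β * log (1-α*z) + α * log (1-β*z))/(α-β))]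
  · simp
  · intro z hz
    rw [hIcc] at hz
    have q := (bz_pos hb hz).ne'
    have q' := (bz_pos ha hz).ne'
    have i := hasDerivAt_id' z
    have d1 := dlog ((i.const_mul α).const_sub 1) q'
    have d2 := dlog ((i.const_mul β).const_sub 1) q
    refine (((d1.const_mul (-β)).fun_add (d2.const_mul α)).div_const (α-β)).congr_deriv ?_
    rw [hL _ (abs_lt.2 (az_mem ha hz))]
    have := sub_ne_zero.2 hab
    field_simp
    ring
  · apply ContinuousOn.intervalIntegrable; rw [hIcc]
    exact ((cont_Li_lt 0).comp cm (fun z hz => az_mem ha hz)).mul (continuousOn_const.div e3 (fun z hz => (bz_pos hb hz).ne'))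

lemma J_b0 (k : ℕ) (α : ℝ) : J k α 0 = 0 := by simp [J]

end H4P
end

section
open Set Real MeasureTheory

namespace H4P

noncomputable def fa (x : ℝ) : ℝ := log x
noncomputable def fc (x : ℝ) : ℝ := log (1 - x)
noncomputable def fd (x : ℝ) : ℝ := log (1 + x)
noncomputable def fP (k : ℕ) (x : ℝ) : ℝ := Li k x
noncomputable def fM (k : ℕ) (x : ℝ) : ℝ := Li k (-x)
noncomputable def fA (k : ℕ) (x : ℝ) : ℝ := Li k (1 - x)
noncomputable def fB (k : ℕ) (x : ℝ) : ℝ := Li k (1 / (1 + x))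
noncomputable def fC (k : ℕ) (x : ℝ) : ℝ := Li k (1 - x^2)
noncomputable def fN (k : ℕ) (x : ℝ) : ℝ := Li k (x / (x - 1))
noncomputable def fR (k : ℕ) (x : ℝ) : ℝ := Li k (x / (1 + x))
noncomputable def fQ (k : ℕ) (x : ℝ) : ℝ := Li k (x^2 / (x^2 - 1))

lemma dLiG (k : ℕ) {f : ℝ → ℝ} {f' x D V : ℝ} (hf : HasDerivAt f f' x) (h1 : |f x| < 1) (h0 : f x ≠ 0)
    (hD : f' / f x = D) (hV : Li k (f x) = V) : HasDerivAt (fun y => Li (k+1) (f y)) (V * D) x := by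
  subst hD hV; exact dLi k hf h1 h0

section atoms
variable {x : ℝ} (h : x ∈ Ioo (0:ℝ) (1/2))
include h

lemma xne : x ≠ 0 := h.1.ne'
lemma x1ne : 1 - x ≠ 0 := by linarith [h.2]
lemma x2ne : 1 + x ≠ 0 := by linarith [h.1]
lemma x3ne : x - 1 ≠ 0 := by linarith [h.2]
lemma logCD : log (1 - x^2) = fc x + fd x := by
  unfold fc fd; rw [← log_mul (x1ne h) (x2ne h)]; congr 1; ring
lemma logx2 : log (x^2) = 2 * fa x := by
  unfold fa; rw [log_pow]; norm_num
lemma logR1 : log (1 - x/(1+x)) = - fd x := by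
  unfold fd; rw [← log_inv]; congr 1; have := x2ne h; field_simp; ring
lemma logR : log (x/(1+x)) = fa x - fd x := by
  unfold fd fa; rw [log_div (xne h) (x2ne h)]
lemma R_eq : x/(1+x)/(x/(1+x) - 1) = -x := by
  have := x2ne h
  have e : x/(1+x) - 1 = -(1/(1+x)) := by field_simp; ring
  rw [e]; field_simp
lemma R1_eq : 1 - x/(1+x) = 1/(1+x) := by
  have := x2ne h
  field_simp; ring
lemma R_bd : 0 < x/(1+x) ∧ x/(1+x) ≤ 1/2 := by
  have := h.1; have := h.2
  constructor
  · positivity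
  · rw [div_le_iff₀ (by linarith)]; linarith

lemma da : HasDerivAt fa x⁻¹ x := Real.hasDerivAt_log (xne h)
lemma dc : HasDerivAt fc (-(1-x)⁻¹) x := by
  have := dlog ((hasDerivAt_id' x).const_sub 1) (x1ne h)
  exact this.congr_deriv (by ring)
lemma dd : HasDerivAt fd ((1+x)⁻¹) x := by
  have := dlog ((hasDerivAt_id' x).const_add 1) (x2ne h)
  exact this.congr_deriv (by ring)
lemma dP (k : ℕ) : HasDerivAt (fP (k+1)) (fP k x * x⁻¹) x := by
  refine dLiG k (hasDerivAt_id' x) (by rw [abs_lt]; constructor <;> linarith [h.1, h.2]) (xne h) (by ring) rfl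
lemma dM (k : ℕ) : HasDerivAt (fM (k+1)) (fM k x * x⁻¹) x := by
  refine dLiG k (hasDerivAt_id' x).neg (by rw [abs_lt]; constructor <;> linarith [h.1, h.2]) (neg_ne_zero.2 (xne h)) ?_ rfl
  have := xne h
  field_simp
lemma P1 : fP 1 x = - fc x := by
  unfold fP fc; rw [Li_one (by rw [abs_lt]; constructor <;> linarith [h.1, h.2])]
lemma M1 : fM 1 x = - fd x := by
  unfold fM fd; rw [Li_one (by rw [abs_lt]; constructor <;> linarith [h.1, h.2])]
  congr 2; ring
lemma dP2 : HasDerivAt (fP 2) (-fc x * x⁻¹) x := by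
  have := dP h 1; rwa [P1 h] at this
lemma dM2 : HasDerivAt (fM 2) (-fd x * x⁻¹) x := by
  have := dM h 1; rwa [M1 h] at this

lemma rA2 : fA 2 x = zeta' 2 - fa x * fc x - fP 2 x := Li2_refl h.1 (by linarith [h.2])
lemma rR2 : fR 2 x = - fM 2 x - fd x^2/2 := by
  have := Li2_landen (x := -x) (by linarith [h.2]) (by linarith [h.1])
  unfold fR fM fd
  have e : x/(1+x) = -x/(-x-1) := by
    rw [show -x-1 = -(1+x) by ring, neg_div_neg_eq]
  rw [e, this]; congr 3; ring_nf
lemma rB2 : fB 2 x = zeta' 2 + fd x * (fa x - fd x) + fM 2 x + fd x^2/2 := by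
  have := Li2_refl (x := x/(1+x)) (R_bd h).1 (by linarith [(R_bd h).2])
  rw [logR h, logR1 h, R1_eq h] at this
  have r := rR2 h
  unfold fR at r
  unfold fB; rw [this, r]; ring
lemma X2 (k : ℕ) (hk : 2 ≤ k) : Li k (x^2) = 2^k/2 * (fP k x + fM k x) := by
  have := Li_dup hk (z := x) (by rw [abs_le]; constructor <;> linarith [h.1, h.2])
  unfold fP fM; linarith
lemma xsq : 0 < x^2 ∧ x^2 < 1/4 := ⟨pow_pos h.1 2, by nlinarith [h.1, h.2]⟩
lemma rC2 : fC 2 x = zeta' 2 - 2*fa x * (fc x + fd x) - 2*fP 2 x - 2*fM 2 x := by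
  have := Li2_refl (x := x^2) (xsq h).1 (by linarith [(xsq h).2])
  rw [logx2 h, logCD h, X2 h 2 le_rfl] at this
  unfold fC; rw [this]; ring
lemma rN2 : fN 2 x = - fP 2 x - fc x^2/2 := Li2_landen (by linarith [h.1]) h.2.le
lemma rQ2 : fQ 2 x = - 2*fP 2 x - 2*fM 2 x - (fc x + fd x)^2/2 := by
  have := Li2_landen (x := x^2) (by linarith [(xsq h).1]) (by linarith [(xsq h).2])
  rw [logCD h, X2 h 2 le_rfl] at this
  unfold fQ; rw [this]; ring
lemma rN3 : fN 3 x = zeta' 3 + fc x^3/6 + zeta' 2 * fc x - fa x * fc x^2/2 - fP 3 x - fA 3 x :=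
  Li3_three h.1 h.2.le
lemma rA3 : fA 3 x = zeta' 3 + fc x^3/6 + zeta' 2 * fc x - fa x * fc x^2/2 - fP 3 x - fN 3 x := by
  rw [rN3 h]; ring
lemma rC3 : fC 3 x = zeta' 3 + (fc x + fd x)^3/6 + zeta' 2 * (fc x + fd x) - fa x * (fc x+fd x)^2 - 4*fP 3 x - 4*fM 3 x - fQ 3 x := by
  have := Li3_three (x := x^2) (xsq h).1 (by linarith [(xsq h).2])
  rw [logCD h, logx2 h, X2 h 3 (by norm_num)] at this
  unfold fQ fC; rw [this]; ring
lemma rB3 : fB 3 x = zeta' 3 - fd x^3/6 - zeta' 2 * fd x - (fa x - fd x) * fd x^2/2 - fR 3 x - fM 3 x := by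
  have := Li3_three (x := x/(1+x)) (R_bd h).1 (R_bd h).2
  rw [logR h, logR1 h, R1_eq h, R_eq h] at this
  unfold fB fR fM; rw [this]; ring

lemma dA (k : ℕ) : HasDerivAt (fA (k+1)) (fA k x * -(1-x)⁻¹) x := by
  refine dLiG k ((hasDerivAt_id' x).const_sub 1) (by rw [abs_lt]; constructor <;> linarith [h.1, h.2]) (x1ne h) ?_ rfl
  ring
lemma dB (k : ℕ) : HasDerivAt (fB (k+1)) (fB k x * -(1+x)⁻¹) x := by
  have h0 := h.1
  have := x2ne h
  refine dLiG k ((hasDerivAt_const x 1).fun_div ((hasDerivAt_id' x).const_add 1) this) ?_ ?_ ?_ rfl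
  · rw [abs_of_pos (by positivity), div_lt_one (by positivity)]; linarith
  · positivity
  · field_simp; ring
lemma dC (k : ℕ) : HasDerivAt (fC (k+1)) (fC k x * ((1+x)⁻¹ - (1-x)⁻¹)) x := by
  have h0 := xsq h
  have e1 := x2ne h
  have e2 := x1ne h
  have : 1 - x^2 ≠ 0 := by linarith
  refine dLiG k (((hasDerivAt_id' x).fun_pow 2).const_sub 1) ?_ this ?_ rfl
  · rw [abs_lt]; constructor <;> linarith
  · rw [show 1 - x^2 = (1-x)*(1+x) by ring]; simp; field_simp; ring
lemma dN (k : ℕ) : HasDerivAt (fN (k+1)) (fN k x * (x⁻¹ + (1-x)⁻¹)) x := by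
  have h0 := xne h
  have e1 := x3ne h
  have e2 := x1ne h
  have e3 : x - 1 < 0 := by linarith [h.2]
  refine dLiG k ((hasDerivAt_id' x).fun_div ((hasDerivAt_id' x).sub_const 1) e1) ?_ (div_ne_zero h0 e1) ?_ rfl
  · rw [abs_lt]
    constructor
    · rw [lt_div_iff_of_neg e3]; linarith [h.2]
    · rw [div_lt_iff_of_neg e3]; linarith
  · rw [show x - 1 = -(1-x) by ring]; field_simp; ring
lemma dR (k : ℕ) : HasDerivAt (fR (k+1)) (fR k x * (x⁻¹ - (1+x)⁻¹)) x := by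
  have h0 := xne h
  have e1 := x2ne h
  refine dLiG k ((hasDerivAt_id' x).fun_div ((hasDerivAt_id' x).const_add 1) e1) ?_ (div_ne_zero h0 e1) ?_ rfl
  · rw [abs_of_pos (R_bd h).1]; linarith [(R_bd h).2]
  · field_simp
lemma dQ (k : ℕ) : HasDerivAt (fQ (k+1)) (fQ k x * (2*x⁻¹ + (1-x)⁻¹ - (1+x)⁻¹)) x := by
  have h0 := xne h
  have e1 := x2ne h
  have e2 := x1ne h
  have e3 : x^2 - 1 < 0 := by linarith [(xsq h).2]
  have e4 := (xsq h).2
  refine dLiG k (((hasDerivAt_id' x).fun_pow 2).fun_div (((hasDerivAt_id' x).fun_pow 2).sub_const 1) e3.ne) ?_ (div_ne_zero (pow_ne_zero _ h0) e3.ne) ?_ rfl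
  · rw [abs_lt]
    constructor
    · rw [lt_div_iff_of_neg e3]; linarith
    · rw [div_lt_iff_of_neg e3]; nlinarith
  · rw [show x^2 - 1 = -((1-x)*(1+x)) by ring]; simp; field_simp; ring
end atoms

section cont
abbrev I2 : Set ℝ := Icc (0:ℝ) (1/2)
lemma cc : ContinuousOn fc I2 := ContinuousOn.log (by fun_prop) (fun y hy => by linarith [hy.2])
lemma cd : ContinuousOn fd I2 := ContinuousOn.log (by fun_prop) (fun y hy => by linarith [hy.1])
lemma bN {x : ℝ} (hx : x ∈ I2) : -1 ≤ x/(x-1) ∧ x/(x-1) ≤ 1 := by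
  have : x - 1 < 0 := by linarith [hx.2]
  constructor
  · rw [le_div_iff_of_neg this]; linarith [hx.2]
  · rw [div_le_iff_of_neg this]; linarith
lemma bR {x : ℝ} (hx : x ∈ I2) : -1 ≤ x/(1+x) ∧ x/(1+x) ≤ 1 := by
  have : 0 < 1 + x := by linarith [hx.1]
  constructor
  · rw [le_div_iff₀ this]; linarith [hx.1]
  · rw [div_le_iff₀ this]; linarith
lemma bQ {x : ℝ} (hx : x ∈ I2) : -1 ≤ x^2/(x^2-1) ∧ x^2/(x^2-1) ≤ 1 := by
  have : x^2 ≤ 1/4 := by nlinarith [hx.1, hx.2]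
  have : x^2 - 1 < 0 := by linarith
  constructor
  · rw [le_div_iff_of_neg this]; linarith [hx.2]
  · rw [div_le_iff_of_neg this]; linarith
lemma sN : ContinuousOn (fun x : ℝ => x/(x-1)) I2 :=
  ContinuousOn.div (by fun_prop) (by fun_prop) (fun y hy => by linarith [hy.2])
lemma sR : ContinuousOn (fun x : ℝ => x/(1+x)) I2 :=
  ContinuousOn.div (by fun_prop) (by fun_prop) (fun y hy => by linarith [hy.1])
lemma sQ : ContinuousOn (fun x : ℝ => x^2/(x^2-1)) I2 :=
  ContinuousOn.div (by fun_prop) (by fun_prop) (fun y hy => by nlinarith [hy.1, hy.2])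
variable {k : ℕ} (hk : 2 ≤ k)
include hk
lemma cP : ContinuousOn (fP k) I2 := cLi hk (by fun_prop) (fun y hy => ⟨by linarith [hy.1], by linarith [hy.2]⟩)
lemma cM : ContinuousOn (fM k) I2 := cLi hk (by fun_prop) (fun y hy => ⟨by linarith [hy.2], by linarith [hy.1]⟩)
lemma cA : ContinuousOn (fA k) I2 := cLi hk (by fun_prop) (fun y hy => ⟨by linarith [hy.2], by linarith [hy.1]⟩)
lemma cB : ContinuousOn (fB k) I2 := by
  refine cLi hk (ContinuousOn.div (by fun_prop) (by fun_prop) (fun y hy => by linarith [hy.1])) ?_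
  intro y hy
  have : 0 < 1 + y := by linarith [hy.1]
  constructor
  · rw [le_div_iff₀ this]; linarith [hy.1]
  · rw [div_le_iff₀ this]; linarith [hy.1]
lemma cC : ContinuousOn (fC k) I2 := cLi hk (by fun_prop) (fun y hy => ⟨by nlinarith [hy.1, hy.2], by nlinarith [hy.1]⟩)
lemma cN : ContinuousOn (fN k) I2 := cLi hk sN (fun _ => bN)
lemma cR : ContinuousOn (fR k) I2 := cLi hk sR (fun _ => bR)
lemma cQ : ContinuousOn (fQ k) I2 := cLi hk sQ (fun _ => bQ)
omit hk in
lemma ca_of {f u h : ℝ → ℝ} (hu : ContinuousOn u I2) (hh : ContinuousOn h I2) (e : ∀ x ∈ I2, f x = x * u x * h x) :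
    ContinuousOn (fun x => fa x * f x) I2 := by
  refine ((cont_xlog.continuousOn (s := I2)).mul (hu.mul hh)).congr ?_
  intro x hx
  simp only [e x hx, fa, Pi.mul_apply]; ring
omit hk in
lemma cac : ContinuousOn (fun x => fa x * fc x) I2 := by
  refine ca_of (u := fun _ => -1) (h := g 1) continuousOn_const ((cont_g_lt 1).mono (fun y hy => ⟨by linarith [hy.1], by linarith [hy.2]⟩)) ?_
  intro x hx
  unfold fc; rw [log_one_sub (by rw [abs_lt]; exact ⟨by linarith [hx.1], by linarith [hx.2]⟩)]; ring
omit hk in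
lemma cad : ContinuousOn (fun x => fa x * fd x) I2 := by
  refine ca_of (u := fun _ => 1) (h := fun x => g 1 (-x)) continuousOn_const ((cont_g_lt 1).comp (by fun_prop) (fun y hy => ⟨by linarith [hy.2], by linarith [hy.1]⟩)) ?_
  intro x hx
  have := log_one_sub (z := -x) (by rw [abs_lt]; exact ⟨by linarith [hx.2], by linarith [hx.1]⟩)
  unfold fd; rw [show 1 + x = 1 - -x by ring, this]; ring
lemma caP : ContinuousOn (fun x => fa x * fP k x) I2 :=
  ca_of (u := fun _ => 1) (h := g k) continuousOn_const ((cont_g hk).mono (fun y hy => ⟨by linarith [hy.1], by linarith [hy.2]⟩))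
    (fun x _ => by unfold fP; rw [Li_eq]; ring)
lemma caM : ContinuousOn (fun x => fa x * fM k x) I2 :=
  ca_of (u := fun _ => -1) (h := fun x => g k (-x)) continuousOn_const ((cont_g hk).comp (by fun_prop) (fun y hy => ⟨by linarith [hy.2], by linarith [hy.1]⟩))
    (fun x _ => by unfold fM; rw [Li_eq]; ring)
lemma caN : ContinuousOn (fun x => fa x * fN k x) I2 :=
  ca_of (u := fun x => 1/(x-1)) (h := fun x => g k (x/(x-1)))
    (ContinuousOn.div (by fun_prop) (by fun_prop) (fun y hy => by linarith [hy.2])) ((cont_g hk).comp sN (fun _ => bN))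
    (fun x _ => by unfold fN; rw [Li_eq]; ring)
lemma caR : ContinuousOn (fun x => fa x * fR k x) I2 :=
  ca_of (u := fun x => 1/(1+x)) (h := fun x => g k (x/(1+x)))
    (ContinuousOn.div (by fun_prop) (by fun_prop) (fun y hy => by linarith [hy.1])) ((cont_g hk).comp sR (fun _ => bR))
    (fun x _ => by unfold fR; rw [Li_eq]; ring)
lemma caQ : ContinuousOn (fun x => fa x * fQ k x) I2 :=
  ca_of (u := fun x => x/(x^2-1)) (h := fun x => g k (x^2/(x^2-1)))
    (ContinuousOn.div (by fun_prop) (by fun_prop) (fun y hy => by nlinarith [hy.1, hy.2])) ((cont_g hk).comp sQ (fun _ => bQ))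
    (fun x _ => by unfold fQ; rw [Li_eq]; ring)
end cont

end H4P
end

section
open Set Real MeasureTheory

namespace H4P

lemma x_alpha (k : ℕ) {x : ℝ} (h : x ∈ Ioo (0:ℝ) (1/2)) :
    HasDerivAt (fun x => J (k+1) x (x^2)) (-x⁻¹ * J k x (x^2) + fP (k+1) x * ((1-x)⁻¹ - (1+x)⁻¹)) x := by
  have := J_deriv k (a := 0) (b := 1/2) (α := fun x => x) (β := fun x => x^2) (α' := fun _ => 1) (β' := fun x => 2*x)
    (fun s _ => hasDerivAt_id' s) (fun s _ => by simpa using (hasDerivAt_id' s).fun_pow 2) (by fun_prop) (by fun_prop)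
    (fun s hs => by rw [abs_lt]; constructor <;> linarith [hs.1, hs.2])
    (fun s hs => by rw [abs_lt]; constructor <;> nlinarith [hs.1, hs.2]) h (xne h) (pow_ne_zero _ (xne h))
  refine this.congr_deriv ?_
  have e0 := xne h
  have e1 := x1ne h
  have e2 := x2ne h
  rw [show 1 - x^2 = (1-x)*(1+x) by ring]
  have a1 : 1/x - 2*x/x^2 = -x⁻¹ := by field_simp; ring
  have a2 : 2*x/((1-x)*(1+x)) = (1-x)⁻¹ - (1+x)⁻¹ := by field_simp; ring
  rw [a1, a2]; rfl

lemma x_cont (k : ℕ) : ContinuousOn (fun x => J k x (x^2)) I2 :=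
  J_cont k (α := fun x => x) (β := fun x => x^2) (by fun_prop) (by fun_prop) (fun s hs => by rw [abs_lt]; constructor <;> linarith [hs.1, hs.2])
    (fun s hs => by rw [abs_lt]; constructor <;> nlinarith [hs.1, hs.2])

lemma y_alpha (k : ℕ) {x : ℝ} (h : x ∈ Ioo (0:ℝ) (1/2)) :
    HasDerivAt (fun x => J (k+1) x (-x)) (- fP (k+1) x * (1+x)⁻¹) x := by
  have := J_deriv k (a := 0) (b := 1/2) (α := fun x => x) (β := fun x => -x) (α' := fun _ => 1) (β' := fun x => -1)
    (fun s _ => hasDerivAt_id' s) (fun s _ => (hasDerivAt_id' s).fun_neg) (by fun_prop) (by fun_prop)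
    (fun s hs => by rw [abs_lt]; constructor <;> linarith [hs.1, hs.2])
    (fun s hs => by rw [abs_lt]; constructor <;> linarith [hs.1, hs.2]) h (xne h) (neg_ne_zero.2 (xne h))
  refine this.congr_deriv ?_
  have e0 := xne h
  rw [show 1 - -x = 1+x by ring]
  have a1 : 1/x - -1/(-x) = 0 := by field_simp; ring
  rw [a1]; unfold fP; ring

lemma y_cont (k : ℕ) : ContinuousOn (fun x => J k x (-x)) I2 :=
  J_cont k (α := fun x => x) (β := fun x => -x) (by fun_prop) (by fun_prop) (fun s hs => by rw [abs_lt]; constructor <;> linarith [hs.1, hs.2])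
    (fun s hs => by rw [abs_lt]; constructor <;> linarith [hs.1, hs.2])

lemma x_zero {x : ℝ} (h : x ∈ Ioo (0:ℝ) (1/2)) : J 0 x (x^2) = fc x + fd x * (1-x)⁻¹ := by
  have e0 := xne h
  have e1 := x1ne h
  have l := logCD h
  have h1 := h.1
  have h2 := h.2
  rw [J_zero (by rw [abs_lt]; constructor <;> linarith) (by rw [abs_lt]; constructor <;> nlinarith) (by nlinarith)]
  rw [l]
  unfold fc fd
  rw [show x - x^2 = x*(1-x) by ring]
  field_simp
  ring

lemma fc0 : fc 0 = 0 := by simp [fc]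
lemma fd0 : fd 0 = 0 := by simp [fd]
lemma fa0 : fa 0 = 0 := by simp [fa]
lemma fP0 (k : ℕ) : fP k 0 = 0 := by simp [fP, Li_zero]
lemma fM0 (k : ℕ) : fM k 0 = 0 := by simp [fM, Li_zero]
lemma fN0 (k : ℕ) : fN k 0 = 0 := by simp [fN, Li_zero]
lemma fR0 (k : ℕ) : fR k 0 = 0 := by simp [fR, Li_zero]
lemma fQ0 (k : ℕ) : fQ k 0 = 0 := by simp [fQ, Li_zero]
lemma fA0 (k : ℕ) : fA k 0 = zeta' k := by simp [fA, zeta']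
lemma fB0 (k : ℕ) : fB k 0 = zeta' k := by simp [fB, zeta']
lemma fC0 (k : ℕ) : fC k 0 = zeta' k := by simp [fC, zeta']

lemma XY {x : ℝ} (h : x ∈ Ioo (0:ℝ) (1/2)) : x⁻¹ * (1-x)⁻¹ = x⁻¹ + (1-x)⁻¹ := by
  have e0 := xne h
  have e1 := x1ne h
  field_simp; ring

lemma x_one {x : ℝ} (h : x ∈ I2) : J 1 x (x^2) = fc x * fd x + fc x^2/2 + fP 2 x + fM 2 x := by
  have key := eq_of_deriv_zero' (f := fun x => J 1 x (x^2) - (fc x * fd x + fc x^2/2 + fP 2 x + fM 2 x)) h.1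
    (((x_cont 1).sub ((((cc.mul cd).add ((cc.pow 2).div_const 2)).add (cP le_rfl)).add (cM le_rfl))).mono (Icc_subset_Icc le_rfl h.2))
    (by
      intro y hy
      have hy : y ∈ Ioo (0:ℝ) (1/2) := ⟨hy.1, by linarith [hy.2, h.2]⟩
      refine ((x_alpha 0 hy).fun_sub (((((dc hy).fun_mul (dd hy)).fun_add (((dc hy).fun_pow 2).div_const 2)).fun_add (dP2 hy)).fun_add (dM2 hy))).congr_deriv ?_
      rw [x_zero hy, zero_add, P1 hy]
      have := XY hy
      linear_combination (- fd y) * this)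
  simp only [fc0, fd0, fP0, fM0, J_b0, ne_eq, OfNat.ofNat_ne_zero, not_false_eq_true, zero_pow] at key
  linarith

noncomputable def pJ2 (y : ℝ) : ℝ :=
    ((1:ℝ)) * ((fA 3 y))
    + ((-2:ℝ)) * ((fB 3 y))
    + ((1:ℝ)) * ((fC 3 y))
    + ((-1:ℝ)) * ((fM 3 y))
    + ((-1:ℝ)) * ((fP 3 y))
    + ((2:ℝ)) * ((fM 2 y) * (fc y))
    + ((2:ℝ)) * ((fP 2 y) * (fc y))
    + ((1:ℝ)) * ((fP 2 y) * (fd y))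
    + ((-2:ℝ) * zeta' 2) * ((fc y))
    + ((-3:ℝ) * zeta' 2) * ((fd y))
    + ((3/2:ℝ)) * ((fa y * fc y) * (fc y))
    + ((2:ℝ)) * ((fa y * fc y) * (fd y))
    + ((1/3:ℝ)) * ((fd y) * (fd y) * (fd y))

lemma pJ2_cont : ContinuousOn pJ2 I2 :=
    ((((((((((((((cA (k := 3) (by norm_num)).const_mul _).add
    ((cB (k := 3) (by norm_num)).const_mul _)).add
    ((cC (k := 3) (by norm_num)).const_mul _)).add
    ((cM (k := 3) (by norm_num)).const_mul _)).add
    ((cP (k := 3) (by norm_num)).const_mul _)).add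
    (((cM (k := 2) (by norm_num)).mul cc).const_mul _)).add
    (((cP (k := 2) (by norm_num)).mul cc).const_mul _)).add
    (((cP (k := 2) (by norm_num)).mul cd).const_mul _)).add
    (cc.const_mul _)).add
    (cd.const_mul _)).add
    ((cac.mul cc).const_mul _)).add
    ((cac.mul cd).const_mul _)).add
    (((cd.mul cd).mul cd).const_mul _))

set_option maxHeartbeats 1000000 in
lemma pJ2_deriv {x : ℝ} (h : x ∈ Ioo (0:ℝ) (1/2)) : HasDerivAt pJ2 (-x⁻¹ * (fc x * fd x + fc x^2/2 + fP 2 x + fM 2 x) + fP 2 x * ((1-x)⁻¹ - (1+x)⁻¹)) x := by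
  refine HasDerivAt.congr_deriv (((((((((((((((dA h 2).const_mul _).fun_add
    ((dB h 2).const_mul _)).fun_add
    ((dC h 2).const_mul _)).fun_add
    ((dM h 2).const_mul _)).fun_add
    ((dP h 2).const_mul _)).fun_add
    (((dM2 h).fun_mul (dc h)).const_mul _)).fun_add
    (((dP2 h).fun_mul (dc h)).const_mul _)).fun_add
    (((dP2 h).fun_mul (dd h)).const_mul _)).fun_add
    ((dc h).const_mul _)).fun_add
    ((dd h).const_mul _)).fun_add
    ((((da h).fun_mul (dc h)).fun_mul (dc h)).const_mul _)).fun_add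
    ((((da h).fun_mul (dc h)).fun_mul (dd h)).const_mul _)).fun_add
    ((((dd h).fun_mul (dd h)).fun_mul (dd h)).const_mul _))) ?_
  simp only [rA2 h, rR2 h, rB2 h, rC2 h, rN2 h, rQ2 h]
  ring

lemma x_two {x : ℝ} (h : x ∈ I2) : J 2 x (x^2) = pJ2 x := by
  have key := eq_of_deriv_zero' (f := fun x => J 2 x (x^2) - pJ2 x) h.1
    (((x_cont 2).sub pJ2_cont).mono (Icc_subset_Icc le_rfl h.2))
    (by
      intro y hy
      have hy : y ∈ Ioo (0:ℝ) (1/2) := ⟨hy.1, by linarith [hy.2, h.2]⟩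
      refine ((x_alpha 1 hy).fun_sub (pJ2_deriv hy)).congr_deriv ?_
      rw [x_one (Ioo_subset_Icc_self hy)]; ring)
  have : pJ2 0 = 0 := by
    unfold pJ2
    simp only [fa0, fc0, fd0, fP0, fM0, fA0, fB0, fC0]; ring
  simp only [this, J_b0, ne_eq, OfNat.ofNat_ne_zero, not_false_eq_true, zero_pow] at key
  linarith

noncomputable def pp (y : ℝ) : ℝ :=
    ((2:ℝ)) * ((fA 4 y))
    + ((-1:ℝ)) * ((fB 4 y))
    + ((-1/4:ℝ)) * ((fC 4 y))
    + ((3:ℝ)) * ((fM 4 y))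
    + ((-2:ℝ)) * ((fN 4 y))
    + ((-8:ℝ)) * ((fP 4 y))
    + ((1/4:ℝ)) * ((fQ 4 y))
    + ((-1:ℝ)) * ((fR 4 y))
    + ((-1:ℝ)) * ((fM 2 y) * (fP 2 y))
    + ((-6:ℝ)) * ((fa y * fM 3 y))
    + ((-1:ℝ)) * ((fM 3 y) * (fc y))
    + ((1:ℝ)) * ((fa y * fN 3 y))
    + ((3/2:ℝ)) * ((fP 2 y) * (fP 2 y))
    + ((2:ℝ)) * ((fa y * fP 3 y))
    + ((2:ℝ)) * ((fP 3 y) * (fc y))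
    + ((1:ℝ)) * ((fP 3 y) * (fd y))
    + ((-3/2:ℝ)) * ((fa y * fQ 3 y))
    + ((3:ℝ)) * ((fa y * fR 3 y))
    + ((-7/4:ℝ) * zeta' 3) * ((fc y))
    + ((-3/4:ℝ) * zeta' 3) * ((fd y))
    + ((4:ℝ)) * ((fa y * fM 2 y) * (fc y))
    + ((1:ℝ)) * ((fa y * fP 2 y) * (fc y))
    + ((-1:ℝ)) * ((fa y * fP 2 y) * (fd y))
    + ((-7/8:ℝ) * zeta' 2) * ((fc y) * (fc y))
    + ((1/4:ℝ) * zeta' 2) * ((fc y) * (fd y))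
    + ((5/8:ℝ) * zeta' 2) * ((fd y) * (fd y))
    + ((1/3:ℝ)) * ((fa y * fc y) * (fc y) * (fc y))
    + ((1/2:ℝ)) * ((fa y * fc y) * (fc y) * (fd y))
    + ((1/2:ℝ)) * ((fa y * fc y) * (fd y) * (fd y))
    + ((-1/6:ℝ)) * ((fa y * fd y) * (fd y) * (fd y))
    + ((-7/96:ℝ)) * ((fc y) * (fc y) * (fc y) * (fc y))
    + ((1/24:ℝ)) * ((fc y) * (fc y) * (fc y) * (fd y))
    + ((1/16:ℝ)) * ((fc y) * (fc y) * (fd y) * (fd y))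
    + ((1/24:ℝ)) * ((fc y) * (fd y) * (fd y) * (fd y))
    + ((-7/96:ℝ)) * ((fd y) * (fd y) * (fd y) * (fd y))

lemma pp_cont : ContinuousOn pp I2 :=
    ((((((((((((((((((((((((((((((((((((cA (k := 4) (by norm_num)).const_mul _).add
    ((cB (k := 4) (by norm_num)).const_mul _)).add
    ((cC (k := 4) (by norm_num)).const_mul _)).add
    ((cM (k := 4) (by norm_num)).const_mul _)).add
    ((cN (k := 4) (by norm_num)).const_mul _)).add
    ((cP (k := 4) (by norm_num)).const_mul _)).add
    ((cQ (k := 4) (by norm_num)).const_mul _)).add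
    ((cR (k := 4) (by norm_num)).const_mul _)).add
    (((cM (k := 2) (by norm_num)).mul (cP (k := 2) (by norm_num))).const_mul _)).add
    ((caM (k := 3) (by norm_num)).const_mul _)).add
    (((cM (k := 3) (by norm_num)).mul cc).const_mul _)).add
    ((caN (k := 3) (by norm_num)).const_mul _)).add
    (((cP (k := 2) (by norm_num)).mul (cP (k := 2) (by norm_num))).const_mul _)).add
    ((caP (k := 3) (by norm_num)).const_mul _)).add
    (((cP (k := 3) (by norm_num)).mul cc).const_mul _)).add
    (((cP (k := 3) (by norm_num)).mul cd).const_mul _)).add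
    ((caQ (k := 3) (by norm_num)).const_mul _)).add
    ((caR (k := 3) (by norm_num)).const_mul _)).add
    (cc.const_mul _)).add
    (cd.const_mul _)).add
    (((caM (k := 2) (by norm_num)).mul cc).const_mul _)).add
    (((caP (k := 2) (by norm_num)).mul cc).const_mul _)).add
    (((caP (k := 2) (by norm_num)).mul cd).const_mul _)).add
    ((cc.mul cc).const_mul _)).add
    ((cc.mul cd).const_mul _)).add
    ((cd.mul cd).const_mul _)).add
    (((cac.mul cc).mul cc).const_mul _)).add
    (((cac.mul cc).mul cd).const_mul _)).add
    (((cac.mul cd).mul cd).const_mul _)).add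
    (((cad.mul cd).mul cd).const_mul _)).add
    ((((cc.mul cc).mul cc).mul cc).const_mul _)).add
    ((((cc.mul cc).mul cc).mul cd).const_mul _)).add
    ((((cc.mul cc).mul cd).mul cd).const_mul _)).add
    ((((cc.mul cd).mul cd).mul cd).const_mul _)).add
    ((((cd.mul cd).mul cd).mul cd).const_mul _))

set_option maxHeartbeats 4000000 in
lemma pp_deriv {x : ℝ} (h : x ∈ Ioo (0:ℝ) (1/2)) : HasDerivAt pp (tI x + fP 3 x * (1+x)⁻¹ - (-x⁻¹ * pJ2 x + fP 3 x * ((1-x)⁻¹ - (1+x)⁻¹))) x := by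
  refine HasDerivAt.congr_deriv (((((((((((((((((((((((((((((((((((((dA h 3).const_mul _).fun_add
    ((dB h 3).const_mul _)).fun_add
    ((dC h 3).const_mul _)).fun_add
    ((dM h 3).const_mul _)).fun_add
    ((dN h 3).const_mul _)).fun_add
    ((dP h 3).const_mul _)).fun_add
    ((dQ h 3).const_mul _)).fun_add
    ((dR h 3).const_mul _)).fun_add
    (((dM2 h).fun_mul (dP2 h)).const_mul _)).fun_add
    (((da h).fun_mul (dM h 2)).const_mul _)).fun_add
    (((dM h 2).fun_mul (dc h)).const_mul _)).fun_add
    (((da h).fun_mul (dN h 2)).const_mul _)).fun_add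
    (((dP2 h).fun_mul (dP2 h)).const_mul _)).fun_add
    (((da h).fun_mul (dP h 2)).const_mul _)).fun_add
    (((dP h 2).fun_mul (dc h)).const_mul _)).fun_add
    (((dP h 2).fun_mul (dd h)).const_mul _)).fun_add
    (((da h).fun_mul (dQ h 2)).const_mul _)).fun_add
    (((da h).fun_mul (dR h 2)).const_mul _)).fun_add
    ((dc h).const_mul _)).fun_add
    ((dd h).const_mul _)).fun_add
    ((((da h).fun_mul (dM2 h)).fun_mul (dc h)).const_mul _)).fun_add
    ((((da h).fun_mul (dP2 h)).fun_mul (dc h)).const_mul _)).fun_add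
    ((((da h).fun_mul (dP2 h)).fun_mul (dd h)).const_mul _)).fun_add
    (((dc h).fun_mul (dc h)).const_mul _)).fun_add
    (((dc h).fun_mul (dd h)).const_mul _)).fun_add
    (((dd h).fun_mul (dd h)).const_mul _)).fun_add
    (((((da h).fun_mul (dc h)).fun_mul (dc h)).fun_mul (dc h)).const_mul _)).fun_add
    (((((da h).fun_mul (dc h)).fun_mul (dc h)).fun_mul (dd h)).const_mul _)).fun_add
    (((((da h).fun_mul (dc h)).fun_mul (dd h)).fun_mul (dd h)).const_mul _)).fun_add
    (((((da h).fun_mul (dd h)).fun_mul (dd h)).fun_mul (dd h)).const_mul _)).fun_add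
    (((((dc h).fun_mul (dc h)).fun_mul (dc h)).fun_mul (dc h)).const_mul _)).fun_add
    (((((dc h).fun_mul (dc h)).fun_mul (dc h)).fun_mul (dd h)).const_mul _)).fun_add
    (((((dc h).fun_mul (dc h)).fun_mul (dd h)).fun_mul (dd h)).const_mul _)).fun_add
    (((((dc h).fun_mul (dd h)).fun_mul (dd h)).fun_mul (dd h)).const_mul _)).fun_add
    (((((dd h).fun_mul (dd h)).fun_mul (dd h)).fun_mul (dd h)).const_mul _))) ?_
  have t : tI x = 4*fa x*fP 2 x*(x⁻¹ - (1+x)⁻¹) + (fP 2 x - fM 2 x)*(3*fa x*x⁻¹ + fa x*(1-x)⁻¹ - 2*fc x*x⁻¹) := by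
    unfold tI Lam fa fP fM fc; ring
  rw [t]
  unfold pJ2
  simp only [rA2 h, rR2 h, rB2 h, rC2 h, rN2 h, rQ2 h, rA3 h, rB3 h, rC3 h]
  ring

lemma int_tI_eq : ∫ x in (0:ℝ)..(1/2), tI x = J 3 (1/2) (-(1/2)) + J 3 (1/2) (1/4) + pp (1/2) - 3/4 * zeta' 4 := by
  have := intervalIntegral.integral_eq_sub_of_hasDerivAt_of_le (a := 0) (b := 1/2) (f := fun x => J 3 x (-x) + J 3 x (x^2) + pp x) (f' := tI)
    (by norm_num) (((y_cont 3).add (x_cont 3)).add pp_cont) (by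
      intro x hx
      refine (((y_alpha 2 hx).fun_add (x_alpha 2 hx)).fun_add (pp_deriv hx)).congr_deriv ?_
      rw [x_two (Ioo_subset_Icc_self hx)]; ring) int_tI
  rw [this]
  have p0 : pp 0 = 3/4 * zeta' 4 := by
    unfold pp
    simp only [fa0, fc0, fd0, fP0, fM0, fA0, fB0, fC0, fN0, fR0, fQ0]; ring
  rw [p0]
  simp only [neg_zero, J_b0, ne_eq, OfNat.ofNat_ne_zero, not_false_eq_true, zero_pow]
  norm_num

end H4P
end

section
open Set Real MeasureTheory

namespace H4P

noncomputable def qe (q : ℝ) : ℝ := log q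
noncomputable def qm (q : ℝ) : ℝ := log (q - 1)
noncomputable def qn (q : ℝ) : ℝ := log (1 + q)
noncomputable def qE (k : ℕ) (q : ℝ) : ℝ := Li k (1/q)
noncomputable def qG (k : ℕ) (q : ℝ) : ℝ := Li k (-(1/q))
noncomputable def qU (k : ℕ) (q : ℝ) : ℝ := Li k ((1-q)/2)
noncomputable def qW (k : ℕ) (q : ℝ) : ℝ := Li k ((q-1)/(2*q))
noncomputable def qK (k : ℕ) (q : ℝ) : ℝ := Li k (1 - (1/q)^2)
noncomputable def qY (k : ℕ) (q : ℝ) : ℝ := Li k (1/(1+q))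
noncomputable def qZ (k : ℕ) (q : ℝ) : ℝ := Li k (q/(1+q))
noncomputable def qH (k : ℕ) (q : ℝ) : ℝ := Li k (1-1/q)

lemma Li2m1 : Li 2 (-1) = - zeta' 2 / 2 := by
  have := Li_dup (k := 2) le_rfl (z := 1) (by simp)
  norm_num at this
  unfold zeta'; linarith
lemma Li3m1 : Li 3 (-1) = - 3/4*zeta' 3 := by
  have := Li_dup (k := 3) (by norm_num) (z := 1) (by simp)
  norm_num at this
  unfold zeta'; linarith
lemma Li4m1 : Li 4 (-1) = - 7/8*zeta' 4 := by
  have := Li_dup (k := 4) (by norm_num) (z := 1) (by simp)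
  norm_num at this
  unfold zeta'; linarith
lemma loghalf : log (1/2) = - log 2 := by rw [one_div, log_inv]
lemma Li2h : Li 2 (1/2) = zeta' 2/2 - log 2^2/2 := by
  have := Li2_refl (x := 1/2) (by norm_num) (by norm_num)
  rw [show (1-1/2:ℝ)=1/2 by norm_num, loghalf] at this
  linarith
lemma Li3h : Li 3 (1/2) = 7/8*zeta' 3 - zeta' 2 * log 2/2 + log 2^3/6 := by
  have := Li3_three (x := 1/2) (by norm_num) (by norm_num)
  rw [show (1/2:ℝ)/(1/2-1) = -1 by norm_num, Li3m1, show (1-1/2:ℝ)=1/2 by norm_num, loghalf] at this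
  linarith

section atoms
variable {q : ℝ} (h : q ∈ Ioo (1:ℝ) 2)
include h

lemma q0 : 0 < q := by linarith [h.1]
lemma qne : q ≠ 0 := (q0 h).ne'
lemma q1ne : q - 1 ≠ 0 := by linarith [h.1]
lemma q2ne : 1 + q ≠ 0 := by linarith [h.1]
lemma qi : 1/2 < 1/q ∧ 1/q < 1 := by
  constructor
  · rw [div_lt_div_iff₀ (by norm_num) (q0 h)]; linarith [h.2]
  · rw [div_lt_one (q0 h)]; exact h.1
lemma qi2 : 1/4 < (1/q)^2 ∧ (1/q)^2 < 1 := by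
  have := qi h
  constructor <;> nlinarith
lemma Wb : 0 < (q-1)/(2*q) ∧ (q-1)/(2*q) < 1/4 := by
  have := h.1; have := h.2; have := q0 h
  constructor
  · apply div_pos <;> linarith
  · rw [div_lt_iff₀ (by linarith)]; linarith
lemma Yb : 1/3 < 1/(1+q) ∧ 1/(1+q) < 1/2 := by
  have := h.1; have := h.2
  constructor
  · rw [div_lt_div_iff₀ (by norm_num) (by linarith)]; linarith
  · rw [div_lt_div_iff₀ (by linarith) (by norm_num)]; linarith
lemma Zeq : q/(1+q) = 1 - 1/(1+q) := by
  have := q2ne h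
  field_simp; ring

lemma lq : log (1/q) = - qe q := by unfold qe; rw [one_div, log_inv]
lemma lq2 : log ((1/q)^2) = - 2*qe q := by rw [log_pow, lq h]; push_cast; ring
lemma l1q : log (1 - 1/q) = qm q - qe q := by
  unfold qm qe; rw [← log_div (q1ne h) (qne h)]; congr 1; have := qne h; field_simp
lemma l1q' : log (1 - -(1/q)) = qn q - qe q := by
  unfold qn qe; rw [← log_div (q2ne h) (qne h)]; congr 1; have := qne h; field_simp; ring
lemma l1q2 : log (1 - (1/q)^2) = qm q + qn q - 2*qe q := by
  have a := qi h
  rw [show 1 - (1/q)^2 = (1-1/q)*(1 - -(1/q)) by ring, log_mul (by linarith) (by linarith), l1q h, l1q' h]; ring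
lemma lU : log (1 - (1-q)/2) = qn q - log 2 := by
  unfold qn; rw [← log_div (q2ne h) (by norm_num)]; congr 1; ring
lemma lW : log (1 - (q-1)/(2*q)) = qn q - log 2 - qe q := by
  unfold qn qe; rw [← log_div (q2ne h) (by norm_num), ← log_div (by have := q2ne h; positivity) (qne h)]; congr 1; have := qne h; field_simp; ring
lemma lY : log (1/(1+q)) = - qn q := by unfold qn; rw [one_div, log_inv]
lemma l1Y : log (1 - 1/(1+q)) = qe q - qn q := by
  unfold qe qn; rw [← log_div (qne h) (q2ne h), Zeq h]

lemma de : HasDerivAt qe q⁻¹ q := Real.hasDerivAt_log (qne h)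
lemma dm : HasDerivAt qm (q-1)⁻¹ q :=
  (dlog ((hasDerivAt_id' q).sub_const 1) (q1ne h)).congr_deriv (by ring)
lemma dn : HasDerivAt qn (1+q)⁻¹ q :=
  (dlog ((hasDerivAt_id' q).const_add 1) (q2ne h)).congr_deriv (by ring)

lemma dinv : HasDerivAt (fun q : ℝ => 1/q) (-(1/q)*q⁻¹) q := by
  refine ((hasDerivAt_const q 1).fun_div (hasDerivAt_id' q) (qne h)).congr_deriv ?_
  have := qne h
  field_simp; ring
lemma dE (k : ℕ) : HasDerivAt (qE (k+1)) (qE k q * -q⁻¹) q := by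
  have := qi h
  have := qne h
  refine dLiG k (dinv h) (by rw [abs_lt]; constructor <;> linarith) (by linarith) ?_ rfl
  field_simp
lemma dG (k : ℕ) : HasDerivAt (qG (k+1)) (qG k q * -q⁻¹) q := by
  have := qi h
  have := qne h
  refine dLiG k (dinv h).fun_neg (by rw [abs_lt]; constructor <;> linarith) (by linarith) ?_ rfl
  field_simp
lemma dU (k : ℕ) : HasDerivAt (qU (k+1)) (qU k q * (q-1)⁻¹) q := by
  have h1 := h.1; have h2 := h.2
  refine dLiG k (((hasDerivAt_id' q).const_sub 1).div_const 2) (by rw [abs_lt]; constructor <;> linarith) (by linarith) ?_ rfl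
  rw [show 1 - q = -(q-1) by ring]
  have := q1ne h
  field_simp
lemma dW0 : HasDerivAt (fun q : ℝ => (q-1)/(2*q)) (1/(2*q^2)) q := by
  have := qne h
  refine (((hasDerivAt_id' q).sub_const 1).fun_div ((hasDerivAt_id' q).const_mul 2) (by positivity)).congr_deriv ?_
  field_simp; ring
lemma dW (k : ℕ) : HasDerivAt (qW (k+1)) (qW k q * ((q-1)⁻¹ - q⁻¹)) q := by
  have := Wb h
  refine dLiG k (dW0 h) (by rw [abs_lt]; constructor <;> linarith) (by linarith) ?_ rfl
  have := qne h
  have := q1ne h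
  field_simp; ring
lemma dK (k : ℕ) : HasDerivAt (qK (k+1)) (qK k q * ((q-1)⁻¹ + (1+q)⁻¹ - 2*q⁻¹)) q := by
  have a := qi2 h
  have b := qi h
  refine dLiG k (((dinv h).fun_pow 2).const_sub 1) (by rw [abs_lt]; constructor <;> linarith) (by linarith) ?_ rfl
  have := qne h
  have := q1ne h
  have := q2ne h
  rw [show 1 - (1/q)^2 = (q-1)*(1+q)/q^2 by field_simp; ring]
  simp
  field_simp; ring
lemma dY (k : ℕ) : HasDerivAt (qY (k+1)) (qY k q * -(1+q)⁻¹) q := by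
  have a := Yb h
  have := q2ne h
  refine dLiG k ((hasDerivAt_const q 1).fun_div ((hasDerivAt_id' q).const_add 1) this) (by rw [abs_lt]; constructor <;> linarith) (by linarith) ?_ rfl
  field_simp; ring
lemma dZ (k : ℕ) : HasDerivAt (qZ (k+1)) (qZ k q * (q⁻¹ - (1+q)⁻¹)) q := by
  have a := Yb h
  have := q2ne h
  have := qne h
  have e := Zeq h
  refine dLiG k ((hasDerivAt_id' q).fun_div ((hasDerivAt_id' q).const_add 1) (q2ne h)) (by rw [abs_lt]; constructor <;> linarith) (by linarith) ?_ rfl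
  field_simp
lemma dH (k : ℕ) : HasDerivAt (qH (k+1)) (qH k q * ((q-1)⁻¹ - q⁻¹)) q := by
  have a := qi h
  have := qne h
  have := q1ne h
  refine dLiG k ((dinv h).const_sub 1) (by rw [abs_lt]; constructor <;> linarith) (by linarith) ?_ rfl
  rw [show 1 - 1/q = (q-1)/q by field_simp]
  field_simp; ring

lemma E1' : qE 1 q = - (qm q - qe q) := by
  have := qi h
  unfold qE; rw [Li_one (by rw [abs_lt]; constructor <;> linarith), l1q h]
lemma G1' : qG 1 q = - (qn q - qe q) := by
  have := qi h
  unfold qG; rw [Li_one (by rw [abs_lt]; constructor <;> linarith), l1q' h]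
lemma U1' : qU 1 q = - (qn q - log 2) := by
  have h1 := h.1; have h2 := h.2
  unfold qU; rw [Li_one (by rw [abs_lt]; constructor <;> linarith), lU h]
lemma W1' : qW 1 q = - (qn q - log 2 - qe q) := by
  have := Wb h
  unfold qW; rw [Li_one (by rw [abs_lt]; constructor <;> linarith), lW h]
lemma dE2 : HasDerivAt (qE 2) ((qm q - qe q) * q⁻¹) q := by
  refine (dE h 1).congr_deriv ?_; rw [E1' h]; ring
lemma dG2 : HasDerivAt (qG 2) ((qn q - qe q) * q⁻¹) q := by
  refine (dG h 1).congr_deriv ?_; rw [G1' h]; ring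
lemma dU2 : HasDerivAt (qU 2) (-(qn q - log 2) * (q-1)⁻¹) q := by
  refine (dU h 1).congr_deriv ?_; rw [U1' h]
lemma dW2 : HasDerivAt (qW 2) (-(qn q - log 2 - qe q) * ((q-1)⁻¹ - q⁻¹)) q := by
  refine (dW h 1).congr_deriv ?_; rw [W1' h]
lemma Eq2 (k : ℕ) (hk : 2 ≤ k) : Li k ((1/q)^2) = 2^k/2 * (qE k q + qG k q) := by
  have a := qi h
  have := Li_dup hk (z := 1/q) (by rw [abs_le]; constructor <;> linarith)
  unfold qE qG; linarith
lemma sK2 : qK 2 q = zeta' 2 + 2*qe q*(qm q + qn q - 2*qe q) - 2*qE 2 q - 2*qG 2 q := by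
  have a := qi2 h
  have := Li2_refl (x := (1/q)^2) (by linarith) (by linarith)
  rw [lq2 h, l1q2 h, Eq2 h 2 le_rfl] at this
  unfold qK; rw [this]; ring
lemma sY2 : qY 2 q = - qG 2 q - (qe q - qn q)^2/2 := by
  have a := qi h
  have := Li2_landen (x := -(1/q)) (by linarith) (by linarith)
  have e : -(1/q)/(-(1/q)-1) = 1/(1+q) := by
    rw [show -(1/q)-1 = -(1/q+1) by ring, neg_div_neg_eq]
    have := qne h; have := q2ne h
    rw [show 1/q+1 = (1+q)/q by field_simp]
    field_simp
  rw [e, l1q' h] at this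
  unfold qY qG; rw [this]; ring
lemma sZ2 : qZ 2 q = zeta' 2 + qn q*(qe q - qn q) - qY 2 q := by
  have a := Yb h
  have := Li2_refl (x := 1/(1+q)) (by linarith) (by linarith)
  rw [l1Y h, lY h, ← Zeq h] at this
  unfold qZ qY; rw [this]; ring
lemma sH2 : qH 2 q = zeta' 2 + qe q*(qm q - qe q) - qE 2 q := by
  have a := qi h
  have := Li2_refl (x := 1/q) (by linarith) (by linarith)
  rw [l1q h, lq h] at this
  unfold qH qE; rw [this]; ring
lemma sZ3 : qZ 3 q = zeta' 3 + (qe q - qn q)^3/6 + zeta' 2*(qe q - qn q) + qn q*(qe q - qn q)^2/2 - qY 3 q - qG 3 q := by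
  have a := Yb h
  have := Li3_three (x := 1/(1+q)) (by linarith) (by linarith)
  have e : 1/(1+q)/(1/(1+q) - 1) = -(1/q) := by
    have := qne h; have := q2ne h
    rw [show 1/(1+q) - 1 = -(q/(1+q)) by field_simp; ring]
    field_simp
  rw [e, l1Y h, lY h, ← Zeq h] at this
  unfold qZ qY qG; rw [this]; ring

end atoms

noncomputable def O3v (q : ℝ) : ℝ := zeta' 3 + (-2*qe q)^3/6 + zeta' 2*(-2*qe q) - (qm q+qn q-2*qe q)*(2*qe q)^2/2 - qK 3 q - 4*qE 3 q - 4*qG 3 q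

lemma dO1 {q : ℝ} (h : q ∈ Ioo (1:ℝ) 2) (h2 : q^2 < 2) : HasDerivAt (fun q : ℝ => Li 4 (1 - q^2)) (O3v q * ((q-1)⁻¹ + (1+q)⁻¹)) q := by
  have h1 := h.1
  have := qne h
  have := q1ne h
  have := q2ne h
  have a := qi2 h
  have b : 1 < q^2 := by nlinarith
  have c : 1/2 < (1/q)^2 := by
    rw [div_pow, one_pow, div_lt_div_iff₀ (by norm_num) (by linarith)]; linarith
  refine dLiG 3 (((hasDerivAt_id' q).fun_pow 2).const_sub 1) (by rw [abs_lt]; constructor <;> linarith) (by linarith) ?_ ?_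
  · rw [show 1 - q^2 = -((q-1)*(1+q)) by ring]
    simp
    field_simp; ring
  · have t := Li3_three (x := 1 - (1/q)^2) (by linarith) (by linarith)
    rw [sub_sub_cancel, l1q2 h, lq2 h, Eq2 h 3 (by norm_num)] at t
    have e : (1 - (1/q)^2)/(1 - (1/q)^2 - 1) = 1 - q^2 := by
      rw [show 1 - (1/q)^2 - 1 = -(1/q^2) by ring]
      field_simp; ring
    rw [e] at t
    rw [t]; unfold O3v qK; ring

lemma dO2 {q : ℝ} (h : q ∈ Ioo (1:ℝ) 2) (h2 : 2 < q^2) : HasDerivAt (fun q : ℝ => -Li 4 (1/(1 - q^2)) + 2 * Li 4 (-1)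
      - zeta' 2/2*(qm q + qn q)^2 - (qm q + qn q)^4/24) (O3v q * ((q-1)⁻¹ + (1+q)⁻¹)) q := by
  have h1 := h.1
  have := qne h
  have := q1ne h
  have := q2ne h
  have a := qi2 h
  have c : (1/q)^2 < 1/2 := by
    rw [div_pow, one_pow, div_lt_div_iff₀ (by linarith) (by norm_num)]; linarith
  have d := dLiG 3 (f := fun q : ℝ => 1/(1-q^2)) (x := q) (D := -((q-1)⁻¹ + (1+q)⁻¹)) ((hasDerivAt_const q 1).fun_div (((hasDerivAt_id' q).fun_pow 2).const_sub 1) (by linarith)) (by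
      rw [abs_div, abs_one, div_lt_one (by rw [abs_pos]; linarith), abs_of_neg (by linarith)]; linarith) (div_ne_zero one_ne_zero (by linarith)) (by
      rw [show 1 - q^2 = -((q-1)*(1+q)) by ring]
      simp
      field_simp; ring) rfl
  have dl := (dm h).fun_add (dn h)
  refine (((d.fun_neg.add_const _).fun_sub ((dl.fun_pow 2).const_mul _)).fun_sub ((dl.fun_pow 4).div_const _)).congr_deriv ?_
  have t := Li3_three (x := (1/q)^2) (by linarith) (by linarith)
  rw [l1q2 h, lq2 h, Eq2 h 3 (by norm_num)] at t
  have e : (1/q)^2/((1/q)^2 - 1) = 1/(1 - q^2) := by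
    have : 1 - q^2 ≠ 0 := by linarith
    rw [show (1/q)^2 - 1 = (1-q^2)/q^2 by field_simp]
    field_simp
  rw [e] at t
  rw [t]; unfold O3v qK; ring

section cont
abbrev I3 : Set ℝ := Icc (1:ℝ) 2
lemma ce : ContinuousOn qe I3 := ContinuousOn.log (by fun_prop) (fun y hy => by linarith [hy.1])
lemma cn : ContinuousOn qn I3 := ContinuousOn.log (by fun_prop) (fun y hy => by linarith [hy.1])
lemma ci : ContinuousOn (fun q : ℝ => 1/q) I3 :=
  ContinuousOn.div (by fun_prop) (by fun_prop) (fun y hy => by linarith [hy.1])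
lemma bi {q : ℝ} (h : q ∈ I3) : 1/2 ≤ 1/q ∧ 1/q ≤ 1 := by
  have : 0 < q := by linarith [h.1]
  constructor
  · rw [div_le_div_iff₀ (by norm_num) this]; linarith [h.2]
  · rw [div_le_one this]; exact h.1
lemma cem : ContinuousOn (fun q => qm q * qe q) I3 := by
  have cy : ContinuousOn (fun q : ℝ => 1 - 1/q) I3 := continuousOn_const.sub ci
  have c1 : ContinuousOn (fun q : ℝ => g 1 (1-1/q)) I3 := (cont_g_lt 1).comp cy (fun y hy => by
    have := bi hy
    constructor <;> linarith)
  have c2 : ContinuousOn (fun q : ℝ => (1-1/q)*log (1-1/q)) I3 := cont_xlog.comp_continuousOn cy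
  refine ((c2.mul c1).add (ce.mul ce)).congr ?_
  intro q hq
  simp only [Pi.mul_apply, Pi.add_apply]
  rcases eq_or_lt_of_le hq.1 with h1 | h1
  · subst h1; simp [qm, qe]
  · have hb := bi hq
    have q0 : q ≠ 0 := by linarith
    have e1 := log_one_sub (z := 1-1/q) (by rw [abs_lt]; constructor <;> linarith)
    have e2 : log (1 - 1/q) = qm q - qe q := by
      unfold qm qe; rw [← log_div (by linarith) q0]; congr 1; field_simp
    have e3 : log (1 - (1-1/q)) = - qe q := by rw [sub_sub_cancel, one_div, log_inv]; rfl
    rw [e3] at e1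
    have e4 : qe q = (1-1/q) * g 1 (1-1/q) := by linarith
    rw [e2]
    linear_combination (qm q - qe q) * e4
variable {k : ℕ} (hk : 2 ≤ k)
include hk
lemma cE : ContinuousOn (qE k) I3 := cLi hk ci (fun y hy => ⟨by linarith [(bi hy).1], (bi hy).2⟩)
lemma cG : ContinuousOn (qG k) I3 := cLi hk ci.neg (fun y hy => ⟨by linarith [(bi hy).2], by linarith [(bi hy).1]⟩)
lemma cU : ContinuousOn (qU k) I3 := cLi hk (by fun_prop) (fun y hy => ⟨by linarith [hy.2], by linarith [hy.1]⟩)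
lemma cW : ContinuousOn (qW k) I3 := by
  refine cLi hk (ContinuousOn.div (by fun_prop) (by fun_prop) (fun y hy => by linarith [hy.1])) ?_
  intro y hy
  have : 0 < 2*y := by linarith [hy.1]
  constructor
  · rw [le_div_iff₀ this]; linarith [hy.1]
  · rw [div_le_iff₀ this]; linarith [hy.1]
lemma cK : ContinuousOn (qK k) I3 := cLi hk (continuousOn_const.sub (ci.pow 2)) (fun y hy => ⟨by
  have := bi hy
  nlinarith, by nlinarith [bi hy]⟩)
lemma cY : ContinuousOn (qY k) I3 := by
  refine cLi hk (ContinuousOn.div (by fun_prop) (by fun_prop) (fun y hy => by linarith [hy.1])) ?_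
  intro y hy
  have : 0 < 1+y := by linarith [hy.1]
  constructor
  · rw [le_div_iff₀ this]; linarith [hy.1]
  · rw [div_le_iff₀ this]; linarith [hy.1]
lemma cZ : ContinuousOn (qZ k) I3 := by
  refine cLi hk (ContinuousOn.div (by fun_prop) (by fun_prop) (fun y hy => by linarith [hy.1])) ?_
  intro y hy
  have : 0 < 1+y := by linarith [hy.1]
  constructor
  · rw [le_div_iff₀ this]; linarith [hy.1]
  · rw [div_le_iff₀ this]; linarith [hy.1]
lemma cH : ContinuousOn (qH k) I3 := cLi hk (continuousOn_const.sub ci) (fun y hy => ⟨by linarith [(bi hy).2], by linarith [(bi hy).1]⟩)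
end cont

section J
lemma a_deriv (k : ℕ) {q : ℝ} (h : q ∈ Ioo (1:ℝ) 2) :
    HasDerivAt (fun q => J (k+1) (1/2) ((1-q)/2)) (-(q-1)⁻¹ * J k (1/2) ((1-q)/2) - Li (k+1) (1/2) * (1+q)⁻¹) q := by
  have h1 := h.1
  have := J_deriv k (a := 1) (b := 2) (α := fun _ => 1/2) (β := fun x => (1-x)/2) (α' := fun _ => 0) (β' := fun x => -1/2)
    (fun s _ => hasDerivAt_const _ _) (fun s _ => ((hasDerivAt_id' s).const_sub 1).div_const 2) (by fun_prop) (by fun_prop)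
    (fun s hs => by rw [abs_lt]; constructor <;> norm_num)
    (fun s hs => by rw [abs_lt]; constructor <;> linarith [hs.1, hs.2]) h (by norm_num) (by linarith)
  refine this.congr_deriv ?_
  have e1 := q1ne h
  have e2 := q2ne h
  have a1 : (0:ℝ)/(1/2) - -1/2/((1-q)/2) = -(q-1)⁻¹ := by
    rw [show 1-q = -(q-1) by ring]; field_simp; ring
  have a2 : -1/2/(1-(1-q)/2) = -(1+q)⁻¹ := by
    rw [show 1-(1-q)/2 = (1+q)/2 by ring]; field_simp
  rw [a1, a2]; ring
lemma a_cont (k : ℕ) : ContinuousOn (fun q => J k (1/2) ((1-q)/2)) I3 :=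
  J_cont k (α := fun _ => 1/2) (β := fun x => (1-x)/2) (by fun_prop) (by fun_prop)
    (fun s hs => by rw [abs_lt]; constructor <;> norm_num)
    (fun s hs => by rw [abs_lt]; constructor <;> linarith [hs.1, hs.2])
lemma a_zero {q : ℝ} (h : q ∈ Ioo (1:ℝ) 2) : J 0 (1/2) ((1-q)/2) = qn q * q⁻¹ - log 2 := by
  have h1 := h.1
  have h2 := h.2
  have e0 := qne h
  rw [J_zero (by rw [abs_lt]; constructor <;> norm_num) (by rw [abs_lt]; constructor <;> linarith) (by linarith), lU h,
    show (1 - 1/2:ℝ) = 1/2 by norm_num, loghalf]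
  rw [show 1/2 - (1-q)/2 = q/2 by ring]
  field_simp; ring
lemma b_bd {s : ℝ} (hs : s ∈ Icc (1:ℝ) 2) : |(s-1)/(2*s)| < 1 := by
  have : 0 < 2*s := by linarith [hs.1]
  rw [abs_lt]
  constructor
  · rw [lt_div_iff₀ this]; linarith [hs.1]
  · rw [div_lt_iff₀ this]; linarith [hs.1]
lemma b_deriv (k : ℕ) {q : ℝ} (h : q ∈ Ioo (1:ℝ) 2) :
    HasDerivAt (fun q => J (k+1) (1/2) ((q-1)/(2*q))) (-((q-1)⁻¹ - q⁻¹) * J k (1/2) ((q-1)/(2*q)) + Li (k+1) (1/2) * (q⁻¹ - (1+q)⁻¹)) q := by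
  have h1 := h.1
  have e0 := qne h
  have e1 := q1ne h
  have e2 := q2ne h
  have := J_deriv k (a := 1) (b := 2) (α := fun _ => 1/2) (β := fun x => (x-1)/(2*x)) (α' := fun _ => 0) (β' := fun x => 1/(2*x^2))
    (fun s _ => hasDerivAt_const _ _) (fun s hs => by
      have := hs.1
      have : s ≠ 0 := by linarith
      refine (((hasDerivAt_id' s).sub_const 1).fun_div ((hasDerivAt_id' s).const_mul 2) (by positivity)).congr_deriv ?_
      field_simp; ring) (by fun_prop) (by
      refine ContinuousOn.div (by fun_prop) (by fun_prop) ?_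
      intro s hs; have := hs.1; positivity)
    (fun s hs => by rw [abs_lt]; constructor <;> norm_num)
    (fun s hs => b_bd hs) h (by norm_num) (Wb h).1.ne'
  refine this.congr_deriv ?_
  have a1 : (0:ℝ)/(1/2) - 1/(2*q^2)/((q-1)/(2*q)) = -((q-1)⁻¹ - q⁻¹) := by
    field_simp; ring
  have a2 : 1/(2*q^2)/(1-(q-1)/(2*q)) = q⁻¹ - (1+q)⁻¹ := by
    rw [show 1-(q-1)/(2*q) = (1+q)/(2*q) by field_simp; ring]; field_simp; ring
  rw [a1, a2]
lemma b_cont (k : ℕ) : ContinuousOn (fun q => J k (1/2) ((q-1)/(2*q))) I3 :=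
  J_cont k (α := fun _ => 1/2) (β := fun x => (x-1)/(2*x)) (by fun_prop)
    (ContinuousOn.div (by fun_prop) (by fun_prop) (fun s hs => by have := hs.1; positivity))
    (fun s hs => by rw [abs_lt]; constructor <;> norm_num) (fun s hs => b_bd hs)
lemma b_zero {q : ℝ} (h : q ∈ Ioo (1:ℝ) 2) : J 0 (1/2) ((q-1)/(2*q)) = q*(qn q - qe q) - log 2 := by
  have a := Wb h
  have e0 := qne h
  rw [J_zero (by rw [abs_lt]; constructor <;> norm_num) (by rw [abs_lt]; constructor <;> linarith) (by linarith), lW h,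
    show (1 - 1/2:ℝ) = 1/2 by norm_num, loghalf]
  rw [show 1/2 - (q-1)/(2*q) = 1/(2*q) by field_simp; ring]
  field_simp; ring
lemma Li1h : Li 1 (1/2) = log 2 := by
  rw [Li_one (by rw [abs_lt]; constructor <;> norm_num), show (1 - 1/2:ℝ) = 1/2 by norm_num, loghalf]; ring

end J

end H4P
end

section
open Set Real MeasureTheory

namespace H4P

lemma qe1 : qe 1 = 0 := by simp [qe]
lemma qm1 : qm 1 = 0 := by simp [qm]
lemma qn1 : qn 1 = log 2 := by simp only [qn]; norm_num
lemma qE1 (k : ℕ) : qE k 1 = zeta' k := by simp [qE, zeta']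
lemma qG1 (k : ℕ) : qG k 1 = Li k (-1) := by simp [qG]
lemma qU1 (k : ℕ) : qU k 1 = 0 := by simp [qU, Li_zero]
lemma qW1 (k : ℕ) : qW k 1 = 0 := by simp [qW, Li_zero]
lemma qK1 (k : ℕ) : qK k 1 = 0 := by simp [qK, Li_zero]
lemma qH1 (k : ℕ) : qH k 1 = 0 := by simp [qH, Li_zero]
lemma qY1 (k : ℕ) : qY k 1 = Li k (1/2) := by simp only [qY]; norm_num
lemma qZ1 (k : ℕ) : qZ k 1 = Li k (1/2) := by simp only [qZ]; norm_num
lemma ja1 (k : ℕ) : J k (1/2) ((1-1)/2) = 0 := by rw [sub_self, zero_div, J_b0]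
lemma jb1 (k : ℕ) : J k (1/2) ((1-1)/(2*1)) = 0 := by rw [sub_self, zero_div, J_b0]

lemma XYq {q : ℝ} (h : q ∈ Ioo (1:ℝ) 2) : q⁻¹ * (q-1)⁻¹ = (q-1)⁻¹ - q⁻¹ := by
  have e0 := qne h
  have e1 := q1ne h
  field_simp; ring

lemma sW2 {q : ℝ} (h : q ∈ I3) : qW 2 q = qU 2 q + qG 2 q - qE 2 q + qm q * qe q - qe q^2/2 - qe q * log 2 + 3/2*zeta' 2 := by
  have key := eq_of_deriv_zero' (f := fun q => qW 2 q - (qU 2 q + qG 2 q - qE 2 q + qm q * qe q - qe q^2/2 - qe q * log 2)) h.1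
    (((cW le_rfl).sub ((((((cU le_rfl).add (cG le_rfl)).sub (cE le_rfl)).add cem).sub ((ce.pow 2).div_const 2)).sub (ce.mul continuousOn_const))).mono (Icc_subset_Icc le_rfl h.2))
    (by
      intro y hy
      have h : y ∈ Ioo (1:ℝ) 2 := ⟨hy.1, by linarith [hy.2, h.2]⟩
      refine ((dW2 h).fun_sub ((((((dU2 h).fun_add (dG2 h)).fun_sub (dE2 h)).fun_add ((dm h).fun_mul (de h))).fun_sub (((de h).fun_pow 2).div_const 2)).fun_sub ((de h).mul_const _))).congr_deriv ?_
      ring)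
  simp only [qe1, qm1, qE1, qG1, qU1, qW1, Li2m1] at key
  linarith

lemma a_one {q : ℝ} (h : q ∈ I3) : J 1 (1/2) ((1-q)/2) = zeta' 2/2 + qe q^2/2 + qG 2 q + qU 2 q - log 2 * qn q + log 2^2 := by
  have key := eq_of_deriv_zero' (f := fun q => J 1 (1/2) ((1-q)/2) - (qe q^2/2 + qG 2 q + qU 2 q - log 2 * qn q)) h.1
    (((a_cont 1).sub (((((ce.pow 2).div_const 2).add (cG le_rfl)).add (cU le_rfl)).sub (continuousOn_const.mul cn))).mono (Icc_subset_Icc le_rfl h.2))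
    (by
      intro y hy
      have h : y ∈ Ioo (1:ℝ) 2 := ⟨hy.1, by linarith [hy.2, h.2]⟩
      refine ((a_deriv 0 h).fun_sub ((((((de h).fun_pow 2).div_const 2).fun_add (dG2 h)).fun_add (dU2 h)).fun_sub ((dn h).const_mul _))).congr_deriv ?_
      rw [a_zero h, zero_add, Li1h]
      linear_combination (- qn y) * XYq h)
  simp only [qe1, qn1, qG1, qU1, Li2m1, ja1] at key
  linarith

lemma b_one {q : ℝ} (h : q ∈ I3) : J 1 (1/2) ((q-1)/(2*q)) = - qG 2 q + qW 2 q - log 2 * (qn q - qe q) - zeta' 2/2 + log 2^2 := by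
  have key := eq_of_deriv_zero' (f := fun q => J 1 (1/2) ((q-1)/(2*q)) - (- qG 2 q + qW 2 q - log 2 * (qn q - qe q))) h.1
    (((b_cont 1).sub ((((cG le_rfl).neg).add (cW le_rfl)).sub (continuousOn_const.mul (cn.sub ce)))).mono (Icc_subset_Icc le_rfl h.2))
    (by
      intro y hy
      have h : y ∈ Ioo (1:ℝ) 2 := ⟨hy.1, by linarith [hy.2, h.2]⟩
      refine ((b_deriv 0 h).fun_sub ((((dG2 h).fun_neg).fun_add (dW2 h)).fun_sub (((dn h).fun_sub (de h)).const_mul _))).congr_deriv ?_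
      rw [b_zero h, zero_add, Li1h]
      have e : y * ((y-1)⁻¹ - y⁻¹) = (y-1)⁻¹ := by
        have e0 := qne h
        have e1 := q1ne h
        field_simp; ring
      linear_combination (- (qn y - qe y)) * e)
  simp only [qe1, qn1, qG1, qW1, Li2m1, jb1] at key
  linarith

noncomputable def pa (y : ℝ) : ℝ :=
    ((1:ℝ)) * ((qE 3 y))
    + ((2:ℝ)) * ((qG 3 y))
    + ((-1:ℝ)) * ((qH 3 y))
    + ((1/2:ℝ)) * ((qK 3 y))
    + ((-1:ℝ)) * ((qU 3 y))
    + ((1:ℝ)) * ((qY 3 y))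
    + ((-3/8:ℝ) * zeta' 3)
    + ((1:ℝ)) * ((qE 2 y) * (qn y))
    + ((-1:ℝ) * log 2) * ((qU 2 y))
    + ((1/2:ℝ) * log 2 * zeta' 2)
    + ((-1:ℝ) * zeta' 2) * ((qn y))
    + ((-1:ℝ)) * ((qe y) * (qe y) * (qe y))
    + ((1/2:ℝ)) * ((qm y * qe y) * (qe y))
    + ((3/2:ℝ)) * ((qe y) * (qe y) * (qn y))
    + ((-1:ℝ)) * ((qm y * qe y) * (qn y))
    + ((-1/2:ℝ) * log 2 * log 2 * log 2)
    + ((1/2:ℝ) * log 2 * log 2) * ((qn y))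
    + ((-1/6:ℝ)) * ((qn y) * (qn y) * (qn y))

lemma pa_cont : ContinuousOn pa I3 :=
    (((((((((((((((((((cE (k := 3) (by norm_num)).const_mul _).add
    ((cG (k := 3) (by norm_num)).const_mul _)).add
    ((cH (k := 3) (by norm_num)).const_mul _)).add
    ((cK (k := 3) (by norm_num)).const_mul _)).add
    ((cU (k := 3) (by norm_num)).const_mul _)).add
    ((cY (k := 3) (by norm_num)).const_mul _)).add
    continuousOn_const).add
    (((cE (k := 2) (by norm_num)).mul cn).const_mul _)).add
    ((cU (k := 2) (by norm_num)).const_mul _)).add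
    continuousOn_const).add
    (cn.const_mul _)).add
    (((ce.mul ce).mul ce).const_mul _)).add
    ((cem.mul ce).const_mul _)).add
    (((ce.mul ce).mul cn).const_mul _)).add
    ((cem.mul cn).const_mul _)).add
    continuousOn_const).add
    (cn.const_mul _)).add
    (((cn.mul cn).mul cn).const_mul _))

set_option maxHeartbeats 1000000 in
lemma pa_deriv {q : ℝ} (h : q ∈ Ioo (1:ℝ) 2) : HasDerivAt pa (-(q-1)⁻¹ * (zeta' 2/2 + qe q^2/2 + qG 2 q + qU 2 q - log 2 * qn q + log 2^2) - (zeta' 2/2 - log 2^2/2) * (1+q)⁻¹) q := by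
  refine HasDerivAt.congr_deriv ((((((((((((((((((((dE h 2).const_mul _).fun_add
    ((dG h 2).const_mul _)).fun_add
    ((dH h 2).const_mul _)).fun_add
    ((dK h 2).const_mul _)).fun_add
    ((dU h 2).const_mul _)).fun_add
    ((dY h 2).const_mul _)).fun_add
    (hasDerivAt_const _ _)).fun_add
    (((dE2 h).fun_mul (dn h)).const_mul _)).fun_add
    ((dU2 h).const_mul _)).fun_add
    (hasDerivAt_const _ _)).fun_add
    ((dn h).const_mul _)).fun_add
    ((((de h).fun_mul (de h)).fun_mul (de h)).const_mul _)).fun_add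
    ((((dm h).fun_mul (de h)).fun_mul (de h)).const_mul _)).fun_add
    ((((de h).fun_mul (de h)).fun_mul (dn h)).const_mul _)).fun_add
    ((((dm h).fun_mul (de h)).fun_mul (dn h)).const_mul _)).fun_add
    (hasDerivAt_const _ _)).fun_add
    ((dn h).const_mul _)).fun_add
    ((((dn h).fun_mul (dn h)).fun_mul (dn h)).const_mul _))) ?_
  simp only [sK2 h, sZ2 h, sY2 h, sH2 h, sW2 (Ioo_subset_Icc_self h)]
  ring

lemma a_two {q : ℝ} (h : q ∈ I3) : J 2 (1/2) ((1-q)/2) = pa q := by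
  have key := eq_of_deriv_zero' (f := fun q => J 2 (1/2) ((1-q)/2) - pa q) h.1
    (((a_cont 2).sub pa_cont).mono (Icc_subset_Icc le_rfl h.2))
    (by
      intro y hy
      have h : y ∈ Ioo (1:ℝ) 2 := ⟨hy.1, by linarith [hy.2, h.2]⟩
      refine ((a_deriv 1 h).fun_sub (pa_deriv h)).congr_deriv ?_
      rw [a_one (Ioo_subset_Icc_self h), Li2h]; ring)
  have : pa 1 = 0 := by
    unfold pa
    simp only [qe1, qm1, qn1, qE1, qG1, qU1, qK1, qH1, qY1, Li3m1, Li3h]; ring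
  simp only [this, ja1] at key
  linarith

noncomputable def pb (y : ℝ) : ℝ :=
    ((-1:ℝ)) * ((qG 3 y))
    + ((1:ℝ)) * ((qH 3 y))
    + ((-1/2:ℝ)) * ((qK 3 y))
    + ((-1:ℝ)) * ((qW 3 y))
    + ((-1:ℝ)) * ((qY 3 y))
    + ((1/8:ℝ) * zeta' 3)
    + ((1:ℝ)) * ((qE 2 y) * (qe y))
    + ((1:ℝ) * log 2) * ((qE 2 y))
    + ((-1:ℝ)) * ((qE 2 y) * (qn y))
    + ((-1:ℝ) * log 2) * ((qG 2 y))
    + ((-1:ℝ) * log 2) * ((qU 2 y))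
    + ((-1:ℝ) * log 2 * zeta' 2)
    + ((4/3:ℝ)) * ((qe y) * (qe y) * (qe y))
    + ((1/2:ℝ) * log 2) * ((qe y) * (qe y))
    + ((-1:ℝ)) * ((qm y * qe y) * (qe y))
    + ((-3/2:ℝ)) * ((qe y) * (qe y) * (qn y))
    + ((1/2:ℝ) * log 2 * log 2) * ((qe y))
    + ((-1:ℝ) * log 2) * ((qm y * qe y))
    + ((1:ℝ)) * ((qm y * qe y) * (qn y))
    + ((-1/2:ℝ) * log 2 * log 2 * log 2)
    + ((1/2:ℝ) * log 2 * log 2) * ((qn y))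
    + ((1/6:ℝ)) * ((qn y) * (qn y) * (qn y))

lemma pb_cont : ContinuousOn pb I3 :=
    (((((((((((((((((((((((cG (k := 3) (by norm_num)).const_mul _).add
    ((cH (k := 3) (by norm_num)).const_mul _)).add
    ((cK (k := 3) (by norm_num)).const_mul _)).add
    ((cW (k := 3) (by norm_num)).const_mul _)).add
    ((cY (k := 3) (by norm_num)).const_mul _)).add
    continuousOn_const).add
    (((cE (k := 2) (by norm_num)).mul ce).const_mul _)).add
    ((cE (k := 2) (by norm_num)).const_mul _)).add
    (((cE (k := 2) (by norm_num)).mul cn).const_mul _)).add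
    ((cG (k := 2) (by norm_num)).const_mul _)).add
    ((cU (k := 2) (by norm_num)).const_mul _)).add
    continuousOn_const).add
    (((ce.mul ce).mul ce).const_mul _)).add
    ((ce.mul ce).const_mul _)).add
    ((cem.mul ce).const_mul _)).add
    (((ce.mul ce).mul cn).const_mul _)).add
    (ce.const_mul _)).add
    (cem.const_mul _)).add
    ((cem.mul cn).const_mul _)).add
    continuousOn_const).add
    (cn.const_mul _)).add
    (((cn.mul cn).mul cn).const_mul _))

set_option maxHeartbeats 1000000 in
lemma pb_deriv {q : ℝ} (h : q ∈ Ioo (1:ℝ) 2) : HasDerivAt pb (-((q-1)⁻¹ - q⁻¹) * (- qG 2 q + qW 2 q - log 2 * (qn q - qe q) - zeta' 2/2 + log 2^2) + (zeta' 2/2 - log 2^2/2) * (q⁻¹ - (1+q)⁻¹)) q := by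
  refine HasDerivAt.congr_deriv ((((((((((((((((((((((((dG h 2).const_mul _).fun_add
    ((dH h 2).const_mul _)).fun_add
    ((dK h 2).const_mul _)).fun_add
    ((dW h 2).const_mul _)).fun_add
    ((dY h 2).const_mul _)).fun_add
    (hasDerivAt_const _ _)).fun_add
    (((dE2 h).fun_mul (de h)).const_mul _)).fun_add
    ((dE2 h).const_mul _)).fun_add
    (((dE2 h).fun_mul (dn h)).const_mul _)).fun_add
    ((dG2 h).const_mul _)).fun_add
    ((dU2 h).const_mul _)).fun_add
    (hasDerivAt_const _ _)).fun_add
    ((((de h).fun_mul (de h)).fun_mul (de h)).const_mul _)).fun_add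
    (((de h).fun_mul (de h)).const_mul _)).fun_add
    ((((dm h).fun_mul (de h)).fun_mul (de h)).const_mul _)).fun_add
    ((((de h).fun_mul (de h)).fun_mul (dn h)).const_mul _)).fun_add
    ((de h).const_mul _)).fun_add
    (((dm h).fun_mul (de h)).const_mul _)).fun_add
    ((((dm h).fun_mul (de h)).fun_mul (dn h)).const_mul _)).fun_add
    (hasDerivAt_const _ _)).fun_add
    ((dn h).const_mul _)).fun_add
    ((((dn h).fun_mul (dn h)).fun_mul (dn h)).const_mul _))) ?_
  simp only [sK2 h, sZ2 h, sY2 h, sH2 h, sW2 (Ioo_subset_Icc_self h)]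
  ring

lemma b_two {q : ℝ} (h : q ∈ I3) : J 2 (1/2) ((q-1)/(2*q)) = pb q := by
  have key := eq_of_deriv_zero' (f := fun q => J 2 (1/2) ((q-1)/(2*q)) - pb q) h.1
    (((b_cont 2).sub pb_cont).mono (Icc_subset_Icc le_rfl h.2))
    (by
      intro y hy
      have h : y ∈ Ioo (1:ℝ) 2 := ⟨hy.1, by linarith [hy.2, h.2]⟩
      refine ((b_deriv 1 h).fun_sub (pb_deriv h)).congr_deriv ?_
      rw [b_one (Ioo_subset_Icc_self h), Li2h]; ring)
  have : pb 1 = 0 := by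
    unfold pb
    simp only [qe1, qm1, qn1, qE1, qG1, qU1, qW1, qK1, qH1, qY1, Li2m1, Li3m1, Li3h]; ring
  simp only [this, jb1] at key
  linarith

noncomputable def ps (y : ℝ) : ℝ :=
    ((1/4:ℝ)) * ((qK 4 y))
    + ((1:ℝ)) * ((qU 4 y))
    + ((1:ℝ)) * ((qW 4 y))
    + ((1:ℝ)) * ((qY 4 y))
    + ((1:ℝ)) * ((qZ 4 y))
    + ((1/2:ℝ) * zeta' 2) * ((qE 2 y))
    + ((1:ℝ)) * ((qE 3 y) * (qn y))
    + ((-1/2:ℝ) * zeta' 2) * ((qG 2 y))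
    + ((1:ℝ)) * ((qH 3 y) * (qe y))
    + ((-1:ℝ) * zeta' 2) * ((qU 2 y))
    + ((1:ℝ) * log 2) * ((qU 3 y))
    + ((1:ℝ) * log 2) * ((qW 3 y))
    + ((-1:ℝ) * zeta' 3) * ((qn y))
    + ((-1/2:ℝ) * log 2 * log 2) * ((qE 2 y))
    + ((1/2:ℝ) * log 2 * log 2) * ((qG 2 y))
    + ((1:ℝ) * log 2 * log 2) * ((qU 2 y))
    + ((-1/2:ℝ) * zeta' 2) * ((qm y * qe y))
    + ((3/2:ℝ) * zeta' 2) * ((qe y) * (qn y))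
    + ((1:ℝ) * log 2 * zeta' 2) * ((qn y))
    + ((-1/2:ℝ) * zeta' 2) * ((qn y) * (qn y))
    + ((1/24:ℝ)) * ((qe y) * (qe y) * (qe y) * (qe y))
    + ((-1/2:ℝ)) * ((qe y) * (qe y) * (qe y) * (qn y))
    + ((-1/4:ℝ) * log 2 * log 2) * ((qe y) * (qe y))
    + ((1/2:ℝ)) * ((qm y * qe y) * (qe y) * (qn y))
    + ((1/4:ℝ)) * ((qe y) * (qe y) * (qn y) * (qn y))
    + ((-1/3:ℝ) * log 2 * log 2 * log 2) * ((qe y))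
    + ((1/2:ℝ) * log 2 * log 2) * ((qm y * qe y))
    + ((-1/6:ℝ)) * ((qe y) * (qn y) * (qn y) * (qn y))
    + ((-1/3:ℝ) * log 2 * log 2 * log 2) * ((qn y))
    + ((1/12:ℝ)) * ((qn y) * (qn y) * (qn y) * (qn y))

lemma ps_cont : ContinuousOn ps I3 :=
    (((((((((((((((((((((((((((((((cK (k := 4) (by norm_num)).const_mul _).add
    ((cU (k := 4) (by norm_num)).const_mul _)).add
    ((cW (k := 4) (by norm_num)).const_mul _)).add
    ((cY (k := 4) (by norm_num)).const_mul _)).add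
    ((cZ (k := 4) (by norm_num)).const_mul _)).add
    ((cE (k := 2) (by norm_num)).const_mul _)).add
    (((cE (k := 3) (by norm_num)).mul cn).const_mul _)).add
    ((cG (k := 2) (by norm_num)).const_mul _)).add
    (((cH (k := 3) (by norm_num)).mul ce).const_mul _)).add
    ((cU (k := 2) (by norm_num)).const_mul _)).add
    ((cU (k := 3) (by norm_num)).const_mul _)).add
    ((cW (k := 3) (by norm_num)).const_mul _)).add
    (cn.const_mul _)).add
    ((cE (k := 2) (by norm_num)).const_mul _)).add
    ((cG (k := 2) (by norm_num)).const_mul _)).add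
    ((cU (k := 2) (by norm_num)).const_mul _)).add
    (cem.const_mul _)).add
    ((ce.mul cn).const_mul _)).add
    (cn.const_mul _)).add
    ((cn.mul cn).const_mul _)).add
    ((((ce.mul ce).mul ce).mul ce).const_mul _)).add
    ((((ce.mul ce).mul ce).mul cn).const_mul _)).add
    ((ce.mul ce).const_mul _)).add
    (((cem.mul ce).mul cn).const_mul _)).add
    ((((ce.mul ce).mul cn).mul cn).const_mul _)).add
    (ce.const_mul _)).add
    (cem.const_mul _)).add
    ((((ce.mul cn).mul cn).mul cn).const_mul _)).add
    (cn.const_mul _)).add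
    ((((cn.mul cn).mul cn).mul cn).const_mul _))

set_option maxHeartbeats 4000000 in
lemma ps_deriv {q : ℝ} (h : q ∈ Ioo (1:ℝ) 2) : HasDerivAt ps (-(q-1)⁻¹ * (pa q + pb q) + (pb q + (7/8*zeta' 3 - zeta' 2 * log 2/2 + log 2^3/6)) * q⁻¹
    - 2*(7/8*zeta' 3 - zeta' 2 * log 2/2 + log 2^3/6)*(1+q)⁻¹ - 1/4*(O3v q * ((q-1)⁻¹ + (1+q)⁻¹))) q := by
  refine HasDerivAt.congr_deriv ((((((((((((((((((((((((((((((((dK h 3).const_mul _).fun_add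
    ((dU h 3).const_mul _)).fun_add
    ((dW h 3).const_mul _)).fun_add
    ((dY h 3).const_mul _)).fun_add
    ((dZ h 3).const_mul _)).fun_add
    ((dE2 h).const_mul _)).fun_add
    (((dE h 2).fun_mul (dn h)).const_mul _)).fun_add
    ((dG2 h).const_mul _)).fun_add
    (((dH h 2).fun_mul (de h)).const_mul _)).fun_add
    ((dU2 h).const_mul _)).fun_add
    ((dU h 2).const_mul _)).fun_add
    ((dW h 2).const_mul _)).fun_add
    ((dn h).const_mul _)).fun_add
    ((dE2 h).const_mul _)).fun_add
    ((dG2 h).const_mul _)).fun_add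
    ((dU2 h).const_mul _)).fun_add
    (((dm h).fun_mul (de h)).const_mul _)).fun_add
    (((de h).fun_mul (dn h)).const_mul _)).fun_add
    ((dn h).const_mul _)).fun_add
    (((dn h).fun_mul (dn h)).const_mul _)).fun_add
    (((((de h).fun_mul (de h)).fun_mul (de h)).fun_mul (de h)).const_mul _)).fun_add
    (((((de h).fun_mul (de h)).fun_mul (de h)).fun_mul (dn h)).const_mul _)).fun_add
    (((de h).fun_mul (de h)).const_mul _)).fun_add
    (((((dm h).fun_mul (de h)).fun_mul (de h)).fun_mul (dn h)).const_mul _)).fun_add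
    (((((de h).fun_mul (de h)).fun_mul (dn h)).fun_mul (dn h)).const_mul _)).fun_add
    ((de h).const_mul _)).fun_add
    (((dm h).fun_mul (de h)).const_mul _)).fun_add
    (((((de h).fun_mul (dn h)).fun_mul (dn h)).fun_mul (dn h)).const_mul _)).fun_add
    ((dn h).const_mul _)).fun_add
    (((((dn h).fun_mul (dn h)).fun_mul (dn h)).fun_mul (dn h)).const_mul _))) ?_
  unfold pa pb O3v
  simp only [sK2 h, sZ2 h, sY2 h, sH2 h, sZ3 h, sW2 (Ioo_subset_Icc_self h)]
  ring

noncomputable def SS (q : ℝ) : ℝ := J 3 (1/2) ((1-q)/2) + J 3 (1/2) ((q-1)/(2*q)) - ps q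
lemma SS_cont : ContinuousOn SS I3 := ((a_cont 3).add (b_cont 3)).sub ps_cont
lemma SS_deriv {q : ℝ} (h : q ∈ Ioo (1:ℝ) 2) : HasDerivAt SS (1/4*(O3v q * ((q-1)⁻¹ + (1+q)⁻¹))) q := by
  refine (((a_deriv 2 h).fun_add (b_deriv 2 h)).fun_sub (ps_deriv h)).congr_deriv ?_
  rw [a_two (Ioo_subset_Icc_self h), b_two (Ioo_subset_Icc_self h), Li3h]; ring

lemma sq2 : (1:ℝ) < √2 ∧ √2 < 2 ∧ √2^2 = 2 := by
  have := Real.sq_sqrt (show (0:ℝ) ≤ 2 by norm_num)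
  have h0 := Real.sqrt_nonneg 2
  refine ⟨by nlinarith, by nlinarith, this⟩

lemma SS_a : SS (√2) = SS 1 + Li 4 (-1)/4 := by
  obtain ⟨s1, s2, s3⟩ := sq2
  have key := eq_of_deriv_zero' (f := fun q => SS q - 1/4*Li 4 (1-q^2)) s1.le
    ((SS_cont.mono (Icc_subset_Icc le_rfl s2.le)).sub (continuousOn_const.mul (cLi (by norm_num) (by fun_prop) (fun y hy => by
      have := hy.1; have := hy.2
      constructor <;> nlinarith))))
    (by
      intro y hy
      have := hy.1; have := hy.2
      have h : y ∈ Ioo (1:ℝ) 2 := ⟨hy.1, by linarith [hy.2]⟩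
      refine ((SS_deriv h).fun_sub ((dO1 h (by nlinarith)).const_mul _)).congr_deriv ?_
      ring)
  simp only [s3] at key
  norm_num [Li_zero] at key
  linarith

lemma SS_b : SS 2 = SS (√2) + 1/4*(-Li 4 (-(1/3)) + Li 4 (-1) - zeta' 2/2*(log 3)^2 - (log 3)^4/24) := by
  obtain ⟨s1, s2, s3⟩ := sq2
  have key := eq_of_deriv_zero' (f := fun q => SS q - 1/4*(-Li 4 (1/(1 - q^2)) + 2 * Li 4 (-1)
      - zeta' 2/2*(qm q + qn q)^2 - (qm q + qn q)^4/24)) s2.le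
    (by
      have cm : ContinuousOn qm (Icc (√2) 2) := ContinuousOn.log (by fun_prop) (fun y hy => by linarith [hy.1])
      have cl : ContinuousOn (fun q => qm q + qn q) (Icc (√2) 2) := cm.add (cn.mono (Icc_subset_Icc s1.le le_rfl))
      refine (SS_cont.mono (Icc_subset_Icc s1.le le_rfl)).sub (continuousOn_const.mul ?_)
      refine (((ContinuousOn.add (ContinuousOn.neg ?_) continuousOn_const).sub (continuousOn_const.mul (cl.pow 2))).sub ((cl.pow 4).div_const 24))
      refine cLi (by norm_num) (ContinuousOn.div (by fun_prop) (by fun_prop) ?_) ?_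
      · intro y hy
        have := hy.1; nlinarith
      · intro y hy
        have h2 : 1 - y^2 ≤ -1 := by have := hy.1; nlinarith
        constructor
        · rw [le_div_iff_of_neg (by linarith)]; linarith
        · rw [div_le_iff_of_neg (by linarith)]; linarith)
    (by
      intro y hy
      have := hy.1; have := hy.2
      have h : y ∈ Ioo (1:ℝ) 2 := ⟨by linarith, hy.2⟩
      refine ((SS_deriv h).fun_sub ((dO2 h (by nlinarith)).const_mul _)).congr_deriv ?_
      ring)
  have l0 : qm (√2) + qn (√2) = 0 := by
    unfold qm qn
    rw [← log_mul (by linarith) (by linarith), show (√2 - 1)*(1+√2) = √2^2 - 1 by ring, s3]; norm_num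
  have l1 : qm 2 + qn 2 = log 3 := by unfold qm qn; norm_num
  simp only [l0, l1, s3] at key
  rw [show (1/(1-2^2):ℝ) = -(1/3) by norm_num, show (1/(1-2):ℝ) = -1 by norm_num] at key
  linear_combination key

lemma S_eq : J 3 (1/2) (-(1/2)) + J 3 (1/2) (1/4) = ps 2 - ps 1 + 1/4*(-Li 4 (-(1/3)) + 2*Li 4 (-1) - zeta' 2/2*(log 3)^2 - (log 3)^4/24) := by
  have h := SS_b
  rw [SS_a] at h
  have e1 : SS 1 = - ps 1 := by unfold SS; rw [ja1, jb1]; ring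
  have e2 : SS 2 = J 3 (1/2) (-(1/2)) + J 3 (1/2) (1/4) - ps 2 := by unfold SS; norm_num
  rw [e1, e2] at h
  linarith

end H4P
end

section
open Set Real MeasureTheory

namespace H4P

lemma zk (k : ℕ) (hk : k ≠ 0) {s : ℝ} (hs : HasSum (fun n : ℕ => 1 / (n:ℝ)^k) s) : zeta' k = s := by
  have h2 := (hasSum_nat_add_iff' (f := fun n : ℕ => 1 / (n:ℝ)^k) 1).2 hs
  simp only [Finset.range_one, Finset.sum_singleton, Nat.cast_zero, zero_pow hk, div_zero, sub_zero] at h2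
  unfold zeta' Li
  rw [← h2.tsum_eq]
  congr 1; ext n; push_cast; simp

lemma z2sq : zeta' 2 ^ 2 = 5/2 * zeta' 4 := by
  rw [zk 2 (by norm_num) hasSum_zeta_two, zk 4 (by norm_num) hasSum_zeta_four]; ring

lemma l32 : log (3/2) = log 3 - log 2 := log_div (by norm_num) (by norm_num)
lemma l34 : log (3/4) = log 3 - 2*log 2 := by
  rw [log_div (by norm_num) (by norm_num), show (4:ℝ) = 2^2 by norm_num, log_pow]; norm_num
lemma l14 : log (1/4) = - 2*log 2 := by
  rw [log_div (by norm_num) (by norm_num), show (4:ℝ) = 2^2 by norm_num, log_pow]; norm_num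
lemma l23 : log (2/3) = log 2 - log 3 := log_div (by norm_num) (by norm_num)
lemma l13 : log (1/3) = - log 3 := by rw [log_div (by norm_num) (by norm_num)]; norm_num

lemma v2q : Li 2 (1/4) = zeta' 2 - log 2^2 + 2*Li 2 (-(1/2)) := by
  have := Li_dup (k := 2) le_rfl (z := 1/2) (by rw [abs_le]; constructor <;> norm_num)
  rw [Li2h, show ((1/2:ℝ))^2 = 1/4 by norm_num] at this; linarith
lemma v3q : Li 3 (1/4) = 4*(7/8*zeta' 3 - zeta' 2 * log 2/2 + log 2^3/6) + 4*Li 3 (-(1/2)) := by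
  have := Li_dup (k := 3) (by norm_num) (z := 1/2) (by rw [abs_le]; constructor <;> norm_num)
  rw [Li3h, show ((1/2:ℝ))^2 = 1/4 by norm_num] at this; linarith
lemma v4q : Li 4 (1/4) = 8*Li 4 (1/2) + 8*Li 4 (-(1/2)) := by
  have := Li_dup (k := 4) (by norm_num) (z := 1/2) (by rw [abs_le]; constructor <;> norm_num)
  rw [show ((1/2:ℝ))^2 = 1/4 by norm_num] at this; linarith
lemma v2t : Li 2 (1/3) = - Li 2 (-(1/2)) - (log 3 - log 2)^2/2 := by
  have := Li2_landen (x := -(1/2)) (by norm_num) (by norm_num)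
  rw [show (-(1/2)/(-(1/2)-1):ℝ) = 1/3 by norm_num, show (1 - -(1/2):ℝ) = 3/2 by norm_num, l32] at this
  exact this
lemma v2mt : Li 2 (-(1/3)) = - Li 2 (1/4) - (log 3 - 2*log 2)^2/2 := by
  have := Li2_landen (x := 1/4) (by norm_num) (by norm_num)
  rw [show (1/4/(1/4-1):ℝ) = -(1/3) by norm_num, show (1 - 1/4:ℝ) = 3/4 by norm_num, l34] at this
  exact this
lemma v3t : Li 3 (2/3) = zeta' 3 + (log 2 - log 3)^3/6 + zeta' 2*(log 2 - log 3) + log 3*(log 2 - log 3)^2/2 - Li 3 (1/3) - Li 3 (-(1/2)) := by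
  have := Li3_three (x := 1/3) (by norm_num) (by norm_num)
  rw [show (1/3/(1/3-1):ℝ) = -(1/2) by norm_num, show (1 - 1/3:ℝ) = 2/3 by norm_num, l23, l13] at this
  linarith
lemma v3f : Li 3 (3/4) = zeta' 3 + (log 3 - 2*log 2)^3/6 + zeta' 2*(log 3 - 2*log 2) + log 2*(log 3 - 2*log 2)^2 - Li 3 (1/4) - Li 3 (-(1/3)) := by
  have := Li3_three (x := 1/4) (by norm_num) (by norm_num)
  rw [show (1/4/(1/4-1):ℝ) = -(1/3) by norm_num, show (1 - 1/4:ℝ) = 3/4 by norm_num, l34, l14] at this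
  linarith

lemma fah : fa (1/2) = - log 2 := loghalf
lemma fch : fc (1/2) = - log 2 := by unfold fc; rw [show (1-1/2:ℝ) = 1/2 by norm_num, loghalf]
lemma fdh : fd (1/2) = log 3 - log 2 := by unfold fd; rw [show (1+1/2:ℝ) = 3/2 by norm_num, l32]
lemma fPh (k : ℕ) : fP k (1/2) = Li k (1/2) := rfl
lemma fMh (k : ℕ) : fM k (1/2) = Li k (-(1/2)) := rfl
lemma fAh (k : ℕ) : fA k (1/2) = Li k (1/2) := by unfold fA; norm_num
lemma fBh (k : ℕ) : fB k (1/2) = Li k (2/3) := by unfold fB; norm_num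
lemma fCh (k : ℕ) : fC k (1/2) = Li k (3/4) := by unfold fC; norm_num
lemma fNh (k : ℕ) : fN k (1/2) = Li k (-1) := by unfold fN; norm_num
lemma fRh (k : ℕ) : fR k (1/2) = Li k (1/3) := by unfold fR; norm_num
lemma fQh (k : ℕ) : fQ k (1/2) = Li k (-(1/3)) := by unfold fQ; norm_num
lemma qe2 : qe 2 = log 2 := rfl
lemma qm2 : qm 2 = 0 := by unfold qm; norm_num
lemma qn2 : qn 2 = log 3 := by unfold qn; norm_num
lemma qE2 (k : ℕ) : qE k 2 = Li k (1/2) := rfl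
lemma qG2 (k : ℕ) : qG k 2 = Li k (-(1/2)) := rfl
lemma qU2 (k : ℕ) : qU k 2 = Li k (-(1/2)) := by unfold qU; norm_num
lemma qW2 (k : ℕ) : qW k 2 = Li k (1/4) := by unfold qW; norm_num
lemma qK2 (k : ℕ) : qK k 2 = Li k (3/4) := by unfold qK; norm_num
lemma qY2 (k : ℕ) : qY k 2 = Li k (1/3) := by unfold qY; norm_num
lemma qZ2 (k : ℕ) : qZ k 2 = Li k (2/3) := by unfold qZ; norm_num
lemma qH2 (k : ℕ) : qH k 2 = Li k (1/2) := by unfold qH; norm_num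

lemma J2rel : pJ2 (1/2) = pb 2 := by
  rw [← x_two ⟨by norm_num, le_rfl⟩, ← b_two ⟨by norm_num, le_rfl⟩]; norm_num

end H4P
end

open H4P

/-- The integer relation
`16·H₄(1/2) = ζ(4) + 48·Li₄(−1/2) − 8·ζ(2)·Li₂(1/4)`
`  + (12·Li₃(1/4) + 16·ζ(2)·log(3) − 42·ζ(3))·log(2)`
`  + (12·Li₂(1/4) − 4·ζ(2))·log²(2) − 8·log(3)·log³(2) + 10·log⁴(2)`. -/
theorem H4_half_integer_relation :
    16 * H4 (1 / 2)
      = zeta' 4 + 48 * Li 4 (-(1 / 2)) - 8 * zeta' 2 * Li 2 (1 / 4)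
        + (12 * Li 3 (1 / 4) + 16 * zeta' 2 * Real.log 3 - 42 * zeta' 3) * Real.log 2
        + (12 * Li 2 (1 / 4) - 4 * zeta' 2) * (Real.log 2) ^ 2
        - 8 * Real.log 3 * (Real.log 2) ^ 3 + 10 * (Real.log 2) ^ 4 := by
  have h1 := H4_T
  rw [int_tI_eq, S_eq] at h1
  have h2 := J2rel
  unfold pJ2 pb at h2
  unfold ps pp Lam at h1
  simp only [qe1, qm1, qn1, qE1, qG1, qU1, qW1, qK1, qH1, qY1, qZ1, fah, fch, fdh, fPh, fMh, fAh, fBh, fCh, fNh, fRh, fQh,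
    qe2, qm2, qn2, qE2, qG2, qU2, qW2, qK2, qY2, qZ2, qH2] at h1 h2
  simp only [v3t, v3f, v2mt, v2t, v4q, v3q, v2q, Li2h, Li3h, Li2m1, Li3m1, Li4m1] at h1 h2 ⊢
  have h3 := z2sq
  linear_combination 4 * h1 - 4 * Real.log 2 * h2 - 1/2 * h3
end

section
/- For every positive integer N, the finite sum rule Σ_{n=1}^{N} n·ρ(n) = ∫_0^N ρ(x) dx holds; consequently, since ∫_0^∞ ρ(x) dx = e^γ, the full sum satisfies Σ_{n≥1} n·ρ(n) = e^γ, where γ is the Euler–Mascheroni constant. -/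
/-- For every positive integer `N`, the finite sum rule
`∑_{n=1}^{N} n·ρ(n) = ∫_0^N ρ(x) dx` holds; consequently, since
`∫_0^∞ ρ(x) dx = e^γ`, the full sum satisfies `∑_{n≥1} n·ρ(n) = e^γ`,
with `γ` the Euler–Mascheroni constant. -/
theorem dickman_sum_rule
    (ρ : ℝ → ℝ)
    (hρcont : ContinuousOn ρ (Set.Ici 0))
    (hρinit : ∀ u : ℝ, 0 ≤ u → u ≤ 1 → ρ u = 1)
    (hρderiv : ∀ u : ℝ, 1 < u → HasDerivAt ρ (-ρ (u - 1) / u) u)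
    (hI : (∫ x in Set.Ioi (0 : ℝ), ρ x) = Real.exp Real.eulerMascheroniConstant) :
    (∀ N : ℕ, 0 < N →
      ∑ n ∈ Finset.Icc 1 N, (n : ℝ) * ρ (n : ℝ) = ∫ x in (0 : ℝ)..(N : ℝ), ρ x) ∧
    ∑' n : ℕ, ((n : ℝ) + 1) * ρ ((n : ℝ) + 1) = Real.exp Real.eulerMascheroniConstant := by
  have ii : ∀ a b : ℝ, 0 ≤ a → 0 ≤ b → IntervalIntegrable ρ MeasureTheory.volume a b := by
    intro a b ha hb
    apply ContinuousOn.intervalIntegrable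
    apply hρcont.mono
    intro x hx
    exact le_trans (le_min ha hb) hx.1
  have key : ∀ b : ℝ, 1 ≤ b → b * ρ b = ∫ x in (b - 1)..b, ρ x := by
    intro b hb
    have hs : IntervalIntegrable (fun u => ρ (u - 1)) MeasureTheory.volume 1 b := by
      apply ContinuousOn.intervalIntegrable
      apply hρcont.comp (by fun_prop)
      intro x hx
      rw [Set.uIcc_of_le hb] at hx
      simp only [Set.mem_Ici]
      linarith [hx.1]
    have h := intervalIntegral.integral_eq_sub_of_hasDerivAt_of_le
      (f := fun u => u * ρ u) (f' := fun u => ρ u - ρ (u - 1)) hb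
      (continuousOn_id.mul (hρcont.mono (fun x hx => le_trans zero_le_one hx.1)))
      (fun x hx => by
        have hx0 : x ≠ 0 := by linarith [hx.1]
        have := (hasDerivAt_id x).mul (hρderiv x hx.1)
        refine this.congr_deriv ?_
        simp only [id]
        field_simp
        ring)
      ((ii 1 b (by norm_num) (by linarith)).sub hs)
    rw [intervalIntegral.integral_sub (ii 1 b (by norm_num) (by linarith)) hs,
      intervalIntegral.integral_comp_sub_right (fun u => ρ u) 1] at h
    have h1 : ∫ x in (0:ℝ)..1, ρ x = 1 := by
      rw [intervalIntegral.integral_congr (g := fun _ => (1:ℝ))]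
      · simp
      · intro x hx
        rw [Set.uIcc_of_le zero_le_one] at hx
        exact hρinit x hx.1 hx.2
    have h2 := intervalIntegral.integral_add_adjacent_intervals
      (ii 0 1 le_rfl zero_le_one) (ii 1 b zero_le_one (by linarith))
    have h3 := intervalIntegral.integral_add_adjacent_intervals
      (ii 0 (b-1) le_rfl (by linarith)) (ii (b-1) b (by linarith) (by linarith))
    have h4 := hρinit 1 zero_le_one le_rfl
    simp only [sub_self, h4] at h
    linarith
  have key' : ∀ n : ℕ, ((n : ℝ) + 1) * ρ ((n : ℝ) + 1) = ∫ x in (n : ℝ)..((n : ℝ) + 1), ρ x := by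
    intro n
    have := key ((n : ℝ) + 1) (by linarith [n.cast_nonneg (α := ℝ)])
    rwa [add_sub_cancel_right] at this
  refine ⟨?_, ?_⟩
  · intro N _
    induction N with
    | zero => simp
    | succ k ih =>
      have ih' : ∑ n ∈ Finset.Icc 1 k, (n : ℝ) * ρ (n : ℝ) = ∫ x in (0 : ℝ)..(k : ℝ), ρ x := by
        rcases Nat.eq_zero_or_pos k with rfl | hk
        · simp
        · exact ih hk
      rw [Finset.sum_Icc_succ_top (by omega), ih']
      push_cast
      rw [key' k]
      exact intervalIntegral.integral_add_adjacent_intervals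
        (ii _ _ le_rfl k.cast_nonneg) (ii _ _ k.cast_nonneg (by positivity))
  · have hint : MeasureTheory.IntegrableOn ρ (Set.Ioi 0) := by
      by_contra hn
      rw [MeasureTheory.integral_undef hn] at hI
      exact (Real.exp_pos _).ne hI
    have hU : (⋃ n : ℕ, Set.Ioc (n : ℝ) ((n : ℝ) + 1)) = Set.Ioi 0 := by
      ext x
      simp only [Set.mem_iUnion, Set.mem_Ioc, Set.mem_Ioi]
      constructor
      · rintro ⟨n, h, _⟩
        exact lt_of_le_of_lt n.cast_nonneg h
      · intro hx
        have hc : 0 < ⌈x⌉₊ := Nat.ceil_pos.mpr hx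
        obtain ⟨m, hm⟩ := Nat.exists_eq_succ_of_ne_zero hc.ne'
        refine ⟨m, Nat.lt_ceil.mp (by omega), ?_⟩
        have := Nat.le_ceil x
        rw [hm] at this
        push_cast at this
        exact this
    have hd : Pairwise (Function.onFun Disjoint (fun n : ℕ => Set.Ioc (n : ℝ) ((n : ℝ) + 1))) := by
      intro a b hab
      refine Set.disjoint_left.mpr ?_
      rintro x ⟨h1, h2⟩ ⟨h3, h4⟩
      apply hab
      have e1 : (a : ℝ) < (b : ℝ) + 1 := by linarith
      have e2 : (b : ℝ) < (a : ℝ) + 1 := by linarith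
      norm_cast at e1 e2
      omega
    have hS := MeasureTheory.hasSum_integral_iUnion (μ := MeasureTheory.volume) (f := ρ)
      (fun n : ℕ => measurableSet_Ioc) hd (by rw [hU]; exact hint)
    rw [hU, hI] at hS
    rw [← hS.tsum_eq]
    refine tsum_congr fun n => ?_
    rw [key' n, intervalIntegral.integral_of_le (by linarith)]
end

section
/- For every integer k ≥ 1, the Furry probability at argument k+1 satisfies 0 < P_k(k+1) < 1/(k!)². -/
/-- For every integer `k ≥ 1`, the Furry probability at argument `k+1`
satisfies `0 < P_k(k+1) < 1/(k!)²`. -/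
theorem furry_at_k_plus_one
    (P : ℕ → ℝ → ℝ)
    (hP0 : ∀ u : ℝ, 0 ≤ u → P 0 u = 1)
    (hPcont : ∀ k : ℕ, ContinuousOn (P (k + 1)) (Set.Ici ((k : ℝ) + 1)))
    (hPinit : ∀ k : ℕ, P (k + 1) ((k : ℝ) + 1) = 0)
    (hPderiv : ∀ k : ℕ, ∀ u : ℝ, (k : ℝ) + 1 < u →
      HasDerivAt (P (k + 1)) (P k (u - 1) / u) u) :
    ∀ k : ℕ, 1 ≤ k →
      0 < P k ((k : ℝ) + 1) ∧ P k ((k : ℝ) + 1) < 1 / ((k.factorial : ℝ)) ^ 2 := by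
  have step : ∀ k : ℕ, (∀ u : ℝ, (k : ℝ) < u →
      0 < P k u ∧ P k u ≤ (u - k) ^ k / (k.factorial : ℝ) ^ 2) →
      ∀ u : ℝ, (k : ℝ) + 1 < u → 0 < P (k + 1) u ∧
        P (k + 1) u < (u - (k + 1)) ^ (k + 1) / ((k + 1).factorial : ℝ) ^ 2 := by
    intro k ih u hu
    have hk : (0 : ℝ) ≤ k := Nat.cast_nonneg k
    constructor
    · have hm : StrictMonoOn (P (k + 1)) (Set.Ici ((k : ℝ) + 1)) := by
        apply strictMonoOn_of_deriv_pos (convex_Ici _) (hPcont k)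
        intro x hx
        rw [interior_Ici, Set.mem_Ioi] at hx
        rw [(hPderiv k x hx).deriv]
        exact div_pos (ih (x - 1) (by linarith)).1 (by linarith)
      have := hm (Set.self_mem_Ici) (Set.mem_Ici.2 hu.le) hu
      rwa [hPinit k] at this
    · have hd : ∀ x : ℝ, HasDerivAt
          (fun x : ℝ => (x - (k + 1)) ^ (k + 1) / ((k + 1).factorial : ℝ) ^ 2)
          ((x - (k + 1)) ^ k / (k.factorial : ℝ) ^ 2 / (k + 1)) x := by
        intro x
        have h := ((((hasDerivAt_id x).sub_const ((k : ℝ) + 1)).pow (k + 1)).div_const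
          (((k + 1).factorial : ℝ) ^ 2))
        refine h.congr_deriv ?_
        have hf : (k.factorial : ℝ) ≠ 0 := by positivity
        have hk1 : (k : ℝ) + 1 ≠ 0 := by positivity
        rw [Nat.factorial_succ]
        simp only [id, Nat.add_sub_cancel]
        push_cast
        field_simp
      have hm : StrictMonoOn (fun x : ℝ =>
          (x - (k + 1)) ^ (k + 1) / ((k + 1).factorial : ℝ) ^ 2 - P (k + 1) x)
          (Set.Ici ((k : ℝ) + 1)) := by
        apply strictMonoOn_of_deriv_pos (convex_Ici _)
        · exact ContinuousOn.sub (fun x _ => (hd x).continuousAt.continuousWithinAt) (hPcont k)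
        intro x hx
        rw [interior_Ici, Set.mem_Ioi] at hx
        rw [((hd x).fun_sub (hPderiv k x hx)).deriv, sub_pos]
        obtain ⟨h1, h2⟩ := ih (x - 1) (by linarith)
        have e : x - 1 - (k : ℝ) = x - (k + 1) := by ring
        rw [e] at h2
        calc P k (x - 1) / x < P k (x - 1) / (k + 1) :=
              div_lt_div_of_pos_left h1 (by positivity) hx
          _ ≤ _ := by gcongr
      have := hm (Set.self_mem_Ici) (Set.mem_Ici.2 hu.le) hu
      simp only [hPinit k, sub_self] at this
      simp at this
      simpa using this
  have main : ∀ k : ℕ, ∀ u : ℝ, (k : ℝ) < u →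
      0 < P k u ∧ P k u ≤ (u - k) ^ k / (k.factorial : ℝ) ^ 2 := by
    intro k
    induction k with
    | zero =>
      intro u hu
      rw [hP0 u (by simpa using hu.le)]
      simp
    | succ k ih =>
      intro u hu
      push_cast at hu
      have := step k ih u hu
      refine ⟨this.1, ?_⟩
      push_cast at this ⊢
      exact this.2.le
  intro k hk
  obtain ⟨n, rfl⟩ : ∃ n, k = n + 1 := ⟨k - 1, by omega⟩
  have := step n (main n) (((n + 1 : ℕ) : ℝ) + 1) (by push_cast; linarith)
  refine ⟨this.1, this.2.trans_eq ?_⟩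
  push_cast
  simp
end
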